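/- Let Ω ⊂ ℝ² be a bounded, open, simply connected domain satisfying Assumption (R), with Ω_B⁺ := {x ∈ Ω : B(x) > 0} nonempty, and let ψ̂₀ ∈ C⁰(closure(Ω_B⁺)) ∩ C²(Ω_B⁺) satisfy Δψ̂₀ = B in Ω_B⁺ and ψ̂₀ = 0 on ∂Ω_B⁺. If the zero set B⁻¹(0) is either a compact C^{2,α} closed simple curve contained in Ω, or a C^{2,α} simple arc crossing ∂Ω transversally away from the corner points, then limsup_{h→0⁺} h·log λ₋^D(h,B,Ω) < 2·inf_{Ω_B⁺} ψ̂₀ (strict inequality). -/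

import Mathlib

open MeasureTheory Set Filter Topology

noncomputable section

/-- First partial derivative (in the direction `x₁`) of a function on `ℝ × ℝ`. -/
def pd1 {E : Type*} [NormedAddCommGroup E] [NormedSpace ℝ E] (u : ℝ × ℝ → E) (x : ℝ × ℝ) : E :=
  fderiv ℝ u x (1, 0)

/-- Second partial derivative (in the direction `x₂`) of a function on `ℝ × ℝ`. -/
def pd2 {E : Type*} [NormedAddCommGroup E] [NormedSpace ℝ E] (u : ℝ × ℝ → E) (x : ℝ × ℝ) : E :=
  fderiv ℝ u x (0, 1)

/-- The Laplacian on `ℝ × ℝ`. -/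
def lap (ψ : ℝ × ℝ → ℝ) (x : ℝ × ℝ) : ℝ := pd1 (pd1 ψ) x + pd2 (pd2 ψ) x

/-- Test functions for the Dirichlet variational problems on `Ω`:
nonzero smooth compactly supported functions with support in `Ω`. -/
def IsTestFun (Ω : Set (ℝ × ℝ)) (u : ℝ × ℝ → ℂ) : Prop :=
  ContDiff ℝ (⊤ : ℕ∞) u ∧ HasCompactSupport u ∧ tsupport u ⊆ Ω ∧ u ≠ 0

/-- Rayleigh quotient of the spin-`σ` (`σ = -1` : spin-down, `σ = 1` : spin-up)
Dirichlet Pauli operator at the test function `u`. -/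
def pauliRayleigh (σ : ℝ) (h : ℝ) (A : ℝ × ℝ → ℝ × ℝ) (B : ℝ × ℝ → ℝ) (Ω : Set (ℝ × ℝ))
    (u : ℝ × ℝ → ℂ) : ℝ :=
  ((∫ x in Ω, (‖(h : ℂ) * pd1 u x - Complex.I * ((A x).1 : ℂ) * u x‖ ^ 2
      + ‖(h : ℂ) * pd2 u x - Complex.I * ((A x).2 : ℂ) * u x‖ ^ 2))
    + σ * (h * ∫ x in Ω, B x * ‖u x‖ ^ 2)) / ∫ x in Ω, ‖u x‖ ^ 2

/-- The ground state energy `λ₋^D(h,A,B,Ω)` of the spin-down Dirichlet Pauli operator. -/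
def lambdaMinusD (h : ℝ) (A : ℝ × ℝ → ℝ × ℝ) (B : ℝ × ℝ → ℝ) (Ω : Set (ℝ × ℝ)) : ℝ :=
  sInf (pauliRayleigh (-1) h A B Ω '' {u | IsTestFun Ω u})

/-- The ground state energy `λ₊^D(h,A,B,Ω)` of the spin-up Dirichlet Pauli operator. -/
def lambdaPlusD (h : ℝ) (A : ℝ × ℝ → ℝ × ℝ) (B : ℝ × ℝ → ℝ) (Ω : Set (ℝ × ℝ)) : ℝ :=
  sInf (pauliRayleigh 1 h A B Ω '' {u | IsTestFun Ω u})

/-- The ground state energy `Λ^D(h,A,B,Ω)` of the full Dirichlet Pauli operator. -/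
def LambdaD (h : ℝ) (A : ℝ × ℝ → ℝ × ℝ) (B : ℝ × ℝ → ℝ) (Ω : Set (ℝ × ℝ)) : ℝ :=
  min (lambdaMinusD h A B Ω) (lambdaPlusD h A B Ω)

/-- The canonical vector potential `∇⊥ψ = (−∂₂ψ, ∂₁ψ)`. -/
def perpGrad (ψ : ℝ × ℝ → ℝ) (x : ℝ × ℝ) : ℝ × ℝ := (-(pd2 ψ x), pd1 ψ x)

/-- `ψ` is the scalar potential of `B` on `Ω`: `ψ ∈ C⁰(closure Ω) ∩ C²(Ω)`,
`Δψ = B` in `Ω` and `ψ = 0` on `∂Ω`. -/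
structure IsScalarPotential (Ω : Set (ℝ × ℝ)) (B : ℝ × ℝ → ℝ) (ψ : ℝ × ℝ → ℝ) : Prop where
  contOn : ContinuousOn ψ (closure Ω)
  c2 : ContDiffOn ℝ 2 ψ Ω
  lap_eq : ∀ x ∈ Ω, lap ψ x = B x
  bdry : ∀ x ∈ frontier Ω, ψ x = 0

/-- `A` is a continuous vector potential for `B` on `Ω`: `∂₁A₂ − ∂₂A₁ = B`. -/
def IsVectorPotential (Ω : Set (ℝ × ℝ)) (B : ℝ × ℝ → ℝ) (A : ℝ × ℝ → ℝ × ℝ) : Prop :=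
  ContinuousOn A Ω ∧ ∀ x ∈ Ω, pd1 (fun y => (A y).2) x - pd2 (fun y => (A y).1) x = B x

/-- `γ` is a regular curve of class `C^{2,α}` on the parameter set `s`. -/
def C2HolderOn (α : ℝ) (γ : ℝ → ℝ × ℝ) (s : Set ℝ) : Prop :=
  ContDiffOn ℝ 2 γ s ∧
  (∃ C : ℝ, ∀ x ∈ s, ∀ y ∈ s,
      ‖derivWithin (derivWithin γ s) s x - derivWithin (derivWithin γ s) s y‖ ≤ C * |x - y| ^ α) ∧
  ∀ x ∈ s, derivWithin γ s x ≠ 0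

/-- Near `p`, the set `Γ` is a regular curve of class `C^{2,α}`. -/
def IsLocallyC2CurveAt (α : ℝ) (Γ : Set (ℝ × ℝ)) (p : ℝ × ℝ) : Prop :=
  ∃ ε > 0, ∃ γ : ℝ → ℝ × ℝ, C2HolderOn α γ (Icc (-1) 1) ∧ γ 0 = p ∧
    Γ ∩ Metric.ball p ε = γ '' Ioo (-1) 1 ∩ Metric.ball p ε

/-- `Γ` is (locally) a regular curve of class `C^{2,α}`. -/
def IsC2HolderSet (α : ℝ) (Γ : Set (ℝ × ℝ)) : Prop := ∀ p ∈ Γ, IsLocallyC2CurveAt α Γ p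

/-- `Ω` has a corner at `p` formed by two `C^{2,α}` arcs, of aperture less than `π`
(near `p`, `Ω` is contained in a strictly convex open cone with vertex `p`). -/
def HasConvexCornerAt (Ω : Set (ℝ × ℝ)) (α : ℝ) (p : ℝ × ℝ) : Prop :=
  ∃ ε > 0, (∃ γ₁ γ₂ : ℝ → ℝ × ℝ, C2HolderOn α γ₁ (Icc 0 1) ∧ C2HolderOn α γ₂ (Icc 0 1) ∧
      γ₁ 0 = p ∧ γ₂ 0 = p ∧
      frontier Ω ∩ Metric.ball p ε = (γ₁ '' Ico 0 1 ∪ γ₂ '' Ico 0 1) ∩ Metric.ball p ε) ∧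
    ∃ w : ℝ × ℝ, ∃ c > 0, ∀ x ∈ Ω ∩ Metric.ball p ε,
      c * ‖x - p‖ ≤ (x - p).1 * w.1 + (x - p).2 * w.2

/-- `Ω` has a continuous boundary which is piecewise of class `C^{2,α}` for some `α > 0`,
with at most finitely many corners, each of aperture less than `π`. -/
def HasPiecewiseC2Boundary (Ω : Set (ℝ × ℝ)) : Prop :=
  ∃ α > 0, ∃ S : Finset (ℝ × ℝ), ↑S ⊆ frontier Ω ∧
    (∀ p ∈ frontier Ω \ (S : Set (ℝ × ℝ)), IsLocallyC2CurveAt α (frontier Ω) p) ∧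
    ∀ p ∈ S, HasConvexCornerAt Ω α p

/-- Assumption (R): `Ω` is bounded and open with continuous, piecewise `C^{2,α}` boundary
having finitely many corners of aperture `< π`, and `B` extends continuously to `closure Ω`. -/
structure AssumptionR (Ω : Set (ℝ × ℝ)) (B : ℝ × ℝ → ℝ) : Prop where
  isOpen : IsOpen Ω
  bounded : Bornology.IsBounded Ω
  bdryReg : HasPiecewiseC2Boundary Ω
  fieldCont : ContinuousOn B (closure Ω)

/-- The oscillation of `ψ` over `Ω`. -/
def osc (ψ : ℝ × ℝ → ℝ) (Ω : Set (ℝ × ℝ)) : ℝ := sSup (ψ '' Ω) - sInf (ψ '' Ω)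

/-- The region enclosed by `Γ`: the union of the bounded connected components of `Γᶜ`. -/
def curveInterior (Γ : Set (ℝ × ℝ)) : Set (ℝ × ℝ) :=
  {x | x ∉ Γ ∧ Bornology.IsBounded (connectedComponentIn Γᶜ x)}

/-- `Γ` is a simple closed curve of class `C^{2,α}`. -/
def IsC2ClosedCurve (α : ℝ) (Γ : Set (ℝ × ℝ)) : Prop :=
  ∃ γ : ℝ → ℝ × ℝ, Function.Periodic γ 1 ∧ C2HolderOn α γ (Icc 0 1) ∧
    InjOn γ (Ico 0 1) ∧ Γ = γ '' Icc 0 1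

/-- The ground state energy `λ^D(Ω)` of the Dirichlet Laplacian on `Ω`. -/
def dirichletGSE (Ω : Set (ℝ × ℝ)) : ℝ :=
  sInf ((fun u : ℝ × ℝ → ℝ =>
      (∫ x in Ω, (pd1 u x ^ 2 + pd2 u x ^ 2)) / ∫ x in Ω, u x ^ 2) ''
    {u | ContDiff ℝ (⊤ : ℕ∞) u ∧ HasCompactSupport u ∧ tsupport u ⊆ Ω ∧ u ≠ 0})

/-- The open disc of radius `R` centred at the origin (with the Euclidean distance). -/
def disc (R : ℝ) : Set (ℝ × ℝ) := {y : ℝ × ℝ | y.1 ^ 2 + y.2 ^ 2 < R ^ 2}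

end

section Calculus

variable {F : Type*} [NormedAddCommGroup F] [NormedSpace ℝ F]

lemma ContDiffAt.pd1 {f : ℝ × ℝ → F} {x : ℝ × ℝ} {m n : WithTop ℕ∞} (hf : ContDiffAt ℝ n f x)
    (hmn : m + 1 ≤ n) : ContDiffAt ℝ m (pd1 f) x :=
  (hf.fderiv_right hmn).clm_apply contDiffAt_const

lemma ContDiffAt.pd2 {f : ℝ × ℝ → F} {x : ℝ × ℝ} {m n : WithTop ℕ∞} (hf : ContDiffAt ℝ n f x)
    (hmn : m + 1 ≤ n) : ContDiffAt ℝ m (pd2 f) x :=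
  (hf.fderiv_right hmn).clm_apply contDiffAt_const

lemma ContDiff.pd1 {f : ℝ × ℝ → F} {m n : WithTop ℕ∞} (hf : ContDiff ℝ n f)
    (hmn : m + 1 ≤ n) : ContDiff ℝ m (pd1 f) :=
  contDiff_iff_contDiffAt.2 fun _ => hf.contDiffAt.pd1 hmn

lemma ContDiff.pd2 {f : ℝ × ℝ → F} {m n : WithTop ℕ∞} (hf : ContDiff ℝ n f)
    (hmn : m + 1 ≤ n) : ContDiff ℝ m (pd2 f) :=
  contDiff_iff_contDiffAt.2 fun _ => hf.contDiffAt.pd2 hmn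

lemma Filter.EventuallyEq.pd1 {f g : ℝ × ℝ → F} {x : ℝ × ℝ} (h : f =ᶠ[𝓝 x] g) :
    pd1 f =ᶠ[𝓝 x] pd1 g := by
  filter_upwards [h.fderiv (𝕜 := ℝ)] with y hy
  simp only [_root_.pd1, hy]

lemma Filter.EventuallyEq.pd2 {f g : ℝ × ℝ → F} {x : ℝ × ℝ} (h : f =ᶠ[𝓝 x] g) :
    pd2 f =ᶠ[𝓝 x] pd2 g := by
  filter_upwards [h.fderiv (𝕜 := ℝ)] with y hy
  simp only [_root_.pd2, hy]

lemma Filter.EventuallyEq.lap_eq {f g : ℝ × ℝ → ℝ} {x : ℝ × ℝ} (h : f =ᶠ[𝓝 x] g) :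
    lap f x = lap g x := by
  simp only [lap, h.pd1.pd1.eq_of_nhds, h.pd2.pd2.eq_of_nhds]

lemma pd1_pd2_comm {f : ℝ × ℝ → F} {x : ℝ × ℝ} (hf : ContDiffAt ℝ 2 f x) :
    pd1 (pd2 f) x = pd2 (pd1 f) x := by
  have hd : DifferentiableAt ℝ (fderiv ℝ f) x :=
    (hf.fderiv_right (m := 1) (by norm_num)).differentiableAt (by norm_num)
  have h := (hf.isSymmSndFDerivAt (by simp)).eq (1, 0) (0, 1)
  have h1 : pd1 (pd2 f) x = fderiv ℝ (fderiv ℝ f) x (1, 0) (0, 1) := by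
    change fderiv ℝ (fun y => fderiv ℝ f y (0, 1)) x (1, 0) = _
    rw [fderiv_clm_apply hd (by fun_prop)]; simp
  have h2 : pd2 (pd1 f) x = fderiv ℝ (fderiv ℝ f) x (0, 1) (1, 0) := by
    change fderiv ℝ (fun y => fderiv ℝ f y (1, 0)) x (0, 1) = _
    rw [fderiv_clm_apply hd (by fun_prop)]; simp
  rw [h1, h2, h]

lemma pd1_eq_zero_of_notMem_tsupport {f : ℝ × ℝ → F} {x : ℝ × ℝ} (hx : x ∉ tsupport f) :
    pd1 f x = 0 := by
  simp [pd1, (notMem_tsupport_iff_eventuallyEq.1 hx).fderiv_eq]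

lemma pd2_eq_zero_of_notMem_tsupport {f : ℝ × ℝ → F} {x : ℝ × ℝ} (hx : x ∉ tsupport f) :
    pd2 f x = 0 := by
  simp [pd2, (notMem_tsupport_iff_eventuallyEq.1 hx).fderiv_eq]

lemma HasCompactSupport.pd1 {f : ℝ × ℝ → F} (hf : HasCompactSupport f) :
    HasCompactSupport (pd1 f) :=
  hf.fderiv_apply ℝ (1, 0)

lemma HasCompactSupport.pd2 {f : ℝ × ℝ → F} (hf : HasCompactSupport f) :
    HasCompactSupport (pd2 f) :=
  hf.fderiv_apply ℝ (0, 1)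

lemma integral_fderiv_apply_eq_zero {f : ℝ × ℝ → ℝ} (hf : ContDiff ℝ 1 f)
    (hc : HasCompactSupport f) (v : ℝ × ℝ) : ∫ x, fderiv ℝ f x v = 0 := by
  have hcont : Continuous fun x => fderiv ℝ f x v :=
    (hf.continuous_fderiv (by norm_num)).clm_apply continuous_const
  have := integral_mul_fderiv_eq_neg_fderiv_mul_of_integrable (μ := volume)
    (f := fun _ : ℝ × ℝ => (1 : ℝ)) (g := f) (v := v) (by simp)
    (by simpa using hcont.integrable_of_hasCompactSupport (hc.fderiv_apply ℝ v))
    (by simpa using hf.continuous.integrable_of_hasCompactSupport hc)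
    (fun _ _ => by fun_prop) (fun x _ => hf.differentiable (by norm_num) x)
  simpa using this

lemma integral_pd1_eq_zero {f : ℝ × ℝ → ℝ} (hf : ContDiff ℝ 1 f) (hc : HasCompactSupport f) :
    ∫ x, pd1 f x = 0 :=
  integral_fderiv_apply_eq_zero hf hc _

lemma integral_pd2_eq_zero {f : ℝ × ℝ → ℝ} (hf : ContDiff ℝ 1 f) (hc : HasCompactSupport f) :
    ∫ x, pd2 f x = 0 :=
  integral_fderiv_apply_eq_zero hf hc _

lemma pd1_mul {A : Type*} [NormedCommRing A] [NormedAlgebra ℝ A] {f g : ℝ × ℝ → A} {x : ℝ × ℝ}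
    (hf : DifferentiableAt ℝ f x) (hg : DifferentiableAt ℝ g x) :
    pd1 (fun y => f y * g y) x = f x * pd1 g x + pd1 f x * g x := by
  simp only [pd1]; rw [fderiv_fun_mul hf hg]; simp [mul_comm]

lemma pd2_mul {A : Type*} [NormedCommRing A] [NormedAlgebra ℝ A] {f g : ℝ × ℝ → A} {x : ℝ × ℝ}
    (hf : DifferentiableAt ℝ f x) (hg : DifferentiableAt ℝ g x) :
    pd2 (fun y => f y * g y) x = f x * pd2 g x + pd2 f x * g x := by
  simp only [pd2]; rw [fderiv_fun_mul hf hg]; simp [mul_comm]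

lemma pd1_comp {g : ℝ → ℝ} {f : ℝ × ℝ → ℝ} {x : ℝ × ℝ} (hg : DifferentiableAt ℝ g (f x))
    (hf : DifferentiableAt ℝ f x) : pd1 (fun y => g (f y)) x = deriv g (f x) * pd1 f x := by
  have := (hg.hasDerivAt.comp_hasFDerivAt x hf.hasFDerivAt).fderiv
  simp only [pd1]
  rw [show (fun y => g (f y)) = g ∘ f from rfl, this]; simp

lemma pd2_comp {g : ℝ → ℝ} {f : ℝ × ℝ → ℝ} {x : ℝ × ℝ} (hg : DifferentiableAt ℝ g (f x))
    (hf : DifferentiableAt ℝ f x) : pd2 (fun y => g (f y)) x = deriv g (f x) * pd2 f x := by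
  have := (hg.hasDerivAt.comp_hasFDerivAt x hf.hasFDerivAt).fderiv
  simp only [pd2]
  rw [show (fun y => g (f y)) = g ∘ f from rfl, this]; simp

lemma lap_comp {g : ℝ → ℝ} {f : ℝ × ℝ → ℝ} {x : ℝ × ℝ} (hg : ContDiffAt ℝ 2 g (f x))
    (hf : ContDiffAt ℝ 2 f x) :
    lap (fun y => g (f y)) x =
      deriv (deriv g) (f x) * (pd1 f x ^ 2 + pd2 f x ^ 2) + deriv g (f x) * lap f x := by
  have hg1 : DifferentiableAt ℝ (deriv g) (f x) :=
    ((hg.fderiv_right (m := 1) (by norm_num)).clm_apply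
      (contDiffAt_const (c := (1 : ℝ)))).differentiableAt (by norm_num)
  have e := (hf.eventually (by simp)).and (hf.continuousAt.eventually (hg.eventually (by simp)))
  have h1 : pd1 (fun y => g (f y)) =ᶠ[𝓝 x] fun y => deriv g (f y) * pd1 f y := by
    filter_upwards [e] with y hy
    exact pd1_comp (hy.2.differentiableAt (by norm_num)) (hy.1.differentiableAt (by norm_num))
  have h2 : pd2 (fun y => g (f y)) =ᶠ[𝓝 x] fun y => deriv g (f y) * pd2 f y := by
    filter_upwards [e] with y hy
    exact pd2_comp (hy.2.differentiableAt (by norm_num)) (hy.1.differentiableAt (by norm_num))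
  have hf' := hf.differentiableAt (by norm_num)
  have hc : DifferentiableAt ℝ (fun y => deriv g (f y)) x := hg1.comp x hf'
  rw [lap, h1.pd1.eq_of_nhds, h2.pd2.eq_of_nhds,
    pd1_mul hc ((hf.pd1 (m := 1) (by norm_num)).differentiableAt (by norm_num)),
    pd2_mul hc ((hf.pd2 (m := 1) (by norm_num)).differentiableAt (by norm_num)),
    pd1_comp hg1 hf', pd2_comp hg1 hf', lap]
  ring

lemma lap_add {f g : ℝ × ℝ → ℝ} {x : ℝ × ℝ} (hf : ContDiffAt ℝ 2 f x) (hg : ContDiffAt ℝ 2 g x) :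
    lap (fun y => f y + g y) x = lap f x + lap g x := by
  have e := (hf.eventually (by simp)).and (hg.eventually (by simp))
  have h1 : pd1 (fun y => f y + g y) =ᶠ[𝓝 x] fun y => pd1 f y + pd1 g y := by
    filter_upwards [e] with y hy
    simp only [pd1]
    rw [fderiv_fun_add (hy.1.differentiableAt (by norm_num)) (hy.2.differentiableAt (by norm_num))]
    rfl
  have h2 : pd2 (fun y => f y + g y) =ᶠ[𝓝 x] fun y => pd2 f y + pd2 g y := by
    filter_upwards [e] with y hy
    simp only [pd2]
    rw [fderiv_fun_add (hy.1.differentiableAt (by norm_num)) (hy.2.differentiableAt (by norm_num))]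
    rfl
  have d {k : ℝ × ℝ → ℝ} (hk : ContDiffAt ℝ 2 k x) :
      DifferentiableAt ℝ (pd1 k) x ∧ DifferentiableAt ℝ (pd2 k) x :=
    ⟨(hk.pd1 (m := 1) (by norm_num)).differentiableAt (by norm_num),
      (hk.pd2 (m := 1) (by norm_num)).differentiableAt (by norm_num)⟩
  have h3 : pd1 (fun y => pd1 f y + pd1 g y) x = pd1 (pd1 f) x + pd1 (pd1 g) x := by
    rw [pd1, fderiv_fun_add (d hf).1 (d hg).1]; rfl
  have h4 : pd2 (fun y => pd2 f y + pd2 g y) x = pd2 (pd2 f) x + pd2 (pd2 g) x := by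
    rw [pd2, fderiv_fun_add (d hf).2 (d hg).2]; rfl
  rw [lap, h1.pd1.eq_of_nhds, h2.pd2.eq_of_nhds, h3, h4, lap, lap]
  ring

lemma lap_const_mul (c : ℝ) {f : ℝ × ℝ → ℝ} {x : ℝ × ℝ} (hf : ContDiffAt ℝ 2 f x) :
    lap (fun y => c * f y) x = c * lap f x := by
  have h : ContDiffAt ℝ 2 (fun t : ℝ => c * t) (f x) := by fun_prop
  have hd : deriv (fun t : ℝ => c * t) = fun _ => c := by
    ext t; simp
  rw [lap_comp (g := fun t => c * t) h hf, hd]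
  simp

end Calculus

section Cutoff

lemma two_le_smooth : (2 : WithTop ℕ∞) ≤ ((⊤ : ℕ∞) : WithTop ℕ∞) :=
  ENat.LEInfty.out

lemma exists_smooth_cutoff {K U : Set (ℝ × ℝ)} (hK : IsClosed K) (hU : IsOpen U) (hKU : K ⊆ U) :
    ∃ θ : ℝ × ℝ → ℝ, ContDiff ℝ (⊤ : ℕ∞) θ ∧ (∀ x ∈ K, ∀ᶠ y in 𝓝 x, θ y = 1) ∧ tsupport θ ⊆ U ∧
      ∀ x, θ x ∈ Icc (0 : ℝ) 1 := by
  obtain ⟨V, hV, hKV, hVU⟩ := normal_exists_closure_subset hK hU hKU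
  obtain ⟨f, hf1, hf0, hf⟩ := exists_contMDiffMap_one_nhds_of_subset_interior (n := ⊤)
    (modelWithCornersSelf ℝ (ℝ × ℝ)) hK (hKV.trans (hV.subset_interior_iff.2 subset_closure) :
      K ⊆ interior (closure V))
  refine ⟨f, f.contMDiff.contDiff, fun x hx => ?_, ?_, hf⟩
  · exact hf1.filter_mono (nhds_le_nhdsSet hx)
  · refine (closure_minimal ?_ isClosed_closure).trans hVU
    intro x hx
    by_contra h
    exact hx (hf0 x h)

lemma contDiff_of_forall_mem_tsupport {F : Type*} [NormedAddCommGroup F] [NormedSpace ℝ F]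
    {n : WithTop ℕ∞} {f : ℝ × ℝ → F} (hf : ∀ x ∈ tsupport f, ContDiffAt ℝ n f x) :
    ContDiff ℝ n f := by
  refine contDiff_iff_contDiffAt.2 fun x => ?_
  by_cases hx : x ∈ tsupport f
  · exact hf x hx
  · exact contDiffAt_const.congr_of_eventuallyEq (notMem_tsupport_iff_eventuallyEq.1 hx)

lemma contDiff_cutoff_mul {F : Type*} [NormedAddCommGroup F] [NormedSpace ℝ F]
    {n : WithTop ℕ∞} {θ : ℝ × ℝ → ℝ} {f : ℝ × ℝ → F} {U : Set (ℝ × ℝ)} (hθ : ContDiff ℝ n θ)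
    (hU : tsupport θ ⊆ U) (hf : ∀ x ∈ U, ContDiffAt ℝ n f x) : ContDiff ℝ n fun x => θ x • f x :=
  contDiff_of_forall_mem_tsupport fun x hx =>
    hθ.contDiffAt.smul (hf x (hU (tsupport_smul_subset_left θ f hx)))

end Cutoff

section Energy

variable {u : ℝ × ℝ → ℂ} {x : ℝ × ℝ}

lemma pd1_re (hu : DifferentiableAt ℝ u x) : pd1 (fun y => (u y).re) x = (pd1 u x).re := by
  have := (Complex.reCLM.hasFDerivAt.comp x hu.hasFDerivAt).fderiv
  simp only [pd1]
  rw [show (fun y => (u y).re) = Complex.reCLM ∘ u from rfl, this]; simp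

lemma pd2_re (hu : DifferentiableAt ℝ u x) : pd2 (fun y => (u y).re) x = (pd2 u x).re := by
  have := (Complex.reCLM.hasFDerivAt.comp x hu.hasFDerivAt).fderiv
  simp only [pd2]
  rw [show (fun y => (u y).re) = Complex.reCLM ∘ u from rfl, this]; simp

lemma pd1_im (hu : DifferentiableAt ℝ u x) : pd1 (fun y => (u y).im) x = (pd1 u x).im := by
  have := (Complex.imCLM.hasFDerivAt.comp x hu.hasFDerivAt).fderiv
  simp only [pd1]
  rw [show (fun y => (u y).im) = Complex.imCLM ∘ u from rfl, this]; simp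

lemma pd2_im (hu : DifferentiableAt ℝ u x) : pd2 (fun y => (u y).im) x = (pd2 u x).im := by
  have := (Complex.imCLM.hasFDerivAt.comp x hu.hasFDerivAt).fderiv
  simp only [pd2]
  rw [show (fun y => (u y).im) = Complex.imCLM ∘ u from rfl, this]; simp

lemma Complex.sq_norm_eq (z : ℂ) : ‖z‖ ^ 2 = z.re ^ 2 + z.im ^ 2 := by
  rw [Complex.sq_norm, Complex.normSq_apply]; ring

lemma pauli_energy_identity {ψ : ℝ × ℝ → ℝ} (h : ℝ) (hψ : ContDiff ℝ 2 ψ) (hu : ContDiff ℝ 2 u)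
    (hc : HasCompactSupport u) :
    (∫ x, (‖(h : ℂ) * pd1 u x - Complex.I * (((perpGrad ψ x).1 : ℝ) : ℂ) * u x‖ ^ 2
      + ‖(h : ℂ) * pd2 u x - Complex.I * (((perpGrad ψ x).2 : ℝ) : ℂ) * u x‖ ^ 2))
      + (-1) * (h * ∫ x, lap ψ x * ‖u x‖ ^ 2) =
    ∫ x, ‖(h : ℂ) * (pd1 u x + Complex.I * pd2 u x)
      + (((pd1 ψ x : ℝ) : ℂ) + Complex.I * ((pd2 ψ x : ℝ) : ℂ)) * u x‖ ^ 2 := by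
  set a : ℝ × ℝ → ℝ := fun y => (u y).re with ha
  set b : ℝ × ℝ → ℝ := fun y => (u y).im with hb
  have hud : Differentiable ℝ u := hu.differentiable (by norm_num)
  have ca : ContDiff ℝ 2 a := Complex.reCLM.contDiff.comp hu
  have cb : ContDiff ℝ 2 b := Complex.imCLM.contDiff.comp hu
  have cu1 : Continuous (pd1 u) := (hu.pd1 (m := 1) (by norm_num)).continuous
  have cu2 : Continuous (pd2 u) := (hu.pd2 (m := 1) (by norm_num)).continuous
  have cb1 : ContDiff ℝ 1 (pd1 b) := cb.pd1 (by norm_num)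
  have cb2 : ContDiff ℝ 1 (pd2 b) := cb.pd2 (by norm_num)
  have cp1 : ContDiff ℝ 1 (pd1 ψ) := hψ.pd1 (by norm_num)
  have cp2 : ContDiff ℝ 1 (pd2 ψ) := hψ.pd2 (by norm_num)
  have hlap : Continuous (lap ψ) :=
    (cp1.pd1 (m := 0) (by norm_num)).continuous.add (cp2.pd2 (m := 0) (by norm_num)).continuous
  have csupp {f : ℝ × ℝ → ℝ} (hf : ∀ x, x ∉ tsupport u → f x = 0) : HasCompactSupport f :=
    HasCompactSupport.intro hc hf
  have z0 (x) (hx : x ∉ tsupport u) : u x = 0 := image_eq_zero_of_notMem_tsupport hx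
  have z1 (x) (hx : x ∉ tsupport u) : pd1 u x = 0 := pd1_eq_zero_of_notMem_tsupport hx
  have z2 (x) (hx : x ∉ tsupport u) : pd2 u x = 0 := pd2_eq_zero_of_notMem_tsupport hx
  let F1 : ℝ × ℝ → ℝ := fun x => (-2 * h ^ 2) * (a x * pd2 b x) +
    h * (pd1 ψ x * (a x * a x + b x * b x))
  let F2 : ℝ × ℝ → ℝ := fun x => (2 * h ^ 2) * (a x * pd1 b x) +
    h * (pd2 ψ x * (a x * a x + b x * b x))
  have ca1 := ca.of_le (show (1 : WithTop ℕ∞) ≤ 2 by norm_num)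
  have cbb1 := cb.of_le (show (1 : WithTop ℕ∞) ≤ 2 by norm_num)
  have hF1 : ContDiff ℝ 1 F1 := by fun_prop
  have hF2 : ContDiff ℝ 1 F2 := by fun_prop
  have hF1c : HasCompactSupport F1 := csupp fun x hx => by simp [F1, ha, hb, z0 x hx]
  have hF2c : HasCompactSupport F2 := csupp fun x hx => by simp [F2, ha, hb, z0 x hx]
  have da := ca.differentiable (by norm_num)
  have db := cb.differentiable (by norm_num)
  have db1 := cb1.differentiable (by norm_num)
  have db2 := cb2.differentiable (by norm_num)
  have dp1 := cp1.differentiable (by norm_num)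
  have dp2 := cp2.differentiable (by norm_num)
  have add1 {f g : ℝ × ℝ → ℝ} (hf : Differentiable ℝ f) (hg : Differentiable ℝ g) (x) :
      pd1 (fun y => f y + g y) x = pd1 f x + pd1 g x := by
    rw [pd1, fderiv_fun_add (hf x) (hg x)]; rfl
  have add2 {f g : ℝ × ℝ → ℝ} (hf : Differentiable ℝ f) (hg : Differentiable ℝ g) (x) :
      pd2 (fun y => f y + g y) x = pd2 f x + pd2 g x := by
    rw [pd2, fderiv_fun_add (hf x) (hg x)]; rfl
  have c1 (c : ℝ) {f : ℝ × ℝ → ℝ} (hf : Differentiable ℝ f) (x) :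
      pd1 (fun y => c * f y) x = c * pd1 f x := by
    rw [pd1, fderiv_const_mul (hf x)]; rfl
  have c2 (c : ℝ) {f : ℝ × ℝ → ℝ} (hf : Differentiable ℝ f) (x) :
      pd2 (fun y => c * f y) x = c * pd2 f x := by
    rw [pd2, fderiv_const_mul (hf x)]; rfl
  have e1 (x) : pd1 F1 x = (-2 * h ^ 2) * (a x * pd1 (pd2 b) x + pd1 a x * pd2 b x) +
      h * (pd1 ψ x * (2 * a x * pd1 a x + 2 * b x * pd1 b x)
        + pd1 (pd1 ψ) x * (a x * a x + b x * b x)) := by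
    rw [add1 (by fun_prop) (by fun_prop), c1 _ (by fun_prop), c1 _ (by fun_prop),
      pd1_mul (da x) (db2 x), pd1_mul (dp1 x) (by fun_prop), add1 (by fun_prop) (by fun_prop),
      pd1_mul (da x) (da x), pd1_mul (db x) (db x)]
    ring
  have e2 (x) : pd2 F2 x = (2 * h ^ 2) * (a x * pd2 (pd1 b) x + pd2 a x * pd1 b x) +
      h * (pd2 ψ x * (2 * a x * pd2 a x + 2 * b x * pd2 b x)
        + pd2 (pd2 ψ) x * (a x * a x + b x * b x)) := by
    rw [add2 (by fun_prop) (by fun_prop), c2 _ (by fun_prop), c2 _ (by fun_prop),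
      pd2_mul (da x) (db1 x), pd2_mul (dp2 x) (by fun_prop), add2 (by fun_prop) (by fun_prop),
      pd2_mul (da x) (da x), pd2_mul (db x) (db x)]
    ring
  have iF1 := integral_pd1_eq_zero hF1 hF1c
  have iF2 := integral_pd2_eq_zero hF2 hF2c
  have intF1 : Integrable (pd1 F1) :=
    (hF1.pd1 (m := 0) (by norm_num)).continuous.integrable_of_hasCompactSupport hF1c.pd1
  have intF2 : Integrable (pd2 F2) :=
    (hF2.pd2 (m := 0) (by norm_num)).continuous.integrable_of_hasCompactSupport hF2c.pd2
  have cu := hu.continuous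
  have cpc1 := cp1.continuous
  have cpc2 := cp2.continuous
  have i1 : Integrable (fun x => ‖(h : ℂ) * pd1 u x -
      Complex.I * (((perpGrad ψ x).1 : ℝ) : ℂ) * u x‖ ^ 2
      + ‖(h : ℂ) * pd2 u x - Complex.I * (((perpGrad ψ x).2 : ℝ) : ℂ) * u x‖ ^ 2) := by
    refine Continuous.integrable_of_hasCompactSupport ?_ (csupp fun x hx => by
      simp [z0 x hx, z1 x hx, z2 x hx])
    simp only [perpGrad]
    fun_prop
  have i2 : Integrable (fun x => lap ψ x * ‖u x‖ ^ 2) :=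
    Continuous.integrable_of_hasCompactSupport (by fun_prop) (csupp fun x hx => by
      simp [z0 x hx])
  have key (x) : ‖(h : ℂ) * (pd1 u x + Complex.I * pd2 u x)
      + (((pd1 ψ x : ℝ) : ℂ) + Complex.I * ((pd2 ψ x : ℝ) : ℂ)) * u x‖ ^ 2 =
      ((‖(h : ℂ) * pd1 u x -
      Complex.I * (((perpGrad ψ x).1 : ℝ) : ℂ) * u x‖ ^ 2
      + ‖(h : ℂ) * pd2 u x - Complex.I * (((perpGrad ψ x).2 : ℝ) : ℂ) * u x‖ ^ 2)
      + (-1) * (h * (lap ψ x * ‖u x‖ ^ 2))) + (pd1 F1 x + pd2 F2 x) := by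
    rw [e1, e2, pd1_pd2_comm cb.contDiffAt, pd1_re (hud x), pd2_re (hud x), pd1_im (hud x),
      pd2_im (hud x)]
    simp only [Complex.sq_norm_eq, perpGrad, lap, ha, hb]
    simp
    ring
  symm
  refine (integral_congr_ae (ae_of_all _ key)).trans ?_
  refine (integral_add (i1.add ((i2.const_mul h).const_mul (-1))) (intF1.add intF2)).trans ?_
  rw [integral_add' intF1 intF2, iF1, iF2, integral_add' i1 ((i2.const_mul h).const_mul (-1)),
    integral_const_mul, integral_const_mul]
  ring

lemma setIntegral_eq_integral_of_tsupport_subset {Ω : Set (ℝ × ℝ)} {f : ℝ × ℝ → ℝ}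
    (hu : tsupport u ⊆ Ω) (hf : ∀ x, x ∉ tsupport u → f x = 0) :
    ∫ x in Ω, f x = ∫ x, f x :=
  setIntegral_eq_integral_of_forall_compl_eq_zero fun x hx => hf x fun h => hx (hu h)

lemma pauliRayleigh_eq {Ω : Set (ℝ × ℝ)} {B ψ : ℝ × ℝ → ℝ} (hΩ : IsOpen Ω)
    (hψ : IsScalarPotential Ω B ψ) (hu : IsTestFun Ω u) (h : ℝ) :
    pauliRayleigh (-1) h (perpGrad ψ) B Ω u =
    (∫ x, ‖(h : ℂ) * (pd1 u x + Complex.I * pd2 u x)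
      + (((pd1 ψ x : ℝ) : ℂ) + Complex.I * ((pd2 ψ x : ℝ) : ℂ)) * u x‖ ^ 2) / ∫ x, ‖u x‖ ^ 2 := by
  obtain ⟨hu1, hu2, hu3, -⟩ := hu
  obtain ⟨θ, hθ, hθ1, hθΩ, -⟩ := exists_smooth_cutoff (isClosed_tsupport u) hΩ hu3
  set φ : ℝ × ℝ → ℝ := fun x => θ x • ψ x with hφ
  have hφ2 : ContDiff ℝ 2 φ := contDiff_cutoff_mul (hθ.of_le two_le_smooth) hθΩ
    fun x hx => hψ.c2.contDiffAt (hΩ.mem_nhds hx)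
  have heq (x) (hx : x ∈ tsupport u) : φ =ᶠ[𝓝 x] ψ := by
    filter_upwards [hθ1 x hx] with y hy
    simp [hφ, hy]
  have z0 (x) (hx : x ∉ tsupport u) : u x = 0 := image_eq_zero_of_notMem_tsupport hx
  have z1 (x) (hx : x ∉ tsupport u) : pd1 u x = 0 := pd1_eq_zero_of_notMem_tsupport hx
  have z2 (x) (hx : x ∉ tsupport u) : pd2 u x = 0 := pd2_eq_zero_of_notMem_tsupport hx
  have key := pauli_energy_identity h hφ2 (hu1.of_le two_le_smooth) hu2
  rw [pauliRayleigh, setIntegral_eq_integral_of_tsupport_subset hu3 fun x hx => by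
      simp [z0 x hx, z1 x hx, z2 x hx],
    setIntegral_eq_integral_of_tsupport_subset hu3 fun x hx => by simp [z0 x hx],
    setIntegral_eq_integral_of_tsupport_subset hu3 fun x hx => by simp [z0 x hx]]
  congr 1
  convert key using 3
  · funext x
    by_cases hx : x ∈ tsupport u
    · simp only [perpGrad, (heq x hx).pd1.eq_of_nhds, (heq x hx).pd2.eq_of_nhds]
    · simp [z0 x hx]
  · congr 1
    refine congrArg _ (funext fun x => ?_)
    by_cases hx : x ∈ tsupport u
    · rw [(heq x hx).lap_eq, hψ.lap_eq x (hu3 hx)]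
    · simp [z0 x hx]
  · by_cases hx : ‹ℝ × ℝ› ∈ tsupport u
    · simp only [(heq _ hx).pd1.eq_of_nhds, (heq _ hx).pd2.eq_of_nhds]
    · simp [z0 _ hx]

end Energy

section LowerBound

lemma pd1_smul {F : Type*} [NormedAddCommGroup F] [NormedSpace ℝ F] {c : ℝ × ℝ → ℝ}
    {u : ℝ × ℝ → F} {x : ℝ × ℝ} (hc : DifferentiableAt ℝ c x) (hu : DifferentiableAt ℝ u x) :
    pd1 (fun y => c y • u y) x = c x • pd1 u x + pd1 c x • u x := by
  simp only [pd1]; rw [fderiv_fun_smul hc hu]; simp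

lemma pd2_smul {F : Type*} [NormedAddCommGroup F] [NormedSpace ℝ F] {c : ℝ × ℝ → ℝ}
    {u : ℝ × ℝ → F} {x : ℝ × ℝ} (hc : DifferentiableAt ℝ c x) (hu : DifferentiableAt ℝ u x) :
    pd2 (fun y => c y • u y) x = c x • pd2 u x + pd2 c x • u x := by
  simp only [pd2]; rw [fderiv_fun_smul hc hu]; simp

lemma pd1_exp_smul {φ : ℝ × ℝ → ℝ} {u : ℝ × ℝ → ℂ} {x : ℝ × ℝ} (h : ℝ)
    (hφ : DifferentiableAt ℝ φ x) (hu : DifferentiableAt ℝ u x) :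
    pd1 (fun y => Real.exp (φ y / h) • u y) x =
      (Real.exp (φ x / h) : ℂ) * (pd1 u x + ((pd1 φ x / h : ℝ) : ℂ) * u x) := by
  have hd : DifferentiableAt ℝ (fun t : ℝ => Real.exp (t / h)) (φ x) := by fun_prop
  have hd' : deriv (fun t : ℝ => Real.exp (t / h)) (φ x) = Real.exp (φ x / h) / h := by
    simp [div_eq_mul_inv]
  rw [pd1_smul (c := fun y => Real.exp (φ y / h)) (by fun_prop) hu,
    pd1_comp (g := fun t => Real.exp (t / h)) hd hφ, hd']
  simp only [Complex.real_smul]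
  push_cast
  ring

lemma pd2_exp_smul {φ : ℝ × ℝ → ℝ} {u : ℝ × ℝ → ℂ} {x : ℝ × ℝ} (h : ℝ)
    (hφ : DifferentiableAt ℝ φ x) (hu : DifferentiableAt ℝ u x) :
    pd2 (fun y => Real.exp (φ y / h) • u y) x =
      (Real.exp (φ x / h) : ℂ) * (pd2 u x + ((pd2 φ x / h : ℝ) : ℂ) * u x) := by
  have hd : DifferentiableAt ℝ (fun t : ℝ => Real.exp (t / h)) (φ x) := by fun_prop
  have hd' : deriv (fun t : ℝ => Real.exp (t / h)) (φ x) = Real.exp (φ x / h) / h := by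
    simp [div_eq_mul_inv]
  rw [pd2_smul (c := fun y => Real.exp (φ y / h)) (by fun_prop) hu,
    pd2_comp (g := fun t => Real.exp (t / h)) hd hφ, hd']
  simp only [Complex.real_smul]
  push_cast
  ring

lemma integral_gradient_eq {w : ℝ × ℝ → ℂ} (hw : ContDiff ℝ 2 w) (hc : HasCompactSupport w) :
    ∫ x, (‖pd1 w x‖ ^ 2 + ‖pd2 w x‖ ^ 2) = ∫ x, ‖pd1 w x + Complex.I * pd2 w x‖ ^ 2 := by
  have h0 : ∀ x, pd1 (fun _ : ℝ × ℝ => (0 : ℝ)) x = 0 := fun x => by simp [pd1]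
  have h0' : ∀ x, pd2 (fun _ : ℝ × ℝ => (0 : ℝ)) x = 0 := fun x => by simp [pd2]
  have h1 : ∀ x, lap (fun _ : ℝ × ℝ => (0 : ℝ)) x = 0 := fun x => by
    simp [lap, funext h0, funext h0', h0, h0']
  have := pauli_energy_identity (ψ := fun _ => 0) (u := w) 1 contDiff_const hw hc
  simpa [perpGrad, h0, h0', h1] using this

lemma poincare_le {w : ℝ × ℝ → ℂ} {L : ℝ} (hw : ContDiff ℝ 1 w)
    (hc : HasCompactSupport w) (hL : ∀ x ∈ tsupport w, |x.1| ≤ L) :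
    ∫ x, ‖w x‖ ^ 2 ≤ 4 * L ^ 2 * ∫ x, ‖pd1 w x‖ ^ 2 := by
  set a : ℝ × ℝ → ℝ := fun y => (w y).re with ha
  set b : ℝ × ℝ → ℝ := fun y => (w y).im with hb
  have hwd : Differentiable ℝ w := hw.differentiable (by norm_num)
  have ca : ContDiff ℝ 1 a := Complex.reCLM.contDiff.comp hw
  have cb : ContDiff ℝ 1 b := Complex.imCLM.contDiff.comp hw
  have da := ca.differentiable (by norm_num)
  have db := cb.differentiable (by norm_num)
  have z0 (x) (hx : x ∉ tsupport w) : w x = 0 := image_eq_zero_of_notMem_tsupport hx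
  have z1 (x) (hx : x ∉ tsupport w) : pd1 w x = 0 := pd1_eq_zero_of_notMem_tsupport hx
  let F : ℝ × ℝ → ℝ := fun x => x.1 * (a x * a x + b x * b x)
  have hF : ContDiff ℝ 1 F := by fun_prop
  have hFc : HasCompactSupport F := HasCompactSupport.intro hc fun x hx => by
    simp [F, ha, hb, z0 x hx]
  have e (x) : pd1 F x = ‖w x‖ ^ 2 + 2 * x.1 * (a x * pd1 a x + b x * pd1 b x) := by
    have h1 : pd1 (fun y : ℝ × ℝ => y.1) x = 1 := by
      simp [pd1, fderiv_fst]
    have h2 : pd1 (fun y => a y * a y + b y * b y) x =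
        pd1 (fun y => a y * a y) x + pd1 (fun y => b y * b y) x := by
      rw [pd1, fderiv_fun_add (by fun_prop) (by fun_prop)]; rfl
    rw [pd1_mul (by fun_prop) (by fun_prop), h1, h2, pd1_mul (da x) (da x),
      pd1_mul (db x) (db x), Complex.sq_norm_eq]
    ring
  have cw := hw.continuous
  have cw1 : Continuous (pd1 w) := (hw.pd1 (m := 0) (by norm_num)).continuous
  have i0 : Integrable fun x => ‖w x‖ ^ 2 :=
    Continuous.integrable_of_hasCompactSupport (by fun_prop)
      (HasCompactSupport.intro hc fun x hx => by simp [z0 x hx])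
  have i1 : Integrable fun x => ‖pd1 w x‖ ^ 2 :=
    Continuous.integrable_of_hasCompactSupport (by fun_prop)
      (HasCompactSupport.intro hc fun x hx => by simp [z1 x hx])
  have iF : Integrable (pd1 F) :=
    (hF.pd1 (m := 0) (by norm_num)).continuous.integrable_of_hasCompactSupport hFc.pd1
  have key (x) : 1 / 2 * ‖w x‖ ^ 2 - 2 * L ^ 2 * ‖pd1 w x‖ ^ 2 ≤ pd1 F x := by
    rw [e]
    by_cases hx : x ∈ tsupport w
    · have hxL := hL x hx
      have hx2 : x.1 ^ 2 ≤ L ^ 2 := sq_le_sq' (by linarith [neg_abs_le x.1])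
        ((le_abs_self _).trans hxL)
      rw [pd1_re (hwd x), pd1_im (hwd x), Complex.sq_norm_eq, Complex.sq_norm_eq]
      simp only [ha, hb]
      have := mul_le_mul_of_nonneg_right hx2
        (add_nonneg (sq_nonneg (pd1 w x).re) (sq_nonneg (pd1 w x).im))
      nlinarith [sq_nonneg ((w x).re + 2 * x.1 * (pd1 w x).re),
        sq_nonneg ((w x).im + 2 * x.1 * (pd1 w x).im)]
    · simp [ha, hb, z0 x hx, z1 x hx]
  have := integral_mono ((i0.const_mul (1 / 2)).sub (i1.const_mul (2 * L ^ 2))) iF key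
  rw [integral_pd1_eq_zero hF hFc, integral_sub' (i0.const_mul _) (i1.const_mul _),
    integral_const_mul, integral_const_mul] at this
  linarith

lemma IsTestFun.integral_pos {Ω : Set (ℝ × ℝ)} {u : ℝ × ℝ → ℂ} (hu : IsTestFun Ω u) :
    0 < ∫ x, ‖u x‖ ^ 2 := by
  obtain ⟨h1, h2, -, h4⟩ := hu
  obtain ⟨x, hx⟩ := Function.ne_iff.1 h4
  have cu := h1.continuous
  refine Continuous.integral_pos_of_hasCompactSupport_nonneg_nonzero (x := x) (by fun_prop)
    (HasCompactSupport.intro h2 fun x hx => by simp [image_eq_zero_of_notMem_tsupport hx])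
    (fun x => by positivity) ?_
  simpa using hx

lemma pauliRayleigh_lower_bound {Ω : Set (ℝ × ℝ)} {B ψ : ℝ × ℝ → ℝ} (hΩ : IsOpen Ω)
    (hb : Bornology.IsBounded Ω) (hψ : IsScalarPotential Ω B ψ) :
    ∃ L > 0, ∃ M : ℝ, ∀ h > 0, ∀ u, IsTestFun Ω u →
      h ^ 2 * Real.exp (-(4 * M) / h) / (4 * L ^ 2) ≤
        pauliRayleigh (-1) h (perpGrad ψ) B Ω u := by
  obtain ⟨L, hL0, hL⟩ := hb.exists_pos_norm_le
  obtain ⟨M, hM⟩ := hb.isCompact_closure.exists_bound_of_continuousOn hψ.contOn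
  refine ⟨L, hL0, M, fun h hh u hu => ?_⟩
  rw [pauliRayleigh_eq hΩ hψ hu]
  have hpos := hu.integral_pos
  obtain ⟨hu1, hu2, hu3, -⟩ := hu
  obtain ⟨θ, hθ, hθ1, hθΩ, -⟩ := exists_smooth_cutoff (isClosed_tsupport u) hΩ hu3
  set φ : ℝ × ℝ → ℝ := fun x => θ x • ψ x with hφ
  have hφ2 : ContDiff ℝ 2 φ := contDiff_cutoff_mul (hθ.of_le two_le_smooth) hθΩ
    fun x hx => hψ.c2.contDiffAt (hΩ.mem_nhds hx)
  have heq (x) (hx : x ∈ tsupport u) : φ =ᶠ[𝓝 x] ψ := by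
    filter_upwards [hθ1 x hx] with y hy
    simp [hφ, hy]
  have hφM (x) (hx : x ∈ tsupport u) : |φ x| ≤ M := by
    rw [(heq x hx).eq_of_nhds]; exact hM x (subset_closure (hu3 hx))
  have z0 (x) (hx : x ∉ tsupport u) : u x = 0 := image_eq_zero_of_notMem_tsupport hx
  have hu2' := hu1.of_le two_le_smooth
  set w : ℝ × ℝ → ℂ := fun x => Real.exp (φ x / h) • u x with hw
  have hw2 : ContDiff ℝ 2 w := (Real.contDiff_exp.comp (hφ2.div_const h)).smul hu2'
  have htw : tsupport w ⊆ tsupport u := tsupport_smul_subset_right _ _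
  have hwc : HasCompactSupport w := HasCompactSupport.intro hu2 fun x hx => by
    simp [hw, z0 x hx]
  have hφd := hφ2.differentiable (by norm_num)
  have hud := hu2'.differentiable (by norm_num)
  have w1 (x) : pd1 w x = _ := pd1_exp_smul h (hφd x) (hud x)
  have w2 (x) : pd2 w x = _ := pd2_exp_smul h (hφd x) (hud x)
  have cw1 : Continuous (pd1 w) := (hw2.pd1 (m := 1) (by norm_num)).continuous
  have cw2 : Continuous (pd2 w) := (hw2.pd2 (m := 1) (by norm_num)).continuous
  have cu := hu1.continuous
  have cw := hw2.continuous
  have zw (x) (hx : x ∉ tsupport u) : pd1 w x = 0 ∧ pd2 w x = 0 := by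
    have hx' := fun hh => hx (htw hh)
    exact ⟨pd1_eq_zero_of_notMem_tsupport hx', pd2_eq_zero_of_notMem_tsupport hx'⟩
  have zu1 (x) (hx : x ∉ tsupport u) : pd1 u x = 0 := pd1_eq_zero_of_notMem_tsupport hx
  have zu2 (x) (hx : x ∉ tsupport u) : pd2 u x = 0 := pd2_eq_zero_of_notMem_tsupport hx
  have iD : Integrable fun x => ‖pd1 w x + Complex.I * pd2 w x‖ ^ 2 :=
    Continuous.integrable_of_hasCompactSupport (by fun_prop)
      (HasCompactSupport.intro hu2 fun x hx => by simp [zw x hx])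
  have i1 : Integrable fun x => ‖pd1 w x‖ ^ 2 :=
    Continuous.integrable_of_hasCompactSupport (by fun_prop)
      (HasCompactSupport.intro hu2 fun x hx => by simp [zw x hx])
  have i2 : Integrable fun x => ‖pd2 w x‖ ^ 2 :=
    Continuous.integrable_of_hasCompactSupport (by fun_prop)
      (HasCompactSupport.intro hu2 fun x hx => by simp [zw x hx])
  have iu : Integrable fun x => ‖u x‖ ^ 2 :=
    Continuous.integrable_of_hasCompactSupport (by fun_prop)
      (HasCompactSupport.intro hu2 fun x hx => by simp [z0 x hx])
  have iw : Integrable fun x => ‖w x‖ ^ 2 :=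
    Continuous.integrable_of_hasCompactSupport (by fun_prop)
      (HasCompactSupport.intro hu2 fun x hx => by simp [hw, z0 x hx])
  set N : ℝ × ℝ → ℝ := fun x => ‖(h : ℂ) * (pd1 u x + Complex.I * pd2 u x)
      + (((pd1 ψ x : ℝ) : ℂ) + Complex.I * ((pd2 ψ x : ℝ) : ℂ)) * u x‖ ^ 2 with hN
  have hNeq (x) : N x = h ^ 2 * Real.exp (-φ x / h) ^ 2 *
      ‖pd1 w x + Complex.I * pd2 w x‖ ^ 2 := by
    by_cases hx : x ∈ tsupport u
    · have : (h : ℂ) * (pd1 u x + Complex.I * pd2 u x)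
          + (((pd1 ψ x : ℝ) : ℂ) + Complex.I * ((pd2 ψ x : ℝ) : ℂ)) * u x =
          (h : ℂ) * (Real.exp (-φ x / h) : ℂ) * (pd1 w x + Complex.I * pd2 w x) := by
        rw [w1, w2, ← (heq x hx).pd1.eq_of_nhds, ← (heq x hx).pd2.eq_of_nhds]
        have hh' : (h : ℂ) ≠ 0 := by exact_mod_cast hh.ne'
        have he : (Real.exp (-φ x / h) : ℂ) * (Real.exp (φ x / h) : ℂ) = 1 := by
          rw [← Complex.ofReal_mul, ← Real.exp_add, neg_div, neg_add_cancel]; simp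
        push_cast at he ⊢
        generalize Complex.exp (-(φ x : ℂ) / h) = e1 at he ⊢
        generalize Complex.exp ((φ x : ℂ) / h) = e2 at he ⊢
        have : (h : ℂ) * e1 * (e2 * (pd1 u x + ((pd1 φ x : ℝ) : ℂ) / h * u x) +
            Complex.I * (e2 * (pd2 u x + ((pd2 φ x : ℝ) : ℂ) / h * u x))) =
            (e1 * e2) * (h * (pd1 u x + Complex.I * pd2 u x) +
            (((pd1 φ x : ℝ) : ℂ) + Complex.I * ((pd2 φ x : ℝ) : ℂ)) * u x) := by
          field_simp
          ring
        rw [this, he, one_mul]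
      simp only [hN, this, norm_mul, mul_pow]
      simp [Complex.norm_exp, Complex.norm_real]
    · simp [hN, zw x hx, zu1 x hx, zu2 x hx, z0 x hx]
  have iN : Integrable N := by
    have cφ := hφ2.continuous
    refine (Continuous.integrable_of_hasCompactSupport
      (f := fun x => h ^ 2 * Real.exp (-φ x / h) ^ 2 *
      ‖pd1 w x + Complex.I * pd2 w x‖ ^ 2) (by fun_prop)
      (HasCompactSupport.intro hu2 fun x hx => by simp [zw x hx])).congr
      (ae_of_all _ fun x => (hNeq x).symm)
  have s1 : h ^ 2 * Real.exp (-(2 * M) / h) * ∫ x, ‖pd1 w x + Complex.I * pd2 w x‖ ^ 2 ≤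
      ∫ x, N x := by
    rw [← integral_const_mul]
    refine integral_mono (iD.const_mul _) iN fun x => ?_
    simp only [hNeq]
    by_cases hx : x ∈ tsupport u
    · rw [← Real.exp_nat_mul]
      gcongr
      have := (le_abs_self _).trans (hφM x hx)
      push_cast
      rw [mul_div_assoc', div_le_div_iff_of_pos_right hh]
      linarith
    · simp [zw x hx]
  have s2 := poincare_le (hw2.of_le (by norm_num)) hwc
    (L := L) fun x hx => (norm_fst_le x).trans (hL x (hu3 (htw hx)))
  have s3 : ∫ x, ‖pd1 w x‖ ^ 2 ≤ ∫ x, ‖pd1 w x + Complex.I * pd2 w x‖ ^ 2 := by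
    rw [← integral_gradient_eq hw2 hwc]
    exact integral_mono i1 (i1.add i2) fun x => by
      nlinarith [sq_nonneg ‖pd2 w x‖]
  have s4 : Real.exp (-(2 * M) / h) * ∫ x, ‖u x‖ ^ 2 ≤ ∫ x, ‖w x‖ ^ 2 := by
    rw [← integral_const_mul]
    refine integral_mono (iu.const_mul _) iw fun x => ?_
    by_cases hx : x ∈ tsupport u
    · simp only [hw, norm_smul, mul_pow, Real.norm_eq_abs, Real.abs_exp]
      rw [← Real.exp_nat_mul]
      gcongr
      have := (neg_abs_le _).trans' (neg_le_neg (hφM x hx))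
      push_cast
      rw [mul_div_assoc', div_le_div_iff_of_pos_right hh]
      linarith
    · simp [hw, z0 x hx]
  rw [div_le_div_iff₀ (by positivity) hpos]
  have hexp : Real.exp (-(4 * M) / h) = Real.exp (-(2 * M) / h) * Real.exp (-(2 * M) / h) := by
    rw [← Real.exp_add]; congr 1; ring
  have e0 := Real.exp_pos (-(2 * M) / h)
  rw [hexp]
  calc _ = h ^ 2 * Real.exp (-(2 * M) / h) * (Real.exp (-(2 * M) / h) * ∫ x, ‖u x‖ ^ 2) := by ring
    _ ≤ h ^ 2 * Real.exp (-(2 * M) / h) * (4 * L ^ 2 * ∫ x, ‖pd1 w x + Complex.I * pd2 w x‖ ^ 2) := by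
      exact mul_le_mul_of_nonneg_left
        (s4.trans (s2.trans (mul_le_mul_of_nonneg_left s3 (by positivity)))) (by positivity)
    _ = (h ^ 2 * Real.exp (-(2 * M) / h) * ∫ x, ‖pd1 w x + Complex.I * pd2 w x‖ ^ 2) * (4 * L ^ 2) := by
      ring
    _ ≤ _ := by gcongr

end LowerBound

section Mollification
open scoped Convolution

lemma exists_smooth_approx {g : ℝ × ℝ → ℝ} (hg : ContDiff ℝ 1 g) (hc : HasCompactSupport g)
    {ε : ℝ} (hε : 0 < ε) : ∃ k : ℝ × ℝ → ℝ, ContDiff ℝ (⊤ : ℕ∞) k ∧ (∀ x, |k x - g x| ≤ ε) ∧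
      ∀ x, ‖fderiv ℝ k x - fderiv ℝ g x‖ ≤ ε := by
  have hg' : Continuous (fderiv ℝ g) := hg.continuous_fderiv (by norm_num)
  obtain ⟨d1, hd1, h1⟩ := Metric.uniformContinuous_iff.1
    (hc.uniformContinuous_of_continuous hg.continuous) ε hε
  obtain ⟨d2, hd2, h2⟩ := Metric.uniformContinuous_iff.1
    ((hc.fderiv ℝ).uniformContinuous_of_continuous hg') ε hε
  let φ : ContDiffBump (0 : ℝ × ℝ) :=
    ⟨min d1 d2 / 2, min d1 d2, by positivity, by linarith [lt_min hd1 hd2]⟩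
  have hr : φ.rOut = min d1 d2 := rfl
  have hφ : LocallyIntegrable (φ.normed volume) volume :=
    φ.continuous_normed.locallyIntegrable
  refine ⟨φ.normed volume ⋆[ContinuousLinearMap.lsmul ℝ ℝ, volume] g, ?_, fun x => ?_, fun x => ?_⟩
  · exact φ.hasCompactSupport_normed.contDiff_convolution_left _ φ.contDiff_normed
      hg.continuous.locallyIntegrable
  · rw [← Real.dist_eq]
    refine φ.dist_normed_convolution_le hg.continuous.aestronglyMeasurable fun y hy => ?_
    exact (h1 (lt_of_lt_of_le (Metric.mem_ball.1 hy) (hr ▸ min_le_left _ _))).le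
  · have := (hc.hasFDerivAt_convolution_right (ContinuousLinearMap.lsmul ℝ ℝ) hφ hg x).fderiv
    rw [this]
    have e : (φ.normed volume ⋆[(ContinuousLinearMap.lsmul ℝ ℝ).precompR (ℝ × ℝ), volume]
        fderiv ℝ g) x = (φ.normed volume ⋆[ContinuousLinearMap.lsmul ℝ ℝ, volume]
        fderiv ℝ g) x := by
      simp only [convolution]
      rfl
    rw [e, ← dist_eq_norm]
    refine φ.dist_normed_convolution_le hg'.aestronglyMeasurable fun y hy => ?_
    exact (h2 (lt_of_lt_of_le (Metric.mem_ball.1 hy) (hr ▸ min_le_right _ _))).le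

end Mollification

section Radial

noncomputable def sqDist (x a : ℝ × ℝ) : ℝ := (x.1 - a.1) ^ 2 + (x.2 - a.2) ^ 2

lemma sqDist_nonneg (x a : ℝ × ℝ) : 0 ≤ sqDist x a := by unfold sqDist; positivity

lemma sqDist_comm (x a : ℝ × ℝ) : sqDist x a = sqDist a x := by unfold sqDist; ring

lemma sqDist_self (x : ℝ × ℝ) : sqDist x x = 0 := by simp [sqDist]

lemma contDiff_sqDist {n : WithTop ℕ∞} (a : ℝ × ℝ) : ContDiff ℝ n fun x => sqDist x a := by
  unfold sqDist; fun_prop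

lemma continuous_sqDist : Continuous fun p : (ℝ × ℝ) × (ℝ × ℝ) => sqDist p.1 p.2 := by
  unfold sqDist; fun_prop

lemma sq_dist_le_sqDist (x a : ℝ × ℝ) : dist x a ^ 2 ≤ sqDist x a := by
  rw [Prod.dist_eq, Real.dist_eq, Real.dist_eq]
  rcases max_cases |x.1 - a.1| |x.2 - a.2| with h | h <;> rw [h.1, sq_abs] <;> unfold sqDist <;>
    nlinarith [sq_nonneg (x.1 - a.1), sq_nonneg (x.2 - a.2)]

lemma sqDist_le_two_mul_sq_dist (x a : ℝ × ℝ) : sqDist x a ≤ 2 * dist x a ^ 2 := by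
  have h1 : |x.1 - a.1| ≤ dist x a := by rw [Prod.dist_eq, Real.dist_eq]; exact le_max_left _ _
  have h2 : |x.2 - a.2| ≤ dist x a := by
    rw [Prod.dist_eq, Real.dist_eq (x.2)]; exact le_max_right _ _
  have := pow_le_pow_left₀ (abs_nonneg _) h1 2
  have := pow_le_pow_left₀ (abs_nonneg _) h2 2
  rw [sq_abs] at *
  unfold sqDist
  linarith

lemma sqDist_pos {x a : ℝ × ℝ} (h : x ≠ a) : 0 < sqDist x a :=
  lt_of_lt_of_le (by have := dist_pos.2 h; positivity) (sq_dist_le_sqDist x a)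

lemma hasFDerivAt_sqDist (x a : ℝ × ℝ) : HasFDerivAt (fun x => sqDist x a)
    ((2 * (x.1 - a.1)) • ContinuousLinearMap.fst ℝ ℝ ℝ +
      (2 * (x.2 - a.2)) • ContinuousLinearMap.snd ℝ ℝ ℝ) x := by
  have h1 := ((hasFDerivAt_fst (𝕜 := ℝ) (p := x)).sub_const a.1).pow 2
  have h2 := ((hasFDerivAt_snd (𝕜 := ℝ) (p := x)).sub_const a.2).pow 2
  refine (h1.add h2).congr_fderiv ?_
  ext <;> simp

lemma pd1_sqDist (x a : ℝ × ℝ) : pd1 (fun x => sqDist x a) x = 2 * (x.1 - a.1) := by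
  simp [pd1, (hasFDerivAt_sqDist x a).fderiv]

lemma pd2_sqDist (x a : ℝ × ℝ) : pd2 (fun x => sqDist x a) x = 2 * (x.2 - a.2) := by
  simp [pd2, (hasFDerivAt_sqDist x a).fderiv]

lemma lap_sqDist (x a : ℝ × ℝ) : lap (fun x => sqDist x a) x = 4 := by
  have h1 : pd1 (fun x => sqDist x a) = fun x => 2 * (x.1 - a.1) := funext fun x => pd1_sqDist x a
  have h2 : pd2 (fun x => sqDist x a) = fun x => 2 * (x.2 - a.2) := funext fun x => pd2_sqDist x a
  have h3 := (((hasFDerivAt_fst (𝕜 := ℝ) (p := x)).sub_const a.1).const_mul 2).fderiv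
  have h4 := (((hasFDerivAt_snd (𝕜 := ℝ) (p := x)).sub_const a.2).const_mul 2).fderiv
  rw [lap, h1, h2, pd1, pd2, h3, h4]
  simp
  norm_num

lemma lap_radial {G : ℝ → ℝ} {x a : ℝ × ℝ} (hG : ContDiffAt ℝ 2 G (sqDist x a)) :
    lap (fun x => G (sqDist x a)) x =
      4 * sqDist x a * deriv (deriv G) (sqDist x a) + 4 * deriv G (sqDist x a) := by
  rw [lap_comp (f := fun x => sqDist x a) hG (contDiff_sqDist a).contDiffAt, lap_sqDist,
    pd1_sqDist, pd2_sqDist]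
  simp only [sqDist]
  ring

lemma deriv_half_log_add (c t : ℝ) :
    deriv (fun s => Real.log (s + c) / 2) t = (t + c)⁻¹ / 2 := by
  rw [deriv_div_const, deriv_comp_add_const, Real.deriv_log]

lemma lap_half_log_add {x a : ℝ × ℝ} {c : ℝ} (h : sqDist x a + c ≠ 0) :
    lap (fun x => Real.log (sqDist x a + c) / 2) x = 2 * c / (sqDist x a + c) ^ 2 := by
  have h0 : ContDiffAt ℝ 2 (fun s => Real.log (s + c) / 2) (sqDist x a) :=
    (ContDiffAt.log (f := fun s => s + c) (by fun_prop) h).div_const 2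
  rw [lap_radial (G := fun s => Real.log (s + c) / 2) h0,
    show deriv (fun s => Real.log (s + c) / 2) = fun t => (t + c)⁻¹ / 2 from
      funext (deriv_half_log_add c)]
  have : deriv (fun t => (t + c)⁻¹ / 2) (sqDist x a) = -1 / (sqDist x a + c) ^ 2 / 2 := by
    have := (((hasDerivAt_id (sqDist x a)).add_const c).inv h).div_const 2
    exact this.deriv
  rw [this]
  field_simp
  ring

end Radial

section Potential

lemma green_identity {J g : ℝ × ℝ → ℝ} (hJ : ContDiff ℝ 2 J) (hg : ContDiff ℝ 2 g)
    (hc : HasCompactSupport g) : ∫ x, lap g x * J x = ∫ x, lap J x * g x := by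
  have j1 : ContDiff ℝ 1 (pd1 J) := hJ.pd1 (by norm_num)
  have j2 : ContDiff ℝ 1 (pd2 J) := hJ.pd2 (by norm_num)
  have g1 : ContDiff ℝ 1 (pd1 g) := hg.pd1 (by norm_num)
  have g2 : ContDiff ℝ 1 (pd2 g) := hg.pd2 (by norm_num)
  have hJ1 : ContDiff ℝ 1 J := hJ.of_le (by norm_num)
  have hg1 : ContDiff ℝ 1 g := hg.of_le (by norm_num)
  have z0 (x) (hx : x ∉ tsupport g) : g x = 0 := image_eq_zero_of_notMem_tsupport hx
  have z1 (x) (hx : x ∉ tsupport g) : pd1 g x = 0 := pd1_eq_zero_of_notMem_tsupport hx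
  have z2 (x) (hx : x ∉ tsupport g) : pd2 g x = 0 := pd2_eq_zero_of_notMem_tsupport hx
  have zl (x) (hx : x ∉ tsupport g) : lap g x = 0 := by
    have h1 := (notMem_tsupport_iff_eventuallyEq.1 hx).fderiv (𝕜 := ℝ)
    have h2 : pd1 g =ᶠ[𝓝 x] 0 := by filter_upwards [h1] with y hy; simp [pd1, hy]
    have h3 : pd2 g =ᶠ[𝓝 x] 0 := by filter_upwards [h1] with y hy; simp [pd2, hy]
    rw [lap, pd1, pd2, h2.fderiv_eq, h3.fderiv_eq]
    simp
  let F1 : ℝ × ℝ → ℝ := fun x => J x * pd1 g x - g x * pd1 J x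
  let F2 : ℝ × ℝ → ℝ := fun x => J x * pd2 g x - g x * pd2 J x
  have hF1 : ContDiff ℝ 1 F1 := by fun_prop
  have hF2 : ContDiff ℝ 1 F2 := by fun_prop
  have cF1 : HasCompactSupport F1 := HasCompactSupport.intro hc fun x hx => by
    simp [F1, z0 x hx, z1 x hx]
  have cF2 : HasCompactSupport F2 := HasCompactSupport.intro hc fun x hx => by
    simp [F2, z0 x hx, z2 x hx]
  have dJ := hJ1.differentiable (by norm_num)
  have dg := hg1.differentiable (by norm_num)
  have dj1 := j1.differentiable (by norm_num)
  have dj2 := j2.differentiable (by norm_num)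
  have dg1 := g1.differentiable (by norm_num)
  have dg2 := g2.differentiable (by norm_num)
  have e1 (x) : pd1 F1 x = J x * pd1 (pd1 g) x - g x * pd1 (pd1 J) x := by
    have : pd1 F1 x = pd1 (fun x => J x * pd1 g x) x - pd1 (fun x => g x * pd1 J x) x := by
      rw [pd1, fderiv_fun_sub (by fun_prop) (by fun_prop)]; rfl
    rw [this, pd1_mul (dJ x) (dg1 x), pd1_mul (dg x) (dj1 x)]; ring
  have e2 (x) : pd2 F2 x = J x * pd2 (pd2 g) x - g x * pd2 (pd2 J) x := by
    have : pd2 F2 x = pd2 (fun x => J x * pd2 g x) x - pd2 (fun x => g x * pd2 J x) x := by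
      rw [pd2, fderiv_fun_sub (by fun_prop) (by fun_prop)]; rfl
    rw [this, pd2_mul (dJ x) (dg2 x), pd2_mul (dg x) (dj2 x)]; ring
  have clg : Continuous (lap g) :=
    (g1.pd1 (m := 0) (by norm_num)).continuous.add (g2.pd2 (m := 0) (by norm_num)).continuous
  have clJ : Continuous (lap J) :=
    (j1.pd1 (m := 0) (by norm_num)).continuous.add (j2.pd2 (m := 0) (by norm_num)).continuous
  have cJ := hJ.continuous
  have cg := hg.continuous
  have i1 : Integrable fun x => lap g x * J x :=
    Continuous.integrable_of_hasCompactSupport (by fun_prop)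
      (HasCompactSupport.intro hc fun x hx => by simp [zl x hx])
  have i2 : Integrable fun x => lap J x * g x :=
    Continuous.integrable_of_hasCompactSupport (by fun_prop)
      (HasCompactSupport.intro hc fun x hx => by simp [z0 x hx])
  have iF1 : Integrable (pd1 F1) :=
    (hF1.pd1 (m := 0) (by norm_num)).continuous.integrable_of_hasCompactSupport cF1.pd1
  have iF2 : Integrable (pd2 F2) :=
    (hF2.pd2 (m := 0) (by norm_num)).continuous.integrable_of_hasCompactSupport cF2.pd2
  rw [← sub_eq_zero, ← integral_sub i1 i2, ← add_zero (0 : ℝ)]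
  nth_rw 1 [← integral_pd1_eq_zero hF1 cF1]
  rw [← integral_pd2_eq_zero hF2 cF2, ← integral_add iF1 iF2]
  refine integral_congr_ae (ae_of_all _ fun x => ?_)
  simp only [e1, e2, lap]
  ring

/-- The regularised logarithmic kernel. -/
noncomputable def logKer (ε : ℝ) (z w : ℝ × ℝ) : ℝ := Real.log (sqDist z w + ε ^ 2) / 2

lemma logKer_comm (ε : ℝ) (z w : ℝ × ℝ) : logKer ε z w = logKer ε w z := by
  rw [logKer, sqDist_comm, logKer]

lemma sqDist_add_pos {ε : ℝ} (hε : 0 < ε) (z w : ℝ × ℝ) : 0 < sqDist z w + ε ^ 2 := by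
  have := sqDist_nonneg z w
  positivity

lemma contDiff_logKer {ε : ℝ} (hε : 0 < ε) (z : ℝ × ℝ) {n : WithTop ℕ∞} :
    ContDiff ℝ n fun w => logKer ε w z :=
  (ContDiff.log ((contDiff_sqDist z).add contDiff_const)
    fun x => (sqDist_add_pos hε x z).ne').div_const 2

lemma continuous_logKer {ε : ℝ} (hε : 0 < ε) :
    Continuous fun p : (ℝ × ℝ) × (ℝ × ℝ) => logKer ε p.1 p.2 :=
  ((continuous_sqDist.add continuous_const).log fun p => (sqDist_add_pos hε p.1 p.2).ne').div_const 2

/-- The Poisson-type profile of the regularised logarithmic kernel. -/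
noncomputable def profile (t : ℝ × ℝ) : ℝ := 2 / (sqDist t 0 + 1) ^ 2

lemma profile_pos (t : ℝ × ℝ) : 0 < profile t := by
  have := sqDist_nonneg t 0
  unfold profile; positivity

lemma continuous_profile : Continuous profile := by
  unfold profile
  refine continuous_const.div ?_ fun t => by have := sqDist_nonneg t 0; positivity
  have := (contDiff_sqDist (n := 0) 0).continuous
  fun_prop

lemma profile_le (t : ℝ × ℝ) : profile t * (1 + ‖t‖) ≤ 8 * (1 + ‖t‖) ^ (-3 : ℝ) := by
  have h := sq_dist_le_sqDist t 0
  rw [dist_zero_right] at h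
  have h0 := norm_nonneg t
  have h1 : (1 + ‖t‖) ^ 2 ≤ 2 * (sqDist t 0 + 1) := by nlinarith [sq_nonneg (1 - ‖t‖)]
  have h2 : ((1 + ‖t‖) ^ 2) ^ 2 ≤ (2 * (sqDist t 0 + 1)) ^ 2 :=
    pow_le_pow_left₀ (by positivity) h1 2
  rw [Real.rpow_neg (by positivity), show (3 : ℝ) = ((3 : ℕ) : ℝ) by norm_num, Real.rpow_natCast,
    profile, div_mul_eq_mul_div, ← div_eq_mul_inv, div_le_div_iff₀ (by
      have := sqDist_nonneg t 0; positivity) (by positivity)]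
  nlinarith

lemma integrable_profile_mul : Integrable fun t => profile t * (1 + ‖t‖) := by
  have hi : Integrable fun t : ℝ × ℝ => 8 * (1 + ‖t‖) ^ (-3 : ℝ) :=
    (integrable_one_add_norm (by simp; norm_num)).const_mul 8
  refine hi.mono' ?_ (ae_of_all _ fun t => ?_)
  · have := continuous_profile
    exact Continuous.aestronglyMeasurable (by fun_prop)
  · rw [Real.norm_of_nonneg (mul_nonneg (profile_pos t).le (by positivity))]
    exact profile_le t

lemma integrable_profile : Integrable profile := by
  refine integrable_profile_mul.mono' continuous_profile.aestronglyMeasurable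
    (ae_of_all _ fun t => ?_)
  rw [Real.norm_of_nonneg (profile_pos t).le]
  nlinarith [profile_pos t, norm_nonneg t]

lemma integral_profile_pos : 0 < ∫ t, profile t := by
  refine (integral_pos_iff_support_of_nonneg (fun t => (profile_pos t).le) integrable_profile).2 ?_
  have : Function.support profile = univ := by
    ext t; simpa using (profile_pos t).ne'
  simp [this]

lemma integral_lap_mul_logKer {g : ℝ × ℝ → ℝ} (hg : ContDiff ℝ 2 g) (hc : HasCompactSupport g)
    {ε : ℝ} (hε : 0 < ε) (z : ℝ × ℝ) :
    ∫ w, lap g w * logKer ε w z = ∫ t, profile t * g (z + ε • t) := by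
  rw [green_identity (contDiff_logKer hε z) hg hc]
  set f : ℝ × ℝ → ℝ := fun w => lap (fun w => logKer ε w z) w * g w with hf
  have h1 : ∫ t, f (z + ε • t) = (ε ^ 2)⁻¹ * ∫ w, f w := by
    rw [Measure.integral_comp_smul volume (fun t => f (z + t)) ε, integral_add_left_eq_self f z]
    simp [abs_of_pos hε]
  have h2 : ∫ t, f (z + ε • t) = (ε ^ 2)⁻¹ * ∫ t, profile t * g (z + ε • t) := by
    rw [← integral_const_mul]
    refine integral_congr_ae (ae_of_all _ fun t => ?_)
    have h3 : sqDist (z + ε • t) z = ε ^ 2 * sqDist t 0 := by simp [sqDist]; ring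
    have h4 := sqDist_nonneg t 0
    simp only [hf, logKer]
    rw [lap_half_log_add (sqDist_add_pos hε _ _).ne', h3, profile]
    field_simp
  have := h1.symm.trans h2
  have h5 : (ε ^ 2)⁻¹ ≠ 0 := by positivity
  exact mul_left_cancel₀ h5 this

lemma abs_integral_lap_mul_logKer_sub_le {g : ℝ × ℝ → ℝ} (hg : ContDiff ℝ 2 g)
    (hc : HasCompactSupport g) : ∃ C, ∀ ε > 0, ∀ z,
      |(∫ w, lap g w * logKer ε w z) - (∫ t, profile t) * g z| ≤ C * ε := by
  obtain ⟨K, hK⟩ := ContDiff.lipschitzWith_of_hasCompactSupport (𝕂 := ℝ) (f := g) hc hg two_ne_zero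
  refine ⟨∫ t, profile t * (1 + ‖t‖) * K, fun ε hε z => ?_⟩
  rw [integral_lap_mul_logKer hg hc hε z, ← integral_mul_const, ← integral_sub]
  · rw [← integral_mul_const]
    refine norm_integral_le_of_norm_le (G := ℝ) ((integrable_profile_mul.mul_const _).mul_const _)
      (ae_of_all _ fun t => ?_)
    rw [← mul_sub, norm_mul, Real.norm_of_nonneg (profile_pos t).le, mul_assoc, mul_assoc]
    refine mul_le_mul_of_nonneg_left ?_ (profile_pos t).le
    have := hK.dist_le_mul (z + ε • t) z
    rw [dist_eq_norm, dist_eq_norm, add_sub_cancel_left, norm_smul, Real.norm_of_nonneg hε.le]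
      at this
    refine this.trans ?_
    have : (K : ℝ) * (ε * ‖t‖) ≤ K * (ε * (1 + ‖t‖)) := by gcongr; linarith
    linarith
  · obtain ⟨M, hM⟩ := hg.continuous.bounded_above_of_compact_support hc
    have cg := hg.continuous
    exact integrable_profile.mul_bdd (c := M) (by
      exact Continuous.aestronglyMeasurable (by fun_prop)) (ae_of_all _ fun t => hM _)
  · exact integrable_profile.mul_const _

end Potential

section Discretize

lemma exists_finite_approx_measure {K D : Set (ℝ × ℝ)} (hK : IsCompact K) (ν : Measure (ℝ × ℝ))
    [IsFiniteMeasure ν] (hD : ∀ᵐ w ∂ν, w ∈ D) (hDb : Bornology.IsBounded D)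
    {F : (ℝ × ℝ) × (ℝ × ℝ) → ℝ} (hF : Continuous F) {η : ℝ} (hη : 0 < η) :
    ∃ (n : ℕ) (c : Fin n → ℝ) (w : Fin n → ℝ × ℝ), (∀ i, 0 ≤ c i) ∧ (∀ i, w i ∈ D) ∧
      ∑ i, c i ≤ ν.real univ ∧
      ∀ z ∈ K, |∑ i, c i * F (z, w i) - ∫ w, F (z, w) ∂ν| ≤ η := by
  rcases eq_or_ne ν 0 with rfl | hν
  · exact ⟨0, 0, 0, by simp, by simp, by simp, by simp [hη.le]⟩
  have : NeZero ν := ⟨hν⟩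
  have : CompactSpace K := isCompact_iff_compactSpace.1 hK
  let Φ : C(ℝ × ℝ, C(K, ℝ)) :=
    ContinuousMap.curry ⟨fun p : (ℝ × ℝ) × K => F ((p.2 : ℝ × ℝ), p.1), by fun_prop⟩
  have hΦ (w : ℝ × ℝ) (z : K) : Φ w z = F (z, w) := rfl
  obtain ⟨M, hM⟩ := hDb.isCompact_closure.exists_bound_of_continuousOn Φ.continuous.continuousOn
  have hi : Integrable Φ ν := by
    refine Integrable.of_bound Φ.continuous.aestronglyMeasurable M ?_
    filter_upwards [hD] with w hw using hM w (subset_closure hw)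
  set m := ν.real univ with hm
  have hm0 : 0 < m := by
    rw [hm, measureReal_def]
    exact ENNReal.toReal_pos (by simpa using hν) (measure_ne_top _ _)
  have hav : (⨍ w, Φ w ∂ν) ∈ closure (convexHull ℝ (Φ '' D)) := by
    refine ((convex_convexHull ℝ _).closure).average_mem isClosed_closure ?_ hi
    filter_upwards [hD] with w hw
    exact subset_closure (subset_convexHull ℝ _ ⟨w, hw, rfl⟩)
  obtain ⟨y, hy, hdist⟩ := Metric.mem_closure_iff.1 hav (η / m) (by positivity)
  obtain ⟨ι, hι, a, v, ha, hsum, hv, rfl⟩ := mem_convexHull_iff_exists_fintype.1 hy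
  choose w hwD hw using hv
  let e := (Fintype.equivFin ι).symm
  refine ⟨Fintype.card ι, fun i => m * a (e i), fun i => w (e i),
    fun i => mul_nonneg hm0.le (ha _), fun i => hwD _, ?_, fun z hz => ?_⟩
  · rw [← Finset.mul_sum, e.sum_comp a, hsum, mul_one]
  · have h1 : ∫ w, F (z, w) ∂ν = m * (⨍ w, Φ w ∂ν) ⟨z, hz⟩ := by
      have := ContinuousLinearMap.integral_comp_comm (ContinuousMap.evalCLM ℝ (⟨z, hz⟩ : K)) hi
      simp only [ContinuousMap.evalCLM_apply, hΦ] at this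
      rw [this, average_eq, ContinuousMap.smul_apply, smul_eq_mul, ← hm, mul_inv_cancel_left₀ hm0.ne']
    have h2 : ∑ i, m * a (e i) * F (z, w (e i)) = m * (∑ i, a i • v i) ⟨z, hz⟩ := by
      rw [e.sum_comp fun i => m * a i * F (z, w i), ContinuousMap.sum_apply, Finset.mul_sum]
      refine Finset.sum_congr rfl fun i _ => ?_
      rw [ContinuousMap.smul_apply, ← hw, hΦ, smul_eq_mul, mul_assoc]
    rw [h1, h2, ← mul_sub, abs_mul, abs_of_pos hm0, ← Real.dist_eq, dist_comm]
    have := (ContinuousMap.dist_apply_le_dist (f := ⨍ w, Φ w ∂ν) (g := ∑ i, a i • v i)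
      ⟨z, hz⟩).trans hdist.le
    calc _ ≤ m * (η / m) := by gcongr
      _ = η := by field_simp

lemma exists_finite_approx {K D : Set (ℝ × ℝ)} (hK : IsCompact K) {ρ : ℝ × ℝ → ℝ}
    (hρ0 : ∀ w, 0 ≤ ρ w) (hρm : Measurable ρ) (hρ : Integrable ρ) (hD : ∀ w, ρ w ≠ 0 → w ∈ D)
    (hDb : Bornology.IsBounded D)
    {F : (ℝ × ℝ) × (ℝ × ℝ) → ℝ} (hF : Continuous F) {η : ℝ} (hη : 0 < η) :
    ∃ (n : ℕ) (c : Fin n → ℝ) (w : Fin n → ℝ × ℝ), (∀ i, 0 ≤ c i) ∧ (∀ i, w i ∈ D) ∧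
      ∑ i, c i ≤ ∫ w, ρ w ∧
      ∀ z ∈ K, |∑ i, c i * F (z, w i) - ∫ w, ρ w * F (z, w)| ≤ η := by
  set ν : Measure (ℝ × ℝ) := volume.withDensity fun w => ENNReal.ofReal (ρ w) with hν
  have hm : Measurable fun w => ENNReal.ofReal (ρ w) := hρm.ennreal_ofReal
  have : IsFiniteMeasure ν := isFiniteMeasure_withDensity_ofReal hρ.2
  have h1 : ∀ᵐ w ∂ν, w ∈ D := by
    rw [hν, ae_withDensity_iff hm]
    refine ae_of_all _ fun w hw => hD w fun h => hw (by simp [h])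
  have h2 : ν.real univ = ∫ w, ρ w := by
    rw [measureReal_def, hν, withDensity_apply _ MeasurableSet.univ, setLIntegral_univ,
      integral_eq_lintegral_of_nonneg_ae (ae_of_all _ hρ0) hρ.1]
  obtain ⟨n, c, w, hc, hw, hs, h⟩ := exists_finite_approx_measure hK ν h1 hDb hF hη
  refine ⟨n, c, w, hc, hw, h2 ▸ hs, fun z hz => ?_⟩
  have := h z hz
  rw [hν, integral_withDensity_eq_integral_toReal_smul hm (ae_of_all _ fun w => by simp)] at this
  simpa [ENNReal.toReal_ofReal (hρ0 _)] using this

end Discretize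

lemma log_le_logKer {ε : ℝ} (hε : 0 < ε) (z w : ℝ × ℝ) : Real.log ε ≤ logKer ε z w := by
  rw [logKer, le_div_iff₀ two_pos]
  calc Real.log ε * 2 = Real.log (ε ^ 2) := by rw [Real.log_pow]; push_cast; ring
    _ ≤ _ := Real.log_le_log (by positivity) (by linarith [sqDist_nonneg z w])

lemma logKer_zero_le (ε : ℝ) {z w : ℝ × ℝ} (h : z ≠ w) : logKer 0 z w ≤ logKer ε z w := by
  have := sqDist_pos h
  exact div_le_div_of_nonneg_right (Real.log_le_log (by simpa) (by nlinarith [sq_nonneg ε]))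
    zero_le_two

lemma logKer_le_zero_add (ε : ℝ) {z w : ℝ × ℝ} {d : ℝ} (hd : 0 < d) (h : d ≤ sqDist z w) :
    logKer ε z w ≤ logKer 0 z w + ε ^ 2 / (2 * d) := by
  have hs : 0 < sqDist z w := hd.trans_le h
  have h1 : sqDist z w + ε ^ 2 = sqDist z w * (1 + ε ^ 2 / sqDist z w) := by field_simp
  have h2 : Real.log (1 + ε ^ 2 / sqDist z w) ≤ ε ^ 2 / sqDist z w := by
    have := Real.log_le_sub_one_of_pos (x := 1 + ε ^ 2 / sqDist z w) (by positivity)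
    linarith
  have h3 : ε ^ 2 / sqDist z w ≤ ε ^ 2 / d := by gcongr
  have h4 : ε ^ 2 / (2 * d) = ε ^ 2 / d / 2 := by rw [mul_comm, div_div]
  rw [logKer, h1, Real.log_mul hs.ne' (by positivity), logKer, h4]
  simp only [ne_eq, OfNat.ofNat_ne_zero, not_false_eq_true, zero_pow, add_zero]
  linarith

lemma logKer_nonpos {ε : ℝ} {z w : ℝ × ℝ} (h : sqDist z w + ε ^ 2 ≤ 1) : logKer ε z w ≤ 0 :=
  div_nonpos_of_nonpos_of_nonneg (Real.log_nonpos
    (add_nonneg (sqDist_nonneg z w) (sq_nonneg ε)) h) zero_le_two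

lemma continuous_lap {g : ℝ × ℝ → ℝ} (hg : ContDiff ℝ 2 g) : Continuous (lap g) :=
  ((hg.pd1 (m := 1) (by norm_num)).pd1 (m := 0) (by norm_num)).continuous.add
    ((hg.pd2 (m := 1) (by norm_num)).pd2 (m := 0) (by norm_num)).continuous

lemma hasCompactSupport_lap {g : ℝ × ℝ → ℝ} (hc : HasCompactSupport g) :
    HasCompactSupport (lap g) :=
  hc.pd1.pd1.add hc.pd2.pd2

lemma tendsto_mul_log_nhdsGT (S M d C : ℝ) :
    Tendsto (fun ε : ℝ => C * ε + 4 * M * (ε * -Real.log ε) + S * (ε ^ 2 / (2 * d)) + S * (ε / 2))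
      (𝓝[>] 0) (𝓝 0) := by
  have h0 : Tendsto (fun ε : ℝ => ε) (𝓝[>] 0) (𝓝 0) := tendsto_nhdsWithin_of_tendsto_nhds tendsto_id
  have h1 : Tendsto (fun ε : ℝ => ε * -Real.log ε) (𝓝[>] 0) (𝓝 0) := by
    have := (tendsto_log_mul_rpow_nhdsGT_zero zero_lt_one).neg
    simp only [neg_zero, Real.rpow_one] at this
    refine this.congr fun x => by ring
  have := (((h0.const_mul C).add (h1.const_mul (4 * M))).add
    (((h0.pow 2).div_const (2 * d)).const_mul S)).add ((h0.div_const 2).const_mul S)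
  simpa using this

/-- Approximation of a function which is subharmonic on `W` by logarithmic potentials of finitely
many point charges, the negative ones lying off `W`. -/
lemma exists_point_charges {g : ℝ × ℝ → ℝ} (hg : ContDiff ℝ 2 g) (hc : HasCompactSupport g)
    {W K : Set (ℝ × ℝ)} (hW : IsOpen W) (hlap : ∀ x ∈ W, 0 ≤ lap g x) (hK : IsCompact K)
    (hKW : K ⊆ W) {p : ℝ × ℝ} (hp : p ∈ K) {δ : ℝ} (hδ : 0 < δ) :
    ∃ ε > 0, ∃ (n m : ℕ) (a : Fin n → ℝ) (w : Fin n → ℝ × ℝ) (b : Fin m → ℝ) (v : Fin m → ℝ × ℝ),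
      (∀ i, 0 ≤ a i) ∧ (∀ j, 0 ≤ b j) ∧ (∀ i, w i ≠ p) ∧ (∀ j, v j ∉ W) ∧
      (∀ z ∈ K, ∑ i, a i * logKer ε z (w i) - ∑ j, b j * logKer 0 z (v j) ≤ g z + δ) ∧
      g p - δ ≤ ∑ i, a i * logKer 0 p (w i) - ∑ j, b j * logKer 0 p (v j) := by
  set c := ∫ t, profile t with hcdef
  have hc0 : 0 < c := integral_profile_pos
  set g' : ℝ × ℝ → ℝ := fun x => c⁻¹ * g x with hg'
  have hg'2 : ContDiff ℝ 2 g' := contDiff_const.mul hg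
  have hg'c : HasCompactSupport g' := hc.mul_left
  set ρ := lap g' with hρ
  have hρc : Continuous ρ := continuous_lap hg'2
  have hρs : HasCompactSupport ρ := hasCompactSupport_lap hg'c
  have hρW : ∀ x ∈ W, 0 ≤ ρ x := fun x hx => by
    rw [hρ, hg', lap_const_mul _ hg.contDiffAt]
    exact mul_nonneg (by positivity) (hlap x hx)
  obtain ⟨C, hC⟩ := abs_integral_lap_mul_logKer_sub_le hg'2 hg'c
  have hcg : ∀ z, c * g' z = g z := fun z => by simp only [hg']; field_simp
  obtain ⟨M, hM⟩ := hρc.bounded_above_of_compact_support hρs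
  have hM0 : 0 ≤ M := (norm_nonneg _).trans (hM 0)
  have hρi : Integrable ρ := hρc.integrable_of_hasCompactSupport hρs
  set S := ∫ w, |ρ w| with hS
  have hS0 : 0 ≤ S := integral_nonneg fun w => abs_nonneg _
  obtain ⟨d, hd, hdW⟩ : ∃ d > 0, ∀ z ∈ K, ∀ v ∉ W, d ≤ sqDist z v := by
    obtain ⟨d, hd, h⟩ := hK.exists_thickening_subset_open hW hKW
    refine ⟨d ^ 2, by positivity, fun z hz v hv => ?_⟩
    refine le_trans ?_ (sq_dist_le_sqDist z v)
    by_contra! hlt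
    refine hv (h ?_)
    rw [Metric.mem_thickening_iff]
    exact ⟨z, hz, by rw [dist_comm]; exact lt_of_pow_lt_pow_left₀ 2 hd.le hlt⟩
  obtain ⟨r, hr, hrW⟩ := Metric.isOpen_iff.1 hW p (hKW hp)
  have hev := ((tendsto_mul_log_nhdsGT S M d C).eventually_lt_const (half_pos hδ)).and
    (Ioo_mem_nhdsGT (show (0 : ℝ) < min (1 / 4) (r ^ 2) by positivity))
  obtain ⟨ε, hεlt, hε0, hε1⟩ := hev.exists
  have hε4 : ε < 1 / 4 := hε1.trans_le (min_le_left _ _)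
  have hεr : √ε < r := by
    rw [Real.sqrt_lt' hr]; exact hε1.trans_le (min_le_right _ _)
  have hlog : 0 ≤ -Real.log ε := by
    have := Real.log_nonpos hε0.le (by linarith); linarith
  have hs0 : 0 < √ε := Real.sqrt_pos.2 hε0
  have hs2 : √ε ^ 2 = ε := Real.sq_sqrt hε0.le
  -- the three parts of the density
  set b0 := Metric.ball p (√ε) with hb0
  have hb0m : MeasurableSet b0 := measurableSet_ball
  set ρp := b0ᶜ.indicator (fun w => max (ρ w) 0) with hρp
  set ρd := b0.indicator (fun w => max (ρ w) 0) with hρd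
  set ρm := fun w => max (-ρ w) 0 with hρm
  have hmax : Integrable fun w => max (ρ w) 0 := hρi.pos_part
  have hpi : Integrable ρp := hmax.indicator hb0m.compl
  have hdi : Integrable ρd := hmax.indicator hb0m
  have hmi : Integrable ρm := hρi.neg.pos_part
  have hp0 : ∀ w, 0 ≤ ρp w := fun w => indicator_nonneg (fun _ _ => le_max_right _ _) _
  have hd0 : ∀ w, 0 ≤ ρd w := fun w => indicator_nonneg (fun _ _ => le_max_right _ _) _
  have hm0 : ∀ w, 0 ≤ ρm w := fun w => le_max_right _ _
  have hsum : ∀ w, ρ w = ρp w + ρd w - ρm w := fun w => by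
    have h1 : ρp w + ρd w = max (ρ w) 0 := by
      rw [add_comm]; exact indicator_self_add_compl_apply b0 _ w
    rw [h1]
    simp only [hρm]
    rcases le_total (ρ w) 0 with h | h
    · rw [max_eq_right h, max_eq_left (by linarith)]; ring
    · rw [max_eq_left h, max_eq_right (by linarith)]; ring
  have hple : ∫ w, ρp w ≤ S := integral_mono hpi hρi.abs fun w =>
    (indicator_le_self' (fun _ _ => le_max_right _ _) w).trans (max_le (le_abs_self _) (abs_nonneg _))
  have hmle : ∫ w, ρm w ≤ S := integral_mono hmi hρi.abs fun w =>
    max_le (neg_le_abs _) (abs_nonneg _)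
  have hts : Bornology.IsBounded (tsupport ρ) := hρs.isBounded
  have hnz : ∀ w, ρ w ≠ 0 → w ∈ tsupport ρ := fun w hw => subset_tsupport _ hw
  obtain ⟨n, a, w, ha, hw, hasum, happ⟩ := exists_finite_approx hK hp0
    ((hρc.max continuous_const).measurable.indicator hb0m.compl) hpi
    (D := tsupport ρ ∩ b0ᶜ) (fun w hw => by
      refine ⟨hnz w fun h => hw ?_, ?_⟩
      · simp [hρp, h]
      · by_contra h
        exact hw (indicator_of_notMem h _)) (hts.subset inter_subset_left)
    (continuous_logKer hε0) (show 0 < δ / 8 by positivity)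
  obtain ⟨m, b, v, hb, hv, hbsum, hbpp⟩ := exists_finite_approx hK hm0
    (hρc.neg.max continuous_const).measurable hmi
    (D := tsupport ρ ∩ Wᶜ) (fun w hw => by
      refine ⟨hnz w fun h => hw ?_, fun h => hw ?_⟩
      · simp [hρm, h]
      · exact max_eq_right (by linarith [hρW w h])) (hts.subset inter_subset_left)
    (continuous_logKer hε0) (show 0 < δ / 8 by positivity)
  simp only at happ hbpp
  have hcs : ∀ z, Continuous fun w => logKer ε z w := fun z =>
    (continuous_logKer hε0).comp (continuous_const.prodMk continuous_id)
  have hbd : ∀ z, ∃ R, ∀ w ∈ tsupport ρ, ‖logKer ε z w‖ ≤ R := fun z =>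
    hρs.exists_bound_of_continuousOn (hcs z).continuousOn
  have hint : ∀ z, ∀ σ : ℝ × ℝ → ℝ, Integrable σ → (∀ w, σ w ≠ 0 → ρ w ≠ 0) →
      Integrable fun w => σ w * logKer ε z w := fun z σ hσ hσ0 => by
    obtain ⟨R, hR⟩ := hbd z
    refine (hσ.norm.mul_const R).mono' (hσ.aestronglyMeasurable.mul
      (hcs z).aestronglyMeasurable) (ae_of_all _ fun w => ?_)
    by_cases h : σ w = 0
    · simp [h]
    · rw [norm_mul]
      exact mul_le_mul_of_nonneg_left (hR w (hnz w (hσ0 w h))) (norm_nonneg _)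
  have hpn : ∀ w, ρp w ≠ 0 → ρ w ≠ 0 := fun w hw h => hw (by simp [hρp, h])
  have hdn : ∀ w, ρd w ≠ 0 → ρ w ≠ 0 := fun w hw h => hw (by simp [hρd, h])
  have hmn : ∀ w, ρm w ≠ 0 → ρ w ≠ 0 := fun w hw h => hw (by simp [hρm, h])
  have hsplit : ∀ z, ∫ w, ρ w * logKer ε w z = (∫ w, ρp w * logKer ε z w) +
      (∫ w, ρd w * logKer ε z w) - ∫ w, ρm w * logKer ε z w := fun z => by
    have h1 := integral_sub ((hint z _ hpi hpn).add (hint z _ hdi hdn)) (hint z _ hmi hmn)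
    have h2 := integral_add (hint z _ hpi hpn) (hint z _ hdi hdn)
    simp only [Pi.add_apply] at h1
    rw [← h2, ← h1]
    refine integral_congr_ae (ae_of_all _ fun w => ?_)
    simp only
    rw [hsum w, logKer_comm]; ring
  have hmass : ∫ w, ρd w ≤ 4 * M * ε := by
    rw [hρd, integral_indicator hb0m]
    calc ∫ w in b0, max (ρ w) 0 ≤ ∫ w in b0, M := by
          refine integral_mono hmax.integrableOn (integrableOn_const (by
            exact measure_ball_lt_top.ne)) fun w => ?_
          exact max_le ((le_abs_self _).trans (hM w)) hM0
      _ = 4 * M * ε := by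
          rw [setIntegral_const, measureReal_def, hb0, ← ball_prod_same, Measure.volume_eq_prod,
            Measure.prod_prod, Real.volume_ball, Real.volume_ball, ENNReal.toReal_mul,
            ENNReal.toReal_ofReal (by positivity), smul_eq_mul]
          linear_combination (4 * M) * hs2
  have hId : ∀ z, -(4 * M * (ε * -Real.log ε)) ≤ ∫ w, ρd w * logKer ε z w := fun z => by
    calc -(4 * M * (ε * -Real.log ε)) = (4 * M * ε) * Real.log ε := by ring
      _ ≤ (∫ w, ρd w) * Real.log ε := by nlinarith
      _ = ∫ w, ρd w * Real.log ε := (integral_mul_const _ _).symm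
      _ ≤ _ := integral_mono (hdi.mul_const _) (hint z _ hdi hdn) fun w =>
          mul_le_mul_of_nonneg_left (log_le_logKer hε0 z w) (hd0 w)
  have hIdp : ∫ w, ρd w * logKer ε p w ≤ 0 := integral_nonpos fun w => by
    by_cases hwb : w ∈ b0
    · refine mul_nonpos_of_nonneg_of_nonpos (hd0 w) (logKer_nonpos ?_)
      have h1 := sqDist_le_two_mul_sq_dist p w
      have h2 : dist p w ^ 2 ≤ √ε ^ 2 := by
        refine pow_le_pow_left₀ dist_nonneg ?_ 2
        rw [dist_comm]; exact (Metric.mem_ball.1 hwb).le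
      rw [hs2] at h2
      nlinarith
    · simp [hρd, hwb]
  refine ⟨ε, hε0, n, m, a, w, b, v, ha, hb, fun i h => (hw i).2 ?_, fun j => (hv j).2,
    fun z hz => ?_, ?_⟩
  · rw [h]; exact Metric.mem_ball_self hs0
  · have h1 := abs_le.1 (happ z hz)
    have h2 := abs_le.1 (hbpp z hz)
    have h3 := abs_le.1 (hC ε hε0 z)
    rw [hcg, hsplit z] at h3
    have h4 := hId z
    have h5 : ∑ j, b j * logKer ε z (v j) ≤
        ∑ j, b j * logKer 0 z (v j) + S * (ε ^ 2 / (2 * d)) := by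
      calc _ ≤ ∑ j, (b j * logKer 0 z (v j) + b j * (ε ^ 2 / (2 * d))) :=
            Finset.sum_le_sum fun j _ => by
              rw [← mul_add]
              exact mul_le_mul_of_nonneg_left
                (logKer_le_zero_add ε hd (hdW z hz _ (hv j).2)) (hb j)
        _ ≤ _ := by
            rw [Finset.sum_add_distrib, ← Finset.sum_mul]
            have : 0 ≤ ε ^ 2 / (2 * d) := by positivity
            have := mul_le_mul_of_nonneg_right (hbsum.trans hmle) this
            linarith
    have h6 : 0 ≤ S * (ε / 2) := by positivity
    linarith
  · have h1 := abs_le.1 (happ p hp)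
    have h2 := abs_le.1 (hbpp p hp)
    have h3 := abs_le.1 (hC ε hε0 p)
    rw [hcg, hsplit p] at h3
    have h5 : ∑ j, b j * logKer 0 p (v j) ≤ ∑ j, b j * logKer ε p (v j) :=
      Finset.sum_le_sum fun j _ => mul_le_mul_of_nonneg_left
        (logKer_zero_le ε fun h => (hv j).2 (h ▸ hKW hp)) (hb j)
    have h6 : ∑ i, a i * logKer ε p (w i) ≤ ∑ i, a i * logKer 0 p (w i) + S * (ε / 2) := by
      calc _ ≤ ∑ i, (a i * logKer 0 p (w i) + a i * (ε / 2)) :=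
            Finset.sum_le_sum fun i _ => by
              rw [← mul_add]
              refine mul_le_mul_of_nonneg_left ?_ (ha i)
              have h7 : ε ≤ sqDist p (w i) := by
                refine le_trans ?_ (sq_dist_le_sqDist _ _)
                rw [← hs2]
                refine pow_le_pow_left₀ hs0.le ?_ 2
                have := (hw i).2
                rw [mem_compl_iff, Metric.mem_ball, not_lt] at this
                rwa [dist_comm]
              refine (logKer_le_zero_add ε hε0 h7).trans_eq ?_
              congr 1; field_simp
        _ ≤ _ := by
            rw [Finset.sum_add_distrib, ← Finset.sum_mul]
            have := mul_le_mul_of_nonneg_right (hasum.trans hple) (half_pos hε0).le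
            linarith
    have h7 : 0 ≤ S * (ε ^ 2 / (2 * d)) := by positivity
    have h8 : 0 ≤ 4 * M * (ε * -Real.log ε) := by positivity
    linarith

/-- The real-linear identification of the plane with `ℂ`. -/
noncomputable def toC : ℝ × ℝ →L[ℝ] ℂ :=
  Complex.ofRealCLM ∘L ContinuousLinearMap.fst ℝ ℝ ℝ +
    Complex.I • (Complex.ofRealCLM ∘L ContinuousLinearMap.snd ℝ ℝ ℝ)

lemma toC_apply (x : ℝ × ℝ) : toC x = (x.1 : ℂ) + Complex.I * (x.2 : ℂ) := by simp [toC]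

lemma sq_norm_toC_sub (z w : ℝ × ℝ) : ‖toC z - toC w‖ ^ 2 = sqDist z w := by
  rw [Complex.sq_norm_eq]
  simp [toC_apply, sqDist]

lemma norm_toC_sub_le {ε : ℝ} (hε : 0 < ε) (z w : ℝ × ℝ) :
    ‖toC z - toC w‖ ≤ Real.exp (logKer ε z w) := by
  refine le_of_sq_le_sq ?_ (Real.exp_pos _).le
  rw [sq_norm_toC_sub, ← Real.exp_nat_mul, logKer]
  push_cast
  rw [mul_div_cancel₀ _ two_ne_zero, Real.exp_log (sqDist_add_pos hε z w)]
  nlinarith [sq_nonneg ε]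

lemma norm_toC_sub_eq {z w : ℝ × ℝ} (h : z ≠ w) :
    ‖toC z - toC w‖ = Real.exp (logKer 0 z w) := by
  refine (pow_left_inj₀ (norm_nonneg _) (Real.exp_pos _).le two_ne_zero).1 ?_
  rw [sq_norm_toC_sub, ← Real.exp_nat_mul, logKer]
  push_cast
  rw [mul_div_cancel₀ _ two_ne_zero]
  simp [Real.exp_log (sqDist_pos h)]

lemma pd1_add_I_mul_pd2_comp_toC {F : ℂ → ℂ} {z : ℝ × ℝ} (hF : DifferentiableAt ℂ F (toC z)) :
    pd1 (fun x => F (toC x)) z + Complex.I * pd2 (fun x => F (toC x)) z = 0 := by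
  have h := (hF.hasDerivAt.hasFDerivAt.restrictScalars ℝ).comp z toC.hasFDerivAt
  have h' : fderiv ℝ (fun x => F (toC x)) z = _ := h.fderiv
  have h1 : toC (1, 0) = 1 := by simp [toC_apply]
  have h2 : toC (0, 1) = Complex.I := by simp [toC_apply]
  rw [pd1, pd2, h']
  simp [h1, h2]
  linear_combination (deriv F (toC z)) * Complex.I_mul_I

lemma continuousAt_logKer_zero {z w : ℝ × ℝ} (h : z ≠ w) : ContinuousAt (fun z => logKer 0 z w) z := by
  refine ((ContinuousAt.log ?_ ?_).div_const 2)
  · exact ((contDiff_sqDist (n := 0) w).continuous.continuousAt).add continuousAt_const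
  · simpa using (sqDist_pos h).ne'

lemma exists_holomorphic_approx {g : ℝ × ℝ → ℝ} (hg : ContDiff ℝ 2 g) (hc : HasCompactSupport g)
    {W K : Set (ℝ × ℝ)} (hW : IsOpen W) (hlap : ∀ x ∈ W, 0 ≤ lap g x) (hK : IsCompact K)
    (hKW : K ⊆ W) {p : ℝ × ℝ} (hp : p ∈ K) {δ : ℝ} (hδ : 0 < δ) :
    ∃ C : ℝ, ∃ N ∈ 𝓝 p, ∀ h > 0, ∃ f : ℝ × ℝ → ℂ,
      (∀ z ∈ W, ContDiffAt ℝ (⊤ : ℕ∞) f z) ∧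
      (∀ z ∈ W, pd1 f z + Complex.I * pd2 f z = 0) ∧
      (∀ z ∈ K, ‖f z‖ ≤ Real.exp ((g z + δ) / h + C)) ∧
      ∀ z ∈ N, Real.exp ((g p - δ) / h - C) ≤ ‖f z‖ := by
  obtain ⟨ε, hε, n, m, a, w, b, v, ha, hb, hw, hv, hup, hlo⟩ :=
    exists_point_charges hg hc hW hlap hK hKW hp (half_pos hδ)
  have hvK : ∀ z ∈ W, ∀ j, z ≠ v j := fun z hz j h => hv j (h ▸ hz)
  have hvp := hvK p (hKW hp)
  -- a common bound for the kernels
  obtain ⟨C1, hC1⟩ : ∃ C1, ∀ z ∈ K,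
      ‖∑ i, |logKer ε z (w i)| + ∑ j, |logKer 0 z (v j)|‖ ≤ C1 := by
    refine hK.exists_bound_of_continuousOn fun z hz => ContinuousAt.continuousWithinAt ?_
    refine ContinuousAt.add (tendsto_finsetSum _ fun i _ => ?_) (tendsto_finsetSum _ fun j _ => ?_)
    · exact ((continuous_logKer hε).comp (continuous_id.prodMk continuous_const)).abs.continuousAt
    · exact (continuousAt_logKer_zero (hvK z (hKW hz) j)).abs
  set T : ℝ × ℝ → ℝ := fun z => ∑ i, |logKer 0 z (w i)| + ∑ j, |logKer 0 z (v j)| with hT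
  set G : ℝ × ℝ → ℝ := fun z => ∑ i, a i * logKer 0 z (w i) - ∑ j, b j * logKer 0 z (v j) with hG
  have hTp : ContinuousAt T p := by
    refine ContinuousAt.add (tendsto_finsetSum _ fun i _ => ?_) (tendsto_finsetSum _ fun j _ => ?_)
    · exact (continuousAt_logKer_zero (hw i).symm).abs
    · exact (continuousAt_logKer_zero (hvp j)).abs
  have hGp : ContinuousAt G p := by
    refine ContinuousAt.sub (tendsto_finsetSum _ fun i _ => ?_) (tendsto_finsetSum _ fun j _ => ?_)
    · exact (continuousAt_logKer_zero (hw i).symm).const_mul _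
    · exact (continuousAt_logKer_zero (hvp j)).const_mul _
  have hN : ∀ᶠ z in 𝓝 p, T z < T p + 1 ∧ G p - δ / 2 < G z ∧ (∀ i, z ≠ w i) ∧ ∀ j, z ≠ v j :=
    (hTp.eventually_lt_const (by linarith)).and ((hGp.eventually_const_lt (by linarith)).and
      ((eventually_all.2 fun i => isOpen_ne.mem_nhds (hw i).symm).and
      (eventually_all.2 fun j => isOpen_ne.mem_nhds (hvp j))))
  refine ⟨max C1 (T p + 1), _, hN, fun h hh => ?_⟩
  set k : Fin n → ℕ := fun i => ⌈a i / h⌉₊ with hk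
  set l : Fin m → ℕ := fun j => ⌊b j / h⌋₊ with hl
  set F : ℂ → ℂ := fun s => (∏ i, (s - toC (w i)) ^ k i) * ∏ j, ((s - toC (v j)) ^ l j)⁻¹ with hF
  have hFs : ∀ z ∈ W, ContDiffAt ℂ (⊤ : ℕ∞) F (toC z) := fun z hz => by
    refine ContDiffAt.mul (contDiffAt_prod fun i _ => ?_) (contDiffAt_prod fun j _ => ?_)
    · fun_prop
    · refine ContDiffAt.inv (by fun_prop) (pow_ne_zero _ fun h0 => ?_)
      have := sqDist_pos (hvK z hz j)
      rw [← sq_norm_toC_sub, h0] at this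
      simp at this
  have hFn : ∀ z, ‖F (toC z)‖ =
      (∏ i, ‖toC z - toC (w i)‖ ^ k i) * ∏ j, (‖toC z - toC (v j)‖ ^ l j)⁻¹ := fun z => by
    simp [hF, norm_prod]
  have hkb : ∀ i, ∀ t : ℝ, |k i * t - a i / h * t| ≤ |t| := fun i t => by
    rw [← sub_mul, abs_mul]
    refine mul_le_of_le_one_left (abs_nonneg _) (abs_le.2 ⟨?_, ?_⟩)
    · linarith [Nat.le_ceil (a i / h)]
    · linarith [Nat.ceil_lt_add_one (div_nonneg (ha i) hh.le)]
  have hlb : ∀ j, ∀ t : ℝ, |l j * t - b j / h * t| ≤ |t| := fun j t => by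
    rw [← sub_mul, abs_mul]
    refine mul_le_of_le_one_left (abs_nonneg _) (abs_le.2 ⟨?_, ?_⟩)
    · linarith [Nat.lt_floor_add_one (b j / h)]
    · linarith [Nat.floor_le (div_nonneg (hb j) hh.le)]
  have hexp : ∀ (s : Fin n → ℝ) (t : Fin m → ℝ),
      (∏ i, Real.exp (s i) ^ k i) * ∏ j, (Real.exp (t j) ^ l j)⁻¹ =
        Real.exp (∑ i, k i * s i - ∑ j, l j * t j) := fun s t => by
    simp_rw [← Real.exp_nat_mul, ← Real.exp_neg, ← Real.exp_sum, ← Real.exp_add]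
    rw [Finset.sum_neg_distrib, sub_eq_add_neg]
  have hdiv : ∀ (s : Fin n → ℝ) (t : Fin m → ℝ),
      |(∑ i, k i * s i - ∑ j, l j * t j) - (∑ i, a i * s i - ∑ j, b j * t j) / h| ≤
        ∑ i, |s i| + ∑ j, |t j| := fun s t => by
    have h1 : (∑ i, k i * s i - ∑ j, l j * t j) - (∑ i, a i * s i - ∑ j, b j * t j) / h =
        ∑ i, (k i * s i - a i / h * s i) - ∑ j, (l j * t j - b j / h * t j) := by
      simp_rw [Finset.sum_sub_distrib, sub_div, Finset.sum_div, div_mul_eq_mul_div]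
      ring
    rw [h1]
    refine (abs_sub _ _).trans (add_le_add ?_ ?_)
    · exact (Finset.abs_sum_le_sum_abs _ _).trans (Finset.sum_le_sum fun i _ => hkb i _)
    · exact (Finset.abs_sum_le_sum_abs _ _).trans (Finset.sum_le_sum fun j _ => hlb j _)
  refine ⟨fun x => F (toC x), fun z hz => ?_, fun z hz => ?_, fun z hz => ?_, fun z hz => ?_⟩
  · exact ((hFs z hz).restrict_scalars ℝ).comp z toC.contDiff.contDiffAt
  · exact pd1_add_I_mul_pd2_comp_toC ((hFs z hz).differentiableAt (by simp))
  · rw [hFn]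
    calc _ ≤ (∏ i, Real.exp (logKer ε z (w i)) ^ k i) *
          ∏ j, (Real.exp (logKer 0 z (v j)) ^ l j)⁻¹ := by
          refine mul_le_mul (Finset.prod_le_prod (fun i _ => by positivity) fun i _ =>
            pow_le_pow_left₀ (norm_nonneg _) (norm_toC_sub_le hε z _) _) (le_of_eq ?_)
            (by positivity) (by positivity)
          exact Finset.prod_congr rfl fun j _ => by rw [norm_toC_sub_eq (hvK z (hKW hz) j)]
      _ ≤ _ := by
          rw [hexp]
          refine Real.exp_le_exp.2 ?_
          have h1 := (abs_le.1 (hdiv (fun i => logKer ε z (w i)) fun j => logKer 0 z (v j))).2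
          have h2 := (le_abs_self _).trans (hC1 z hz)
          have h3 := div_le_div_of_nonneg_right (hup z hz) hh.le
          have h4 : (g z + δ / 2) / h ≤ (g z + δ) / h := by gcongr; linarith
          have := le_max_left C1 (T p + 1)
          linarith
  · obtain ⟨hz1, hz2, hz3, hz4⟩ := hz
    have h0 : ‖F (toC z)‖ = Real.exp (∑ i, k i * logKer 0 z (w i) - ∑ j, l j * logKer 0 z (v j)) := by
      rw [hFn, ← hexp]
      congr 1
      · exact Finset.prod_congr rfl fun i _ => by rw [norm_toC_sub_eq (hz3 i)]
      · exact Finset.prod_congr rfl fun j _ => by rw [norm_toC_sub_eq (hz4 j)]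
    simp only
    rw [h0]
    refine Real.exp_le_exp.2 ?_
    have h1 := (abs_le.1 (hdiv (fun i => logKer 0 z (w i)) fun j => logKer 0 z (v j))).1
    have h2 := le_max_right C1 (T p + 1)
    have h3 : (g p - δ) / h ≤ G z / h := by
      refine div_le_div_of_nonneg_right ?_ hh.le
      simp only [hG] at hz2 hlo ⊢
      linarith
    simp only [hT, hG] at *
    linarith

/-- Competitors for the weight: continuous functions vanishing off `Ω` which, below the level `-δ`,
are of class `C²` and satisfy `Δψ ≤ B`. -/
structure IsSubPotential (Ω : Set (ℝ × ℝ)) (B : ℝ × ℝ → ℝ) (δ : ℝ) (ψ : ℝ × ℝ → ℝ) : Prop where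
  cont : Continuous ψ
  zero_off : ∀ x, x ∉ Ω → ψ x = 0
  reg : ∀ x, ψ x < -δ → ContDiffAt ℝ 2 ψ x ∧ lap ψ x ≤ B x

lemma norm_pd1_sub_le {k g : ℝ × ℝ → ℝ} {x : ℝ × ℝ} {ε : ℝ}
    (h : ‖fderiv ℝ k x - fderiv ℝ g x‖ ≤ ε) : |pd1 k x - pd1 g x| ≤ ε := by
  have := (fderiv ℝ k x - fderiv ℝ g x).le_opNorm (1, 0)
  simp only [Prod.norm_def, norm_one, norm_zero] at this
  simp only [pd1]
  simpa using this.trans (by simpa using h)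

lemma norm_pd2_sub_le {k g : ℝ × ℝ → ℝ} {x : ℝ × ℝ} {ε : ℝ}
    (h : ‖fderiv ℝ k x - fderiv ℝ g x‖ ≤ ε) : |pd2 k x - pd2 g x| ≤ ε := by
  have := (fderiv ℝ k x - fderiv ℝ g x).le_opNorm (0, 1)
  simp only [Prod.norm_def, norm_one, norm_zero] at this
  simp only [pd2]
  simpa using this.trans (by simpa using h)

lemma add_sq_le_two (a b : ℝ) : (a + b) ^ 2 ≤ 2 * a ^ 2 + 2 * b ^ 2 := by
  nlinarith [sq_nonneg (a - b)]

lemma IsSubPotential.exists_rayleigh_le {Ω : Set (ℝ × ℝ)} {B ψ₀ ψ : ℝ × ℝ → ℝ} (hΩ : IsOpen Ω)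
    (hb : Bornology.IsBounded Ω) (hψ₀ : IsScalarPotential Ω B ψ₀) {δ : ℝ} (hδ : 0 < δ)
    (hψ : IsSubPotential Ω B δ ψ) {p : ℝ × ℝ} (hp : ψ p < -(4 * δ)) :
    ∃ C > 0, ∀ h ∈ Ioo (0 : ℝ) 1, ∃ u, IsTestFun Ω u ∧
      pauliRayleigh (-1) h (perpGrad ψ₀) B Ω u ≤ C * Real.exp ((2 * ψ p + 18 * δ) / h) := by
  have hcψ := hψ.cont
  set U1 := {x | ψ x < -δ} with hU1
  have hU1o : IsOpen U1 := isOpen_lt hcψ continuous_const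
  have hU1Ω : U1 ⊆ Ω := fun x hx => by
    by_contra h
    have h1 := hψ.zero_off x h
    have h2 : ψ x < -δ := hx
    linarith
  have hψ₀c : ∀ x ∈ Ω, ContDiffAt ℝ 2 ψ₀ x := fun x hx => hψ₀.c2.contDiffAt (hΩ.mem_nhds hx)
  set W := {x | ψ x < -(2 * δ)} with hWdef
  have hWo : IsOpen W := isOpen_lt hcψ continuous_const
  set K1 := {x | ψ x ≤ -(2 * δ)} with hK1
  have hK1U : K1 ⊆ U1 := fun x hx => by
    have h2 : ψ x ≤ -(2 * δ) := hx
    show ψ x < -δ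
    linarith
  have hWK1 : W ⊆ K1 := fun x hx => le_of_lt (show ψ x < -(2 * δ) from hx)
  obtain ⟨θ, hθ, hθ1, hθU, hθI⟩ :=
    exists_smooth_cutoff (isClosed_le hcψ continuous_const : IsClosed K1) hU1o hK1U
  have hθc : HasCompactSupport θ :=
    Metric.isCompact_of_isClosed_isBounded (isClosed_tsupport θ) (hb.subset (hθU.trans hU1Ω))
  have hθ2 : ContDiff ℝ 2 θ := hθ.of_le two_le_smooth
  set g : ℝ × ℝ → ℝ := fun x => θ x • (ψ₀ x - ψ x) with hg
  have hg2 : ContDiff ℝ 2 g := contDiff_cutoff_mul hθ2 hθU fun x hx =>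
    (hψ₀c x (hU1Ω hx)).sub (hψ.reg x hx).1
  have hgc : HasCompactSupport g := hθc.smul_right
  set g₀ : ℝ × ℝ → ℝ := fun x => θ x • ψ₀ x with hg₀
  have hg₀2 : ContDiff ℝ 2 g₀ := contDiff_cutoff_mul hθ2 hθU fun x hx => hψ₀c x (hU1Ω hx)
  have hg₀c : HasCompactSupport g₀ := hθc.smul_right
  have hgW : ∀ x ∈ W, g =ᶠ[𝓝 x] fun y => ψ₀ y + (-1) * ψ y := fun x hx =>
    (hθ1 x (hWK1 hx)).mono fun y hy => by simp [hg, hy]; ring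
  have hg₀W : ∀ x ∈ W, g₀ =ᶠ[𝓝 x] ψ₀ := fun x hx =>
    (hθ1 x (hWK1 hx)).mono fun y hy => by simp [hg₀, hy]
  have hlapg : ∀ x ∈ W, 0 ≤ lap g x := fun x hx => by
    have hx1 := hK1U (hWK1 hx)
    obtain ⟨h1, h2⟩ := hψ.reg x hx1
    rw [(hgW x hx).lap_eq, lap_add (hψ₀c x (hU1Ω hx1)) (contDiffAt_const.mul h1),
      lap_const_mul _ h1, hψ₀.lap_eq x (hU1Ω hx1)]
    linarith
  set K := {x | ψ x ≤ -(3 * δ)} with hKdef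
  have hKcl : IsClosed K := isClosed_le hcψ continuous_const
  have hKW : K ⊆ W := fun x hx => by
    have h2 : ψ x ≤ -(3 * δ) := hx
    show ψ x < -(2 * δ)
    linarith
  have hKΩ : K ⊆ Ω := hKW.trans (hWK1.trans (hK1U.trans hU1Ω))
  have hK : IsCompact K := Metric.isCompact_of_isClosed_isBounded hKcl (hb.subset hKΩ)
  have hpK : p ∈ K := show ψ p ≤ -(3 * δ) by linarith
  obtain ⟨C, N, hN, hf⟩ := exists_holomorphic_approx hg2 hgc hWo hlapg hK hKW hpK hδ
  -- the cutoff
  set U3 := {x | ψ x < -(3 * δ)} with hU3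
  have hU3o : IsOpen U3 := isOpen_lt hcψ continuous_const
  have hU3K : U3 ⊆ K := fun x hx => le_of_lt (show ψ x < -(3 * δ) from hx)
  obtain ⟨χ, hχ, hχ1, hχU, hχI⟩ :=
    exists_smooth_cutoff (isClosed_le hcψ continuous_const : IsClosed {x | ψ x ≤ -(4 * δ)}) hU3o
      (fun x hx => by
        have h2 : ψ x ≤ -(4 * δ) := hx
        show ψ x < -(3 * δ)
        linarith)
  have hχc : HasCompactSupport χ :=
    Metric.isCompact_of_isClosed_isBounded (isClosed_tsupport χ)
      (hb.subset (hχU.trans (hU3K.trans hKΩ)))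
  have hχ2 : ContDiff ℝ 2 χ := hχ.of_le two_le_smooth
  obtain ⟨D, hD⟩ : ∃ D, ∀ x, ‖((pd1 χ x : ℝ) : ℂ) + Complex.I * ((pd2 χ x : ℝ) : ℂ)‖ ≤ D := by
    have c1 := (hχ2.pd1 (m := 1) (by norm_num)).continuous
    have c2 := (hχ2.pd2 (m := 1) (by norm_num)).continuous
    refine Continuous.bounded_above_of_compact_support (by fun_prop) ?_
    refine HasCompactSupport.intro hχc fun x hx => ?_
    simp [pd1_eq_zero_of_notMem_tsupport hx, pd2_eq_zero_of_notMem_tsupport hx]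
  have hD0 : 0 ≤ D := (norm_nonneg _).trans (hD 0)
  have hDz : ∀ x, x ∈ tsupport χ → ψ x < -(4 * δ) →
      ((pd1 χ x : ℝ) : ℂ) + Complex.I * ((pd2 χ x : ℝ) : ℂ) = 0 := fun x _ hx => by
    have h1 : χ =ᶠ[𝓝 x] fun _ => (1 : ℝ) := hχ1 x hx.le
    have h2 : pd1 χ x = 0 := by rw [h1.pd1.eq_of_nhds]; simp [pd1]
    have h3 : pd2 χ x = 0 := by rw [h1.pd2.eq_of_nhds]; simp [pd2]
    simp [h2, h3]
  -- the neighbourhood of `p` on which the trial state is large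
  have hpW : p ∈ W := hKW hpK
  have hpΩ : p ∈ Ω := hKΩ hpK
  have hN' : ∀ᶠ x in 𝓝 p, x ∈ N ∧ ψ x < -(4 * δ) ∧ ψ₀ x < ψ₀ p + δ ∧ x ∈ W :=
    Filter.Eventually.and hN ((hcψ.continuousAt.eventually_lt_const hp).and
      (((hψ₀c p hpΩ).continuousAt.eventually_lt_const (by linarith)).and (hWo.mem_nhds hpW)))
  obtain ⟨r, hr, hrN⟩ := Metric.eventually_nhds_iff_ball.1 hN'
  set b := Metric.ball p r with hbdef
  have hvb : 0 < volume.real b := by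
    rw [measureReal_def]
    exact ENNReal.toReal_pos (Metric.measure_ball_pos volume p hr).ne' measure_ball_lt_top.ne
  have hvK : 0 ≤ volume.real K := measureReal_nonneg
  refine ⟨2 * D ^ 2 * volume.real K * Real.exp (4 * C) / volume.real b + 8, by positivity,
    fun h hh => ?_⟩
  obtain ⟨hh0, hh1⟩ := hh
  obtain ⟨f, hfs, hfh, hfup, hflo⟩ := hf h hh0
  set εs := min δ (Real.exp ((ψ p + 9 * δ) / h)) with hεs
  have hεs0 : 0 < εs := lt_min hδ (Real.exp_pos _)
  obtain ⟨k, hk, hk0, hk1⟩ := exists_smooth_approx (hg₀2.of_le (by norm_num)) hg₀c hεs0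
  set φ : ℝ × ℝ → ℝ := fun x => -k x with hφ
  have hφs : ContDiff ℝ (⊤ : ℕ∞) φ := hk.neg
  set v : ℝ × ℝ → ℂ := fun x => χ x • f x with hv
  have hχW : tsupport χ ⊆ W := hχU.trans (hU3K.trans hKW)
  have hvs : ContDiff ℝ (⊤ : ℕ∞) v := contDiff_cutoff_mul hχ hχW hfs
  have hvt : tsupport v ⊆ tsupport χ := tsupport_smul_subset_left χ f
  set u : ℝ × ℝ → ℂ := fun x => Real.exp (φ x / h) • v x with hu
  have hus : ContDiff ℝ (⊤ : ℕ∞) u := by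
    have : ContDiff ℝ (⊤ : ℕ∞) fun x => Real.exp (φ x / h) := (hφs.div_const h).exp
    exact this.smul hvs
  have hut : tsupport u ⊆ tsupport χ := (tsupport_smul_subset_right _ v).trans hvt
  have huc : HasCompactSupport u := hχc.of_isClosed_subset (isClosed_tsupport u) hut
  have hule : ∀ x ∈ b, Real.exp ((-ψ p - 3 * δ) / h - C) ≤ ‖u x‖ := fun x hx => by
    obtain ⟨hx1, hx2, hx3, hx4⟩ := hrN x hx
    have h1 : χ x = 1 := (hχ1 x hx2.le).self_of_nhds
    have h2 : ‖u x‖ = Real.exp (φ x / h) * ‖f x‖ := by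
      simp only [hu, hv, h1, one_smul, norm_smul, Real.norm_eq_abs, Real.abs_exp]
    have h3 := hflo x hx1
    have h4 : g p = ψ₀ p - ψ p := by rw [(hgW p hpW).eq_of_nhds]; ring
    have h5 : -(ψ₀ p + 2 * δ) / h ≤ φ x / h := by
      refine div_le_div_of_nonneg_right ?_ hh0.le
      have h6 := (abs_le.1 (hk0 x)).2
      rw [(hg₀W x hx4).eq_of_nhds] at h6
      have := min_le_left δ (Real.exp ((ψ p + 9 * δ) / h))
      simp only [hφ]
      linarith
    rw [h2]
    calc _ = Real.exp (-(ψ₀ p + 2 * δ) / h) * Real.exp ((g p - δ) / h - C) := by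
          rw [← Real.exp_add, h4]; congr 1; ring
      _ ≤ _ := mul_le_mul (Real.exp_le_exp.2 h5) h3 (Real.exp_pos _).le (Real.exp_pos _).le
  have hune : u ≠ 0 := fun h0 => by
    have := hule p (Metric.mem_ball_self hr)
    rw [h0] at this
    simp only [Pi.zero_apply, norm_zero] at this
    exact absurd (Real.exp_pos _) this.not_gt
  have huT : IsTestFun Ω u := ⟨hus, huc, hut.trans (hχW.trans (hWK1.trans (hK1U.trans hU1Ω))), hune⟩
  refine ⟨u, huT, ?_⟩
  rw [pauliRayleigh_eq hΩ hψ₀ huT]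
  have hden := huT.integral_pos
  have hu2i : Integrable fun x => ‖u x‖ ^ 2 := by
    have := hus.continuous
    refine Continuous.integrable_of_hasCompactSupport (by fun_prop) ?_
    exact HasCompactSupport.intro huc fun x hx => by simp [image_eq_zero_of_notMem_tsupport hx]
  set A := 2 * (D * Real.exp (6 * δ / h + C)) ^ 2 with hA
  have hA0 : 0 ≤ A := by positivity
  have hpt : ∀ x, ‖(h : ℂ) * (pd1 u x + Complex.I * pd2 u x)
      + (((pd1 ψ₀ x : ℝ) : ℂ) + Complex.I * ((pd2 ψ₀ x : ℝ) : ℂ)) * u x‖ ^ 2 ≤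
      K.indicator (fun _ => A) x + 8 * εs ^ 2 * ‖u x‖ ^ 2 := fun x => by
    by_cases hx : x ∈ tsupport χ
    swap
    · have h1 : x ∉ tsupport u := fun h => hx (hut h)
      rw [pd1_eq_zero_of_notMem_tsupport h1, pd2_eq_zero_of_notMem_tsupport h1,
        image_eq_zero_of_notMem_tsupport h1]
      simp only [mul_zero, add_zero, norm_zero]
      have := indicator_nonneg (s := K) (f := fun _ => A) (fun _ _ => hA0) x
      simpa using this
    have hxW := hχW hx
    have hxK := hU3K (hχU hx)
    have hfd : DifferentiableAt ℝ f x := (hfs x hxW).differentiableAt (by simp)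
    have hχd : DifferentiableAt ℝ χ x := hχ2.differentiable (by norm_num) x
    have hφd : DifferentiableAt ℝ φ x := hφs.differentiable (by simp) x
    have hvd : DifferentiableAt ℝ v x := hχd.smul hfd
    have e1 : pd1 v x + Complex.I * pd2 v x =
        (((pd1 χ x : ℝ) : ℂ) + Complex.I * ((pd2 χ x : ℝ) : ℂ)) * f x := by
      rw [hv, pd1_smul hχd hfd, pd2_smul hχd hfd]
      simp only [Complex.real_smul]
      linear_combination (χ x : ℂ) * hfh x hxW
    have e2 : (h : ℂ) * (pd1 u x + Complex.I * pd2 u x)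
        + (((pd1 ψ₀ x : ℝ) : ℂ) + Complex.I * ((pd2 ψ₀ x : ℝ) : ℂ)) * u x =
        (h : ℂ) * ((Real.exp (φ x / h) : ℂ) *
          ((((pd1 χ x : ℝ) : ℂ) + Complex.I * ((pd2 χ x : ℝ) : ℂ)) * f x)) +
        (((pd1 ψ₀ x + pd1 φ x : ℝ) : ℂ) + Complex.I * ((pd2 ψ₀ x + pd2 φ x : ℝ) : ℂ)) * u x := by
      rw [← e1, hu, pd1_exp_smul h hφd hvd, pd2_exp_smul h hφd hvd]
      have hhC : (h : ℂ) ≠ 0 := by exact_mod_cast hh0.ne'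
      simp only [Complex.real_smul]
      push_cast
      field_simp
      ring
    have hpd1 : |pd1 ψ₀ x + pd1 φ x| ≤ εs := by
      have h1 : pd1 φ x = -pd1 k x := by simp [pd1, hφ, fderiv_fun_neg]
      rw [h1, ← (hg₀W x hxW).pd1.eq_of_nhds, ← sub_eq_add_neg, abs_sub_comm]
      exact norm_pd1_sub_le (hk1 x)
    have hpd2 : |pd2 ψ₀ x + pd2 φ x| ≤ εs := by
      have h1 : pd2 φ x = -pd2 k x := by simp [pd2, hφ, fderiv_fun_neg]
      rw [h1, ← (hg₀W x hxW).pd2.eq_of_nhds, ← sub_eq_add_neg, abs_sub_comm]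
      exact norm_pd2_sub_le (hk1 x)
    have b2 : ‖(((pd1 ψ₀ x + pd1 φ x : ℝ) : ℂ) + Complex.I * ((pd2 ψ₀ x + pd2 φ x : ℝ) : ℂ)) * u x‖
        ≤ 2 * εs * ‖u x‖ := by
      rw [norm_mul]
      refine mul_le_mul_of_nonneg_right ((norm_add_le _ _).trans ?_) (norm_nonneg _)
      rw [norm_mul, Complex.norm_I, one_mul, Complex.norm_real, Complex.norm_real,
        Real.norm_eq_abs, Real.norm_eq_abs]
      linarith
    have b1 : ‖(h : ℂ) * ((Real.exp (φ x / h) : ℂ) *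
          ((((pd1 χ x : ℝ) : ℂ) + Complex.I * ((pd2 χ x : ℝ) : ℂ)) * f x))‖ ≤
        D * Real.exp (6 * δ / h + C) := by
      by_cases hx4 : ψ x < -(4 * δ)
      · rw [hDz x hx hx4]; simp; positivity
      · rw [norm_mul, norm_mul, norm_mul, Complex.norm_real, Complex.norm_real, Real.norm_eq_abs,
          Real.norm_eq_abs, abs_of_pos hh0, abs_of_pos (Real.exp_pos _)]
        have h1 := hfup x hxK
        have h2 : Real.exp (φ x / h) * ‖f x‖ ≤ Real.exp (6 * δ / h + C) := by
          calc _ ≤ Real.exp (φ x / h) * Real.exp ((g x + δ) / h + C) :=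
                mul_le_mul_of_nonneg_left h1 (Real.exp_pos _).le
            _ ≤ _ := by
                rw [← Real.exp_add, ← add_assoc, ← add_div]
                refine Real.exp_le_exp.2 (add_le_add_left (div_le_div_of_nonneg_right ?_ hh0.le) _)
                have h6 := (abs_le.1 (hk0 x)).1
                rw [(hg₀W x hxW).eq_of_nhds] at h6
                rw [(hgW x hxW).eq_of_nhds]
                have := min_le_left δ (Real.exp ((ψ p + 9 * δ) / h))
                simp only [hφ]
                linarith
        calc _ = h * ‖((pd1 χ x : ℝ) : ℂ) + Complex.I * ((pd2 χ x : ℝ) : ℂ)‖ *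
              (Real.exp (φ x / h) * ‖f x‖) := by ring
          _ ≤ 1 * D * Real.exp (6 * δ / h + C) := by
              refine mul_le_mul (mul_le_mul hh1.le (hD x) (norm_nonneg _) zero_le_one) h2
                (by positivity) (by positivity)
          _ = _ := by ring
    rw [e2, indicator_of_mem hxK]
    calc _ ≤ (D * Real.exp (6 * δ / h + C) + 2 * εs * ‖u x‖) ^ 2 :=
          pow_le_pow_left₀ (norm_nonneg _) ((norm_add_le _ _).trans (add_le_add b1 b2)) 2
      _ ≤ _ := add_sq_le_two _ _
      _ = _ := by rw [hA]; ring
  have hKm : MeasurableSet K := hKcl.measurableSet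
  have hKi : Integrable (K.indicator fun _ => A) :=
    (integrable_indicator_iff hKm).2 (integrableOn_const hK.measure_lt_top.ne)
  have hnum := integral_mono_of_nonneg (ae_of_all _ fun x => by positivity)
    (hKi.add (hu2i.const_mul (8 * εs ^ 2))) (ae_of_all volume hpt)
  simp only [Pi.add_apply] at hnum
  rw [integral_add hKi (hu2i.const_mul _), integral_const_mul, integral_indicator hKm,
    setIntegral_const, smul_eq_mul] at hnum
  have hlow : volume.real b * Real.exp ((-ψ p - 3 * δ) / h - C) ^ 2 ≤ ∫ x, ‖u x‖ ^ 2 := by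
    calc _ = ∫ x in b, Real.exp ((-ψ p - 3 * δ) / h - C) ^ 2 := by
          rw [setIntegral_const, smul_eq_mul]
      _ ≤ ∫ x in b, ‖u x‖ ^ 2 := by
          refine setIntegral_mono_on (integrableOn_const measure_ball_lt_top.ne) hu2i.integrableOn
            measurableSet_ball fun x hx => pow_le_pow_left₀ (Real.exp_pos _).le (hule x hx) 2
      _ ≤ _ := setIntegral_le_integral hu2i (ae_of_all _ fun x => by positivity)
  rw [div_le_iff₀ hden]
  refine hnum.trans ?_
  set J := ∫ x, ‖u x‖ ^ 2 with hJ
  have hε2 : εs ^ 2 ≤ Real.exp ((2 * ψ p + 18 * δ) / h) := by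
    calc εs ^ 2 ≤ Real.exp ((ψ p + 9 * δ) / h) ^ 2 :=
          pow_le_pow_left₀ hεs0.le (min_le_right _ _) 2
      _ = _ := by rw [← Real.exp_nat_mul]; congr 1; push_cast; ring
  have hAeq : volume.real K * A = 2 * D ^ 2 * volume.real K * Real.exp (4 * C) / volume.real b *
      Real.exp ((2 * ψ p + 18 * δ) / h) *
      (volume.real b * Real.exp ((-ψ p - 3 * δ) / h - C) ^ 2) := by
    have h1 : Real.exp (6 * δ / h + C) ^ 2 = Real.exp (4 * C) *
        Real.exp ((2 * ψ p + 18 * δ) / h) * Real.exp ((-ψ p - 3 * δ) / h - C) ^ 2 := by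
      rw [← Real.exp_nat_mul, ← Real.exp_nat_mul, ← Real.exp_add, ← Real.exp_add]
      congr 1; push_cast; ring
    rw [hA, mul_pow, h1]
    field_simp
  have h3 := mul_le_mul_of_nonneg_left hlow (show 0 ≤ 2 * D ^ 2 * volume.real K *
    Real.exp (4 * C) / volume.real b * Real.exp ((2 * ψ p + 18 * δ) / h) by positivity)
  have h4 := mul_le_mul_of_nonneg_right hε2 (show 0 ≤ 8 * J by positivity)
  rw [hAeq]
  linarith

lemma tendsto_id_nhdsGT_zero : Tendsto (fun h : ℝ => h) (𝓝[>] 0) (𝓝 0) :=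
  tendsto_nhdsWithin_of_tendsto_nhds tendsto_id

lemma IsSubPotential.limsup_le {Ω : Set (ℝ × ℝ)} {B ψ₀ ψ : ℝ × ℝ → ℝ} (hΩ : IsOpen Ω)
    (hb : Bornology.IsBounded Ω) (hψ₀ : IsScalarPotential Ω B ψ₀) {δ : ℝ} (hδ : 0 < δ)
    (hψ : IsSubPotential Ω B δ ψ) {p : ℝ × ℝ} (hp : ψ p < -(4 * δ)) :
    limsup (fun h : ℝ => h * Real.log (lambdaMinusD h (perpGrad ψ₀) B Ω)) (𝓝[>] 0)
      ≤ 2 * ψ p + 19 * δ := by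
  obtain ⟨C, hC, hup⟩ := hψ.exists_rayleigh_le hΩ hb hψ₀ hδ hp
  obtain ⟨L, hL, M, hlow⟩ := pauliRayleigh_lower_bound hΩ hb hψ₀
  have hlam : ∀ h ∈ Ioo (0 : ℝ) 1,
      h ^ 2 * Real.exp (-(4 * M) / h) / (4 * L ^ 2) ≤ lambdaMinusD h (perpGrad ψ₀) B Ω ∧
      lambdaMinusD h (perpGrad ψ₀) B Ω ≤ C * Real.exp ((2 * ψ p + 18 * δ) / h) := fun h hh => by
    obtain ⟨u, hu, hle⟩ := hup h hh
    have hbd : ∀ y ∈ pauliRayleigh (-1) h (perpGrad ψ₀) B Ω '' {u | IsTestFun Ω u},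
        h ^ 2 * Real.exp (-(4 * M) / h) / (4 * L ^ 2) ≤ y := by
      rintro y ⟨w, hw, rfl⟩
      exact hlow h hh.1 w hw
    exact ⟨le_csInf ⟨_, u, hu, rfl⟩ hbd, (csInf_le ⟨_, hbd⟩ ⟨u, hu, rfl⟩).trans hle⟩
  have hI : ∀ᶠ h : ℝ in 𝓝[>] 0, h ∈ Ioo (0 : ℝ) 1 := Ioo_mem_nhdsGT one_pos
  refine limsup_le_of_le (IsBoundedUnder.isCoboundedUnder_le ?_) ?_
  · have ht : Tendsto (fun h : ℝ => 2 * (Real.log h * h) - 4 * M - h * Real.log (4 * L ^ 2))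
        (𝓝[>] 0) (𝓝 (2 * 0 - 4 * M - 0 * Real.log (4 * L ^ 2))) := by
      have := tendsto_log_mul_rpow_nhdsGT_zero zero_lt_one
      simp only [Real.rpow_one] at this
      exact ((this.const_mul 2).sub_const _).sub (tendsto_id_nhdsGT_zero.mul_const _)
    refine ⟨2 * 0 - 4 * M - 0 * Real.log (4 * L ^ 2) - 1, eventually_map.2 ?_⟩
    filter_upwards [hI, ht.eventually_const_lt (sub_one_lt _)] with h hh hlt
    have h0 : 0 < h := hh.1
    refine hlt.le.trans ?_
    have h1 : 2 * (Real.log h * h) - 4 * M - h * Real.log (4 * L ^ 2) =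
        h * Real.log (h ^ 2 * Real.exp (-(4 * M) / h) / (4 * L ^ 2)) := by
      rw [Real.log_div (by positivity) (by positivity), Real.log_mul (x := h ^ 2)
        (by positivity) (by positivity), Real.log_exp, Real.log_pow]
      push_cast
      field_simp
      ring
    rw [h1]
    exact mul_le_mul_of_nonneg_left (Real.log_le_log (by positivity) (hlam h hh).1) h0.le
  · have ht : Tendsto (fun h : ℝ => h * Real.log C) (𝓝[>] 0) (𝓝 0) := by
      simpa using tendsto_id_nhdsGT_zero.mul_const (Real.log C)
    filter_upwards [hI, ht.eventually_lt_const hδ] with h hh hlt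
    have h0 : 0 < h := hh.1
    have hpos : 0 < lambdaMinusD h (perpGrad ψ₀) B Ω :=
      lt_of_lt_of_le (by positivity) (hlam h hh).1
    calc _ ≤ h * Real.log (C * Real.exp ((2 * ψ p + 18 * δ) / h)) :=
          mul_le_mul_of_nonneg_left (Real.log_le_log hpos (hlam h hh).2) h0.le
      _ = h * Real.log C + (2 * ψ p + 18 * δ) := by
          rw [Real.log_mul hC.ne' (Real.exp_pos _).ne', Real.log_exp]; field_simp
      _ ≤ _ := by linarith

/-- A smooth convex regularisation of `t ↦ max t 0`. -/
noncomputable def smoothPos (t : ℝ) : ℝ := ∫ s in (0 : ℝ)..t, Real.smoothTransition s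

lemma hasDerivAt_smoothPos (t : ℝ) : HasDerivAt smoothPos (Real.smoothTransition t) t :=
  intervalIntegral.integral_hasDerivAt_right
    (Real.smoothTransition.continuous.intervalIntegrable _ _)
    (Real.smoothTransition.continuous.stronglyMeasurableAtFilter _ _)
    Real.smoothTransition.continuous.continuousAt

lemma deriv_smoothPos : deriv smoothPos = Real.smoothTransition :=
  funext fun t => (hasDerivAt_smoothPos t).deriv

lemma contDiff_smoothPos : ContDiff ℝ 2 smoothPos := by
  rw [show (2 : WithTop ℕ∞) = 1 + 1 by norm_num, contDiff_succ_iff_deriv]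
  refine ⟨fun t => (hasDerivAt_smoothPos t).differentiableAt, by simp, ?_⟩
  rw [deriv_smoothPos]
  exact Real.smoothTransition.contDiff

lemma smoothPos_of_nonpos {t : ℝ} (ht : t ≤ 0) : smoothPos t = 0 := by
  rw [smoothPos, intervalIntegral.integral_symm, neg_eq_zero]
  refine intervalIntegral.integral_zero_ae (ae_of_all _ fun s hs => ?_)
  rw [uIoc_of_le ht] at hs
  exact Real.smoothTransition.zero_of_nonpos hs.2

lemma monotone_smoothPos : Monotone smoothPos :=
  monotone_of_deriv_nonneg (fun t => (hasDerivAt_smoothPos t).differentiableAt) fun t => by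
    rw [deriv_smoothPos]; exact Real.smoothTransition.nonneg t

lemma smoothPos_nonneg (t : ℝ) : 0 ≤ smoothPos t := by
  rcases le_total t 0 with h | h
  · exact (smoothPos_of_nonpos h).ge
  · exact (smoothPos_of_nonpos le_rfl).ge.trans (monotone_smoothPos h)

lemma monotone_sub_smoothPos : Monotone fun t => t - smoothPos t :=
  monotone_of_deriv_nonneg (fun t => by
    have := (hasDerivAt_smoothPos t).differentiableAt; fun_prop) fun t => by
    rw [((hasDerivAt_id' t).fun_sub (hasDerivAt_smoothPos t)).deriv]
    linarith [Real.smoothTransition.le_one t]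

lemma smoothPos_le {t : ℝ} : smoothPos t ≤ max t 0 := by
  rcases le_total t 0 with h | h
  · rw [smoothPos_of_nonpos h]; exact le_max_right _ _
  · have := monotone_sub_smoothPos h
    simp only [smoothPos_of_nonpos le_rfl] at this
    exact le_max_of_le_left (by linarith)

lemma smoothPos_of_one_le {t : ℝ} (ht : 1 ≤ t) : smoothPos t = smoothPos 1 + (t - 1) := by
  have h := intervalIntegral.integral_add_adjacent_intervals (a := 0) (b := 1) (c := t) (μ := volume)
    (Real.smoothTransition.continuous.intervalIntegrable _ _)
    (Real.smoothTransition.continuous.intervalIntegrable _ _)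
  have h2 : ∫ s in (1 : ℝ)..t, Real.smoothTransition s = ∫ s in (1 : ℝ)..t, (1 : ℝ) := by
    refine intervalIntegral.integral_congr fun s hs => ?_
    rw [uIcc_of_le ht] at hs
    exact Real.smoothTransition.one_of_one_le hs.1
  rw [smoothPos, smoothPos, ← h, h2]
  simp

lemma sub_one_le_smoothPos (t : ℝ) : t - 1 ≤ smoothPos t := by
  rcases le_total t 1 with h | h
  · linarith [smoothPos_nonneg t]
  · rw [smoothPos_of_one_le h]; linarith [smoothPos_nonneg 1]

/-- A smooth regularisation of `min s a`. -/
noncomputable def smoothMin (ε s a : ℝ) : ℝ := s - ε * smoothPos ((s - a) / ε)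

lemma smoothMin_of_le {ε s a : ℝ} (hε : 0 < ε) (h : s ≤ a) : smoothMin ε s a = s := by
  rw [smoothMin, smoothPos_of_nonpos (div_nonpos_of_nonpos_of_nonneg (by linarith) hε.le)]
  ring

lemma smoothMin_le_left {ε : ℝ} (hε : 0 < ε) (s a : ℝ) : smoothMin ε s a ≤ s := by
  have := smoothPos_nonneg ((s - a) / ε)
  have := mul_nonneg hε.le this
  rw [smoothMin]; linarith

lemma smoothMin_le_right {ε : ℝ} (hε : 0 < ε) (s a : ℝ) : smoothMin ε s a ≤ a + ε := by
  have h1 := mul_le_mul_of_nonneg_left (sub_one_le_smoothPos ((s - a) / ε)) hε.le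
  have h2 : ε * ((s - a) / ε - 1) = s - a - ε := by field_simp
  rw [smoothMin]; linarith

lemma min_le_smoothMin {ε : ℝ} (hε : 0 < ε) (s a : ℝ) : min s a ≤ smoothMin ε s a := by
  rcases le_total s a with h | h
  · rw [smoothMin_of_le hε h]; exact min_le_left _ _
  · refine (min_le_right _ _).trans ?_
    have h0 : 0 ≤ (s - a) / ε := div_nonneg (by linarith) hε.le
    have h1 := mul_le_mul_of_nonneg_left (smoothPos_le (t := (s - a) / ε)) hε.le
    rw [max_eq_left h0, mul_div_cancel₀ _ hε.ne'] at h1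
    rw [smoothMin]; linarith

lemma smoothMin_of_add_le {ε s a : ℝ} (hε : 0 < ε) (h : a + ε ≤ s) :
    smoothMin ε s a = a + ε * (1 - smoothPos 1) := by
  rw [smoothMin, smoothPos_of_one_le (by rw [le_div_iff₀ hε]; linarith)]
  field_simp; ring

lemma continuous_smoothMin (ε : ℝ) : Continuous fun p : ℝ × ℝ => smoothMin ε p.1 p.2 := by
  have := contDiff_smoothPos.continuous
  unfold smoothMin
  fun_prop

lemma contDiffAt_smoothMin {ε : ℝ} {ψ a : ℝ × ℝ → ℝ} {x : ℝ × ℝ}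
    (hψ : ContDiffAt ℝ 2 ψ x) (ha : ContDiffAt ℝ 2 a x) :
    ContDiffAt ℝ 2 (fun y => smoothMin ε (ψ y) (a y)) x := by
  have h : ContDiffAt ℝ 2 (fun y => (ψ y - a y) / ε) x := (hψ.sub ha).div_const ε
  exact hψ.sub (contDiffAt_const.mul (contDiff_smoothPos.contDiffAt.comp x h))

lemma lap_smoothMin_le {ε b : ℝ} (hε : 0 < ε) {ψ a : ℝ × ℝ → ℝ} {x : ℝ × ℝ}
    (hψ : ContDiffAt ℝ 2 ψ x) (ha : ContDiffAt ℝ 2 a x) (hψb : lap ψ x ≤ b) (hab : lap a x ≤ b) :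
    lap (fun y => smoothMin ε (ψ y) (a y)) x ≤ b := by
  set t : ℝ × ℝ → ℝ := fun y => ε⁻¹ * (ψ y + (-1) * a y) with ht
  have ha' : ContDiffAt ℝ 2 (fun y => (-1) * a y) x := contDiffAt_const.mul ha
  have hs : ContDiffAt ℝ 2 (fun y => ψ y + (-1) * a y) x := hψ.add ha'
  have htc : ContDiffAt ℝ 2 t x := contDiffAt_const.mul hs
  have hlt : lap t x = ε⁻¹ * (lap ψ x + (-1) * lap a x) := by
    rw [ht, lap_const_mul _ hs, lap_add hψ ha', lap_const_mul _ ha]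
  have hm : ContDiffAt ℝ 2 (fun y => smoothPos (t y)) x := contDiff_smoothPos.contDiffAt.comp x htc
  have heq : (fun y => smoothMin ε (ψ y) (a y)) = fun y => ψ y + (-ε) * smoothPos (t y) := by
    funext y
    rw [smoothMin, ht, div_eq_inv_mul]; ring_nf
  rw [heq, lap_add hψ (contDiffAt_const.mul hm), lap_const_mul _ hm,
    lap_comp contDiff_smoothPos.contDiffAt htc, hlt, deriv_smoothPos]
  have h0 : 0 ≤ deriv Real.smoothTransition (t x) := Real.smoothTransition.monotone.deriv_nonneg
  have h1 := Real.smoothTransition.nonneg (t x)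
  have h2 := Real.smoothTransition.le_one (t x)
  set θ := Real.smoothTransition (t x)
  have h3 : 0 ≤ ε * (deriv Real.smoothTransition (t x) * (pd1 t x ^ 2 + pd2 t x ^ 2)) := by positivity
  have h4 : ε * (θ * (ε⁻¹ * (lap ψ x + (-1) * lap a x))) = θ * (lap ψ x - lap a x) := by
    field_simp
    ring_nf
  nlinarith

lemma lap_add_const {f : ℝ × ℝ → ℝ} {x : ℝ × ℝ} (hf : ContDiffAt ℝ 2 f x) (c : ℝ) :
    lap (fun y => f y + c) x = lap f x := by
  rw [lap_add (g := fun _ => c) hf contDiffAt_const]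
  have h1 : pd1 (fun _ : ℝ × ℝ => c) = fun _ => 0 := by funext y; simp [pd1]
  have h2 : pd2 (fun _ : ℝ × ℝ => c) = fun _ => 0 := by funext y; simp [pd2]
  rw [show lap (fun _ => c) x = 0 by rw [lap, h1, h2]; simp [pd1, pd2], add_zero]

/-- Gluing a weight with a barrier `v` over an annulus. -/
lemma IsSubPotential.exists_glue {Ω : Set (ℝ × ℝ)} {B ψ v : ℝ × ℝ → ℝ} {δ : ℝ}
    (hψ : IsSubPotential Ω B δ ψ) {x₁ : ℝ × ℝ} {σ₁ σ₂ σ₃ σ₄ ε : ℝ} (h12 : σ₁ < σ₂) (h34 : σ₃ < σ₄)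
    (hε : 0 < ε) (hΩ : ∀ x, σ₁ < sqDist x x₁ → sqDist x x₁ < σ₄ → x ∈ Ω)
    (hv : ∀ x, σ₁ < sqDist x x₁ → sqDist x x₁ < σ₄ → ContDiffAt ℝ 2 v x ∧ lap v x ≤ B x)
    (hin : ∀ x, σ₁ < sqDist x x₁ → sqDist x x₁ < σ₂ → ψ x ≤ v x)
    (hout : ∀ x, σ₃ < sqDist x x₁ → sqDist x x₁ < σ₄ → ψ x ≤ v x)
    (hreg : ∀ x, σ₁ < sqDist x x₁ → sqDist x x₁ < σ₄ → smoothMin ε (ψ x) (v x) < -δ →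
      (ContDiffAt ℝ 2 ψ x ∧ lap ψ x ≤ B x) ∨ v x + ε < ψ x) :
    ∃ φ, IsSubPotential Ω B δ φ ∧ (∀ x, φ x ≤ ψ x) ∧
      ∀ x, σ₁ < sqDist x x₁ → sqDist x x₁ < σ₄ → φ x ≤ v x + ε := by
  classical
  have hs : Continuous fun x => sqDist x x₁ := (contDiff_sqDist (n := 0) x₁).continuous
  set φ : ℝ × ℝ → ℝ := fun x =>
    if σ₁ < sqDist x x₁ ∧ sqDist x x₁ < σ₄ then smoothMin ε (ψ x) (v x) else ψ x with hφ
  have hpos : ∀ x, σ₁ < sqDist x x₁ → sqDist x x₁ < σ₄ → φ x = smoothMin ε (ψ x) (v x) :=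
    fun x h1 h2 => if_pos ⟨h1, h2⟩
  have hsame : ∀ x, sqDist x x₁ < σ₂ ∨ σ₃ < sqDist x x₁ → φ x = ψ x := fun x hx => by
    by_cases h : σ₁ < sqDist x x₁ ∧ sqDist x x₁ < σ₄
    · rw [hpos x h.1 h.2]
      exact smoothMin_of_le hε (hx.elim (hin x h.1) fun h' => hout x h' h.2)
    · exact if_neg h
  have hcover : ∀ x, φ =ᶠ[𝓝 x] ψ ∨ ((σ₁ < sqDist x x₁ ∧ sqDist x x₁ < σ₄) ∧
      φ =ᶠ[𝓝 x] fun y => smoothMin ε (ψ y) (v y)) := fun x => by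
    by_cases h : σ₁ < sqDist x x₁ ∧ sqDist x x₁ < σ₄
    · refine Or.inr ⟨h, ?_⟩
      filter_upwards [hs.continuousAt.eventually_const_lt h.1,
        hs.continuousAt.eventually_lt_const h.2] with y h1 h2
      exact hpos y h1 h2
    · left
      rw [not_and_or, not_lt, not_lt] at h
      rcases h with h | h
      · filter_upwards [hs.continuousAt.eventually_lt_const (h.trans_lt h12)] with y hy
        exact hsame y (Or.inl hy)
      · filter_upwards [hs.continuousAt.eventually_const_lt (h34.trans_le h)] with y hy
        exact hsame y (Or.inr hy)
  refine ⟨φ, ⟨?_, ?_, ?_⟩, ?_, ?_⟩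
  · refine continuous_iff_continuousAt.2 fun x => ?_
    rcases hcover x with h | ⟨⟨h1, h2⟩, h⟩
    · exact hψ.cont.continuousAt.congr h.symm
    · refine ContinuousAt.congr ?_ h.symm
      exact (continuous_smoothMin ε).continuousAt.comp (f := fun y => (ψ y, v y))
        (hψ.cont.continuousAt.prodMk (hv x h1 h2).1.continuousAt)
  · intro x hx
    rw [hφ]
    simp only
    rw [if_neg fun h => hx (hΩ x h.1 h.2)]
    exact hψ.zero_off x hx
  · intro x hx
    rcases hcover x with h | ⟨⟨h1, h2⟩, h⟩
    · rw [h.eq_of_nhds] at hx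
      obtain ⟨r1, r2⟩ := hψ.reg x hx
      exact ⟨r1.congr_of_eventuallyEq h, by rwa [h.lap_eq]⟩
    · obtain ⟨v1, v2⟩ := hv x h1 h2
      rw [h.eq_of_nhds] at hx
      rcases hreg x h1 h2 hx with ⟨r1, r2⟩ | h3
      · exact ⟨(contDiffAt_smoothMin r1 v1).congr_of_eventuallyEq h, by
          rw [h.lap_eq]; exact lap_smoothMin_le hε r1 v1 r2 v2⟩
      · have h4 : φ =ᶠ[𝓝 x] fun y => v y + ε * (1 - smoothPos 1) := by
          filter_upwards [h, (v1.continuousAt.add continuousAt_const).eventually_lt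
            hψ.cont.continuousAt h3] with y hy1 hy2
          rw [hy1, smoothMin_of_add_le hε hy2.le]
        exact ⟨(v1.add contDiffAt_const).congr_of_eventuallyEq h4, by
          rw [h4.lap_eq, lap_add_const v1]; exact v2⟩
  · intro x
    by_cases h : σ₁ < sqDist x x₁ ∧ sqDist x x₁ < σ₄
    · rw [hpos x h.1 h.2]; exact smoothMin_le_left hε _ _
    · exact (if_neg h).le
  · intro x h1 h2
    rw [hpos x h1 h2]; exact smoothMin_le_right hε _ _

lemma lap_logKer_zero {x a : ℝ × ℝ} (h : 0 < sqDist x a) :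
    ContDiffAt ℝ 2 (fun y => logKer 0 y a) x ∧ lap (fun y => logKer 0 y a) x = 0 := by
  have h0 : sqDist x a + 0 ^ 2 ≠ 0 := by simpa using h.ne'
  refine ⟨?_, ?_⟩
  · exact (ContDiffAt.log (f := fun y => sqDist y a + 0 ^ 2)
      ((contDiff_sqDist a).contDiffAt.add contDiffAt_const) h0).div_const 2
  · have := lap_half_log_add h0
    simpa [logKer] using this

lemma logKer_zero (x a : ℝ × ℝ) : logKer 0 x a = Real.log (sqDist x a) / 2 := by simp [logKer]

lemma IsLocalMax.deriv_deriv_nonpos {f : ℝ → ℝ} {t : ℝ} (h : IsLocalMax f t)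
    (hc : ContinuousAt f t) : deriv (deriv f) t ≤ 0 := by
  by_contra! hpos
  have hmin := isLocalMin_of_deriv_deriv_pos hpos h.deriv_eq_zero hc
  have heq : f =ᶠ[𝓝 t] fun _ => f t := by
    filter_upwards [h, hmin] with s h1 h2 using le_antisymm h1 h2
  have h1 := heq.deriv.deriv_eq
  simp at h1
  linarith

lemma IsLocalMax.fderiv_fderiv_nonpos {w : ℝ × ℝ → ℝ} {x : ℝ × ℝ} (h : IsLocalMax w x)
    (hw : ContDiffAt ℝ 2 w x) (e : ℝ × ℝ) : fderiv ℝ (fun y => fderiv ℝ w y e) x e ≤ 0 := by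
  set l : ℝ → ℝ × ℝ := fun t => x + t • e with hl
  have hld : ∀ t, HasDerivAt l e t := fun t => by
    have := ((hasDerivAt_id t).smul_const e).const_add x
    rw [one_smul] at this
    exact this
  have hl0 : l 0 = x := by simp [hl]
  have hlc : Tendsto l (𝓝 0) (𝓝 x) := by
    have := (hld 0).continuousAt.tendsto
    rwa [hl0] at this
  have hd : deriv (fun t => w (l t)) =ᶠ[𝓝 0] fun t => fderiv ℝ w (l t) e := by
    filter_upwards [hlc.eventually (hw.eventually (by simp))] with t ht
    exact ((ht.differentiableAt (by norm_num)).hasFDerivAt.comp_hasDerivAt t (hld t)).deriv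
  have hd2 : deriv (deriv fun t => w (l t)) 0 = fderiv ℝ (fun y => fderiv ℝ w y e) x e := by
    rw [hd.deriv_eq]
    have h1 : DifferentiableAt ℝ (fun y => fderiv ℝ w y e) (l 0) := by
      rw [hl0]
      exact ((hw.fderiv_right (m := 1) (by norm_num)).differentiableAt (by norm_num)).clm_apply
        (differentiableAt_const e)
    have := (h1.hasFDerivAt.comp_hasDerivAt 0 (hld 0)).deriv
    rw [hl0] at this
    exact this
  have hm : IsLocalMax (fun t => w (l t)) 0 := by
    have h2 : ∀ᶠ t in 𝓝 (0 : ℝ), w (l t) ≤ w (l 0) := by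
      rw [hl0]; exact hlc.eventually h
    exact h2
  rw [← hd2]
  refine hm.deriv_deriv_nonpos ?_
  exact ContinuousAt.comp (f := l) (g := w) (by rw [hl0]; exact hw.continuousAt) (hld 0).continuousAt

lemma IsLocalMax.lap_nonpos {w : ℝ × ℝ → ℝ} {x : ℝ × ℝ} (h : IsLocalMax w x)
    (hw : ContDiffAt ℝ 2 w x) : lap w x ≤ 0 :=
  add_nonpos (h.fderiv_fderiv_nonpos hw (1, 0)) (h.fderiv_fderiv_nonpos hw (0, 1))

/-- Weak maximum principle for strictly subharmonic functions. -/
lemma nonpos_of_lap_pos {K U : Set (ℝ × ℝ)} {w : ℝ × ℝ → ℝ} (hK : IsCompact K) (hU : IsOpen U)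
    (hUK : U ⊆ K) (hwc : ContinuousOn w K) (hw : ∀ x ∈ U, ContDiffAt ℝ 2 w x ∧ 0 < lap w x)
    (hb : ∀ x ∈ K, x ∉ U → w x ≤ 0) : ∀ x ∈ K, w x ≤ 0 := by
  intro x hx
  obtain ⟨z, hz, hmax⟩ := hK.exists_isMaxOn ⟨x, hx⟩ hwc
  refine (hmax hx).trans ?_
  by_cases hzU : z ∈ U
  · have hloc : IsLocalMax w z := by
      filter_upwards [hU.mem_nhds hzU] with y hy using hmax (hUK hy)
    exact absurd (hw z hzU).2 (hloc.lap_nonpos (hw z hzU).1).not_gt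
  · exact hb z hz hzU

/-- The extension by zero of the scalar potential of a positive magnetic field on `P`. -/
structure IsPosPotential (P : Set (ℝ × ℝ)) (B ψ : ℝ × ℝ → ℝ) : Prop where
  isOpen : IsOpen P
  pos : ∀ x ∈ P, 0 < B x
  cont : Continuous ψ
  zero_off : ∀ x, x ∉ P → ψ x = 0
  neg : ∀ x ∈ P, ψ x < 0
  c2 : ∀ x ∈ P, ContDiffAt ℝ 2 ψ x
  lap_eq : ∀ x ∈ P, lap ψ x = B x

lemma IsScalarPotential.isPosPotential {P : Set (ℝ × ℝ)} {B ψ : ℝ × ℝ → ℝ}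
    (hψ : IsScalarPotential P B ψ) (hP : IsOpen P) (hb : Bornology.IsBounded P)
    (hB : ∀ x ∈ P, 0 < B x) : IsPosPotential P B (P.indicator ψ) := by
  have heq : ∀ x ∈ P, P.indicator ψ =ᶠ[𝓝 x] ψ := fun x hx => by
    filter_upwards [hP.mem_nhds hx] with y hy using indicator_of_mem hy ψ
  have hc2 : ∀ x ∈ P, ContDiffAt ℝ 2 (P.indicator ψ) x := fun x hx =>
    (hψ.c2.contDiffAt (hP.mem_nhds hx)).congr_of_eventuallyEq (heq x hx)
  have hlap : ∀ x ∈ P, lap (P.indicator ψ) x = B x := fun x hx => by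
    rw [(heq x hx).lap_eq, hψ.lap_eq x hx]
  have hcont : Continuous (P.indicator ψ) := continuous_indicator hψ.bdry hψ.contOn
  have hnp : ∀ x ∈ closure P, P.indicator ψ x ≤ 0 :=
    nonpos_of_lap_pos hb.isCompact_closure hP subset_closure hcont.continuousOn
      (fun x hx => ⟨hc2 x hx, by rw [hlap x hx]; exact hB x hx⟩)
      fun x _ hx => (indicator_of_notMem hx ψ).le
  refine ⟨hP, hB, hcont, fun x hx => indicator_of_notMem hx ψ, fun x hx => ?_, hc2, hlap⟩
  refine lt_of_le_of_ne (hnp x (subset_closure hx)) fun h0 => ?_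
  have hloc : IsLocalMax (P.indicator ψ) x := by
    filter_upwards [hP.mem_nhds hx] with y hy
    rw [h0]
    exact hnp y (subset_closure hy)
  have := hloc.lap_nonpos (hc2 x hx)
  rw [hlap x hx] at this
  exact absurd (hB x hx) this.not_gt

namespace IsPosPotential

variable {P Ω : Set (ℝ × ℝ)} {B ψ : ℝ × ℝ → ℝ}

lemma nonpos (hψ : IsPosPotential P B ψ) (x : ℝ × ℝ) : ψ x ≤ 0 := by
  by_cases h : x ∈ P
  · exact (hψ.neg x h).le
  · exact (hψ.zero_off x h).le

lemma mem_of_neg (hψ : IsPosPotential P B ψ) {x : ℝ × ℝ} (h : ψ x < 0) : x ∈ P := by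
  by_contra h'
  exact h.ne (hψ.zero_off x h')

lemma isSubPotential (hψ : IsPosPotential P B ψ) (hPΩ : P ⊆ Ω) {δ : ℝ} (hδ : 0 < δ) :
    IsSubPotential Ω B δ ψ :=
  ⟨hψ.cont, fun x hx => hψ.zero_off x fun h => hx (hPΩ h), fun x hx => by
    have hx := hψ.mem_of_neg (hx.trans (neg_neg_of_pos hδ))
    exact ⟨hψ.c2 x hx, (hψ.lap_eq x hx).le⟩⟩

end IsPosPotential

lemma continuous_sqDist_left (a : ℝ × ℝ) : Continuous fun x => sqDist x a :=
  (contDiff_sqDist (n := 0) a).continuous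

lemma isCompact_sqDist_le (a : ℝ × ℝ) (σ : ℝ) : IsCompact {x | sqDist x a ≤ σ} := by
  refine Metric.isCompact_of_isClosed_isBounded
    (isClosed_le (continuous_sqDist_left a) continuous_const) ?_
  refine (Metric.isBounded_closedBall (x := a) (r := σ + 1)).subset fun x hx => ?_
  have h1 : sqDist x a ≤ σ := hx
  have := sq_dist_le_sqDist x a
  rw [Metric.mem_closedBall]
  nlinarith [sq_nonneg (dist x a - 1), dist_nonneg (x := x) (y := a)]

lemma sqDist_lt_mem_nhds {x a : ℝ × ℝ} {σ : ℝ} (h : sqDist x a < σ) : {y | sqDist y a < σ} ∈ 𝓝 x :=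
  (continuous_sqDist_left a).continuousAt.eventually_lt_const h

lemma exists_sqDist_lt_subset {x : ℝ × ℝ} {N : Set (ℝ × ℝ)} (hN : N ∈ 𝓝 x) :
    ∃ ρ > 0, {y | sqDist y x < ρ} ⊆ N := by
  obtain ⟨r, hr, hrN⟩ := Metric.mem_nhds_iff.1 hN
  refine ⟨r ^ 2, by positivity, fun y hy => hrN ?_⟩
  exact lt_of_pow_lt_pow_left₀ 2 hr.le ((sq_dist_le_sqDist y x).trans_lt hy)

/-- Weights which beat `ψe` by a fixed amount on `N` exist for all small `δ`. -/
def HasGainOn (Ω : Set (ℝ × ℝ)) (B ψe : ℝ × ℝ → ℝ) (N : Set (ℝ × ℝ)) : Prop :=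
  ∃ κ > 0, ∃ δ₀ > 0, ∀ δ ∈ Ioo (0 : ℝ) δ₀, ∃ ψ, IsSubPotential Ω B δ ψ ∧ (∀ y, ψ y ≤ ψe y) ∧
    ∀ y ∈ N, ψ y ≤ ψe y - κ

lemma HasGainOn.mono {Ω : Set (ℝ × ℝ)} {B ψe : ℝ × ℝ → ℝ} {M N : Set (ℝ × ℝ)}
    (h : HasGainOn Ω B ψe N) (hMN : M ⊆ N) : HasGainOn Ω B ψe M := by
  obtain ⟨κ, hκ, δ₀, hδ₀, h⟩ := h
  refine ⟨κ, hκ, δ₀, hδ₀, fun δ hδ => ?_⟩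
  obtain ⟨ψ, h1, h2, h3⟩ := h δ hδ
  exact ⟨ψ, h1, h2, fun y hy => h3 y (hMN hy)⟩

lemma HasGainOn.enlarge {P Ω : Set (ℝ × ℝ)} {B ψe : ℝ × ℝ → ℝ} (hψe : IsPosPotential P B ψe)
    (hPΩ : P ⊆ Ω) {y₀ : ℝ × ℝ} {ρ σ₃ σ₄ σ₅ : ℝ} (hρ : 0 < ρ) (hρ3 : ρ < σ₃) (h5 : 0 < σ₅)
    (h53 : σ₅ < σ₃) (h34 : σ₃ < σ₄) (hP : {y | sqDist y y₀ ≤ σ₄} ⊆ P)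
    (h : HasGainOn Ω B ψe {y | sqDist y y₀ < ρ}) : HasGainOn Ω B ψe {y | sqDist y y₀ < σ₅} := by
  obtain ⟨κ, hκ, δ₀, hδ₀, h⟩ := h
  have hσ3 : 0 < σ₃ := h5.trans h53
  obtain ⟨z, hz, hmax⟩ := (isCompact_sqDist_le y₀ σ₄).exists_isMaxOn
    ⟨y₀, by simpa [sqDist_self] using (hσ3.trans h34).le⟩ hψe.cont.continuousOn
  have hm : ψe z < 0 := hψe.neg z (hP hz)
  have hL : 0 < Real.log σ₃ - Real.log (ρ / 2) :=
    sub_pos.2 (Real.log_lt_log (by positivity) (by linarith))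
  have hL5 : 0 < Real.log σ₃ - Real.log σ₅ := sub_pos.2 (Real.log_lt_log h5 h53)
  set κ' := κ / (Real.log σ₃ - Real.log (ρ / 2)) with hκ'
  have hκ'0 : 0 < κ' := div_pos hκ hL
  have hκL : κ' * (Real.log σ₃ - Real.log (ρ / 2)) = κ := div_mul_cancel₀ _ hL.ne'
  set g := κ' * (Real.log σ₃ - Real.log σ₅) with hg
  have hg0 : 0 < g := mul_pos hκ'0 hL5
  set v : ℝ × ℝ → ℝ := fun y => ψe y + κ' * (logKer 0 y y₀ + -(Real.log σ₃ / 2)) with hv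
  refine ⟨min κ (g / 4), lt_min hκ (by positivity), min δ₀ (-ψe z), lt_min hδ₀ (by linarith),
    fun δ hδ => ?_⟩
  obtain ⟨ψ, h1, h2, h3⟩ := h δ ⟨hδ.1, hδ.2.trans_le (min_le_left _ _)⟩
  have hδz : δ < -ψe z := hδ.2.trans_le (min_le_right _ _)
  obtain ⟨φ, φ1, φ2, φ3⟩ := h1.exists_glue (v := v) (x₁ := y₀) (σ₁ := ρ / 2) (σ₂ := ρ) (σ₃ := σ₃)
    (σ₄ := σ₄) (ε := g / 4) (by linarith) h34 (by positivity) (fun x _ hx => hPΩ (hP hx.le))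
    (fun x hx1 hx2 => by
      have hxP : x ∈ P := hP hx2.le
      obtain ⟨l1, l2⟩ := lap_logKer_zero (x := x) (a := y₀) (by linarith)
      have l3 : ContDiffAt ℝ 2 (fun y => logKer 0 y y₀ + -(Real.log σ₃ / 2)) x :=
        l1.add contDiffAt_const
      refine ⟨(hψe.c2 x hxP).add (contDiffAt_const.mul l3), ?_⟩
      rw [hv, lap_add (hψe.c2 x hxP) (contDiffAt_const.mul l3), lap_const_mul _ l3,
        lap_add_const l1, l2, hψe.lap_eq x hxP]
      simp)
    (fun x hx1 hx2 => by
      have h4 := h3 x hx2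
      have h5 : Real.log (ρ / 2) ≤ Real.log (sqDist x y₀) :=
        Real.log_le_log (by positivity) hx1.le
      have h6 := mul_le_mul_of_nonneg_left h5 hκ'0.le
      simp only [hv, logKer_zero]
      linarith)
    (fun x hx1 hx2 => by
      have h5 : Real.log σ₃ ≤ Real.log (sqDist x y₀) := Real.log_le_log hσ3 hx1.le
      have h6 := mul_le_mul_of_nonneg_left h5 hκ'0.le
      have h4 := h2 x
      simp only [hv, logKer_zero]
      linarith)
    (fun x hx1 hx2 _ => Or.inl (h1.reg x (by
      have h4 : ψe x ≤ ψe z := hmax hx2.le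
      have := h2 x
      linarith)))
  refine ⟨φ, φ1, fun y => (φ2 y).trans (h2 y), fun y hy => ?_⟩
  have hy5 : sqDist y y₀ < σ₅ := hy
  rcases le_or_gt (sqDist y y₀) (ρ / 2) with h4 | h4
  · have := h3 y (show sqDist y y₀ < ρ by linarith)
    have := φ2 y
    have := min_le_left κ (g / 4)
    linarith
  · have h6 := φ3 y h4 (by linarith)
    have h7 : Real.log (sqDist y y₀) ≤ Real.log σ₅ := Real.log_le_log (by linarith) hy5.le
    have h8 := mul_le_mul_of_nonneg_left h7 hκ'0.le
    have := min_le_right κ (g / 4)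
    simp only [hv, logKer_zero] at h6
    linarith

/-- The set where some gain is possible is open and relatively closed in `P`. -/
lemma hasGainOn_of_mem_component {P Ω V : Set (ℝ × ℝ)} {B ψe : ℝ × ℝ → ℝ}
    (hψe : IsPosPotential P B ψe) (hPΩ : P ⊆ Ω) (hV : IsPreconnected V) (hVP : V ⊆ P)
    (hne : ∃ x ∈ V, ∃ N ∈ 𝓝 x, HasGainOn Ω B ψe N) :
    ∀ x ∈ V, ∃ N ∈ 𝓝 x, HasGainOn Ω B ψe N := by
  set S := {x | ∃ N ∈ 𝓝 x, HasGainOn Ω B ψe N} with hS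
  have hSo : IsOpen S := by
    refine isOpen_iff_mem_nhds.2 fun x hx => ?_
    obtain ⟨N, hN, hg⟩ := hx
    filter_upwards [eventually_mem_nhds_iff.2 hN] with y hy using ⟨N, hy, hg⟩
  refine hV.subset_of_closure_inter_subset hSo hne fun x hx => ?_
  obtain ⟨hxS, hxV⟩ := hx
  obtain ⟨r, hr, hrP⟩ := Metric.mem_nhds_iff.1 (hψe.isOpen.mem_nhds (hVP hxV))
  set d := r / 4 with hd
  have hd0 : 0 < d := by positivity
  obtain ⟨y₀, hy₀, hdist⟩ := Metric.mem_closure_iff.1 hxS (d / 2) (by positivity)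
  obtain ⟨N, hN, hg⟩ := hy₀
  obtain ⟨ρ, hρ, hρN⟩ := exists_sqDist_lt_subset hN
  have hρ' : 0 < min ρ (d ^ 2) := lt_min hρ (by positivity)
  have hd2 : 0 < d ^ 2 := by positivity
  have hgain := (hg.mono (M := {y | sqDist y y₀ < min ρ (d ^ 2)}) (fun y hy =>
    hρN (lt_of_lt_of_le (show sqDist y y₀ < min ρ (d ^ 2) from hy) (min_le_left _ _)))).enlarge hψe hPΩ (σ₃ := 2 * d ^ 2)
    (σ₄ := 3 * d ^ 2) (σ₅ := d ^ 2) hρ' (by have := min_le_right ρ (d ^ 2); linarith) hd2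
    (by linarith) (by linarith) (fun y hy => hrP (by
      have h1 : sqDist y y₀ ≤ 3 * d ^ 2 := hy
      have h2 := sq_dist_le_sqDist y y₀
      have h3 : dist y y₀ < 2 * d := lt_of_pow_lt_pow_left₀ 2 (by positivity) (by nlinarith)
      have h4 := dist_triangle y y₀ x
      rw [dist_comm] at hdist
      rw [Metric.mem_ball]
      linarith))
  refine ⟨_, sqDist_lt_mem_nhds ?_, hgain⟩
  have h1 := sqDist_le_two_mul_sq_dist x y₀
  have h2 : dist x y₀ ^ 2 < (d / 2) ^ 2 := pow_lt_pow_left₀ hdist dist_nonneg two_ne_zero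
  linarith

lemma sqDist_le_add_sq {x y z : ℝ × ℝ} {a b : ℝ} (ha : 0 ≤ a) (hb : 0 ≤ b)
    (h1 : sqDist x y ≤ a ^ 2) (h2 : sqDist y z ≤ b ^ 2) : sqDist x z ≤ (a + b) ^ 2 := by
  have hcs : ((x.1 - y.1) * (y.1 - z.1) + (x.2 - y.2) * (y.2 - z.2)) ^ 2 ≤ (a * b) ^ 2 := by
    have h3 := mul_le_mul h1 h2 (sqDist_nonneg y z) (sq_nonneg a)
    unfold sqDist at h3
    nlinarith [sq_nonneg ((x.1 - y.1) * (y.2 - z.2) - (x.2 - y.2) * (y.1 - z.1))]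
  have h4 := (abs_le_of_sq_le_sq' hcs (by positivity)).2
  unfold sqDist at *
  nlinarith

lemma sqDist_le_two_mul_add (x y z : ℝ × ℝ) : sqDist x z ≤ 2 * sqDist x y + 2 * sqDist y z := by
  unfold sqDist
  nlinarith [sq_nonneg (x.1 - y.1 - (y.1 - z.1)), sq_nonneg (x.2 - y.2 - (y.2 - z.2))]

/-- Hopf-type lower bound for the decay of `|ψ|` at the boundary of a disc contained in `P`. -/
lemma IsPosPotential.exists_hopf {P : Set (ℝ × ℝ)} {B ψ : ℝ × ℝ → ℝ} (hψ : IsPosPotential P B ψ)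
    {x₀ : ℝ × ℝ} {σ : ℝ} (hσ : 0 < σ) (hP : {y | sqDist y x₀ < σ} ⊆ P) :
    ∃ κ > 0, (∀ y, sqDist y x₀ ≤ σ / 4 → ψ y ≤ -(κ * Real.log 2)) ∧
      ∀ y, σ / 4 ≤ sqDist y x₀ → sqDist y x₀ ≤ σ →
        ψ y ≤ -(κ * (Real.log σ - Real.log (sqDist y x₀)) / 2) := by
  obtain ⟨z, hz, hmax⟩ := (isCompact_sqDist_le x₀ (σ / 4)).exists_isMaxOn
    ⟨x₀, show sqDist x₀ x₀ ≤ σ / 4 by rw [sqDist_self]; positivity⟩ hψ.cont.continuousOn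
  have hz' : sqDist z x₀ ≤ σ / 4 := hz
  have hm : ψ z < 0 := hψ.neg z (hP (show sqDist z x₀ < σ by linarith))
  have hlog : 0 < Real.log 2 := Real.log_pos (by norm_num)
  set κ := -ψ z / Real.log 2 with hκ
  have hκ0 : 0 < κ := div_pos (by linarith) hlog
  have hκl : κ * Real.log 2 = -ψ z := div_mul_cancel₀ _ hlog.ne'
  refine ⟨κ, hκ0, fun y hy => ?_, fun y hy1 hy2 => ?_⟩
  · rw [hκl, neg_neg]; exact hmax hy
  have hs := continuous_sqDist_left x₀
  set K := {y | σ / 4 ≤ sqDist y x₀ ∧ sqDist y x₀ ≤ σ} with hK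
  set w : ℝ × ℝ → ℝ := fun y => ψ y + -κ * (logKer 0 y x₀ + -(Real.log σ / 2)) with hw
  have hKc : IsCompact K := (isCompact_sqDist_le x₀ σ).of_isClosed_subset
    ((isClosed_le continuous_const hs).inter (isClosed_le hs continuous_const)) fun y hy => hy.2
  have hUo : IsOpen {y | σ / 4 < sqDist y x₀ ∧ sqDist y x₀ < σ} :=
    (isOpen_lt continuous_const hs).inter (isOpen_lt hs continuous_const)
  have key := nonpos_of_lap_pos (w := w) hKc hUo (fun y hy => ⟨hy.1.le, hy.2.le⟩)
    (fun y hy => by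
      have l1 := (lap_logKer_zero (x := y) (a := x₀) (by linarith [hy.1])).1.continuousAt
      exact (hψ.cont.continuousAt.add (continuousAt_const.mul
        (l1.add continuousAt_const))).continuousWithinAt)
    (fun y hy => by
      have hyP : y ∈ P := hP hy.2
      obtain ⟨l1, l2⟩ := lap_logKer_zero (x := y) (a := x₀) (by linarith [hy.1])
      have l3 : ContDiffAt ℝ 2 (fun y => logKer 0 y x₀ + -(Real.log σ / 2)) y :=
        l1.add contDiffAt_const
      refine ⟨(hψ.c2 y hyP).add (contDiffAt_const.mul l3), ?_⟩
      rw [hw, lap_add (hψ.c2 y hyP) (contDiffAt_const.mul l3), lap_const_mul _ l3,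
        lap_add_const l1, l2, hψ.lap_eq y hyP]
      simpa using hψ.pos y hyP)
    (fun y hy hyU => by
      simp only [hw, logKer_zero]
      rcases hy.1.lt_or_eq with h1 | h1
      · have h2 : sqDist y x₀ = σ := le_antisymm hy.2 (not_lt.1 fun h => hyU ⟨h1, h⟩)
        rw [h2]
        linarith [hψ.nonpos y]
      · have h2 : ψ y ≤ ψ z := hmax (show sqDist y x₀ ≤ σ / 4 from h1.ge)
        rw [← h1, Real.log_div hσ.ne' (by norm_num), show (4 : ℝ) = 2 ^ 2 by norm_num, Real.log_pow]
        push_cast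
        linarith)
    y ⟨hy1, hy2⟩
  simp only [hw, logKer_zero] at key
  linarith

/-- Lower bound on the barrier used near a boundary point. -/
lemma barrier_nonneg {Q s η : ℝ} (hQ : 0 < Q) (hη : 0 < η) (h1 : 2 * Q < s) (h2 : s < 3 * Q) :
    0 ≤ 2 * η * Q * (Real.log s / 2 + -(Real.log (2 * Q) / 2)) + -(η / 4) * (s + -(2 * Q)) := by
  have hs : 0 < s := by linarith
  have h3 := Real.log_le_sub_one_of_pos (show 0 < 2 * Q / s by positivity)
  rw [Real.log_div (by positivity) hs.ne'] at h3
  have h4 : 2 * Q / s ≤ 1 - (s - 2 * Q) / (4 * Q) := by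
    rw [div_le_iff₀ hs, one_sub_div (by positivity), div_mul_eq_mul_div, le_div_iff₀ (by positivity)]
    nlinarith
  have h5 : η * Q * ((s - 2 * Q) / (4 * Q)) = η / 4 * (s - 2 * Q) := by field_simp
  have h6 := mul_le_mul_of_nonneg_left (show (s - 2 * Q) / (4 * Q) ≤ Real.log s - Real.log (2 * Q) by
    linarith) (show 0 ≤ η * Q by positivity)
  linarith

lemma hasGainOn_of_interior_disc {P Ω : Set (ℝ × ℝ)} {B ψe : ℝ × ℝ → ℝ}
    (hψe : IsPosPotential P B ψe) (hPΩ : P ⊆ Ω) (hΩ : IsOpen Ω) {η : ℝ} (hη : 0 < η)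
    (hB : ∀ x ∈ Ω, -η ≤ B x) {q x₀ : ℝ × ℝ} (hqΩ : q ∈ Ω) (hqP : q ∉ P)
    (hσ : 0 < sqDist q x₀) (hdisc : {y | sqDist y x₀ < sqDist q x₀} ⊆ P) :
    ∃ N ∈ 𝓝 q, HasGainOn Ω B ψe N := by
  obtain ⟨κ₀, hκ₀, hopf1, hopf2⟩ := hψe.exists_hopf hσ hdisc
  obtain ⟨ρ, hρ, hρΩ⟩ := exists_sqDist_lt_subset (hΩ.mem_nhds hqΩ)
  set σ := sqDist q x₀ with hσd
  obtain ⟨t, ht0, ht1, ht2, ht3⟩ : ∃ t : ℝ, 0 < t ∧ t ≤ 1 / 2 ∧ t * (8 * η * σ) ≤ κ₀ ∧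
      t * (8 * σ) ≤ ρ := by
    refine ⟨min (1 / 2) (min (κ₀ / (8 * η * σ)) (ρ / (8 * σ))), ?_, min_le_left _ _, ?_, ?_⟩
    · positivity
    · rw [← le_div_iff₀ (by positivity)]
      exact (min_le_right _ _).trans (min_le_left _ _)
    · rw [← le_div_iff₀ (by positivity)]
      exact (min_le_right _ _).trans (min_le_right _ _)
  set x₁ : ℝ × ℝ := q + t • (x₀ - q) with hx₁
  set Q := t ^ 2 * σ with hQd
  have hQ : 0 < Q := by positivity
  have hqx1 : sqDist q x₁ = Q := by
    rw [hQd, hσd, hx₁]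
    simp only [sqDist, Prod.fst_add, Prod.snd_add, Prod.smul_fst, Prod.smul_snd, Prod.fst_sub,
      Prod.snd_sub, smul_eq_mul]
    ring
  have hx10 : sqDist x₁ x₀ = (1 - t) ^ 2 * σ := by
    rw [hσd, hx₁]
    simp only [sqDist, Prod.fst_add, Prod.snd_add, Prod.smul_fst, Prod.smul_snd, Prod.fst_sub,
      Prod.snd_sub, smul_eq_mul]
    ring
  have hQt : Q ≤ t * σ := by
    rw [hQd, pow_two, mul_assoc]
    exact mul_le_of_le_one_left (by positivity) (by linarith)
  have hball : ∀ x, sqDist x x₁ < 3 * Q → x ∈ Ω := fun x hx => hρΩ (by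
    have h1 := sqDist_le_two_mul_add x x₁ q
    rw [sqDist_comm x₁ q, hqx1] at h1
    show sqDist x q < ρ
    linarith)
  have hlog2 := Real.log_two_gt_d9
  have hlog2' := Real.log_two_lt_d9
  -- the inner region
  have hinner : ∀ y, sqDist y x₁ < Q / 4 → ψe y ≤ -(κ₀ * t / 2) := fun y hy => by
    have hsq : Real.sqrt σ ^ 2 = σ := Real.sq_sqrt hσ.le
    have h1 : sqDist y x₀ ≤ (t / 2 * Real.sqrt σ + (1 - t) * Real.sqrt σ) ^ 2 :=
      sqDist_le_add_sq (y := x₁) (by positivity)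
        (mul_nonneg (by linarith) (Real.sqrt_nonneg _))
        (by rw [mul_pow, hsq]; rw [hQd] at hy; linarith) (by rw [mul_pow, hsq, hx10])
    have h2 : sqDist y x₀ ≤ (1 - t / 2) ^ 2 * σ := by
      calc _ ≤ _ := h1
        _ = (1 - t / 2) ^ 2 * Real.sqrt σ ^ 2 := by ring
        _ = _ := by rw [hsq]
    have h3 : (1 - t / 2) ^ 2 ≤ 1 := pow_le_one₀ (by linarith) (by linarith)
    rcases le_total (sqDist y x₀) (σ / 4) with h4 | h4
    · have := hopf1 y h4
      have := mul_le_mul_of_nonneg_left (show t / 2 ≤ Real.log 2 by linarith) hκ₀.le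
      linarith
    · have h5 := hopf2 y h4 (h2.trans (mul_le_of_le_one_left hσ.le h3))
      have h6 := Real.log_le_log (by linarith) h2
      have h7 : 0 < 1 - t / 2 := by linarith
      rw [Real.log_mul (by positivity) hσ.ne', Real.log_pow] at h6
      have h8 := Real.log_le_sub_one_of_pos h7
      push_cast at h6
      have := mul_le_mul_of_nonneg_left
        (show t ≤ Real.log σ - Real.log (sqDist y x₀) by linarith) hκ₀.le
      linarith
  have hlog2Q : Real.log (2 * Q) = Real.log 2 + Real.log Q := Real.log_mul (by norm_num) hQ.ne'
  have hlogQ8 : Real.log (Q / 8) = Real.log Q - 3 * Real.log 2 := by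
    rw [Real.log_div hQ.ne' (by norm_num), show (8 : ℝ) = 2 ^ 3 by norm_num, Real.log_pow]
    push_cast; ring
  set v : ℝ × ℝ → ℝ := fun y => 2 * η * Q * (logKer 0 y x₁ + -(Real.log (2 * Q) / 2)) +
    -(η / 4) * (sqDist y x₁ + -(2 * Q)) with hv
  have hv2 : ∀ x, 0 < sqDist x x₁ → ContDiffAt ℝ 2 v x ∧ lap v x = -η := fun x hx => by
    obtain ⟨l1, l2⟩ := lap_logKer_zero hx
    have l3 : ContDiffAt ℝ 2 (fun y => logKer 0 y x₁ + -(Real.log (2 * Q) / 2)) x :=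
      l1.add contDiffAt_const
    have l4 : ContDiffAt ℝ 2 (fun y => sqDist y x₁) x := (contDiff_sqDist x₁).contDiffAt
    have l5 : ContDiffAt ℝ 2 (fun y => sqDist y x₁ + -(2 * Q)) x := l4.add contDiffAt_const
    refine ⟨(contDiffAt_const.mul l3).add (contDiffAt_const.mul l5), ?_⟩
    rw [hv, lap_add (contDiffAt_const.mul l3) (contDiffAt_const.mul l5), lap_const_mul _ l3,
      lap_const_mul _ l5, lap_add_const l1, lap_add_const l4, l2, lap_sqDist]
    ring
  set c := η * Q * (1 / 4 - Real.log 2) with hc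
  have hc0 : c < 0 := mul_neg_of_pos_of_neg (by positivity) (by linarith)
  have hvq : v q = c := by
    simp only [hv, logKer_zero, hqx1, hlog2Q, hc]
    ring
  refine ⟨{y | (Q / 8 < sqDist y x₁ ∧ sqDist y x₁ < 3 * Q) ∧ v y < 3 / 4 * c ∧ 1 / 4 * c < ψe y},
    ?_, -c / 4, by linarith, -c / 4, by linarith, fun δ hδ => ?_⟩
  · have hs := continuous_sqDist_left x₁
    have e1 : ∀ᶠ y in 𝓝 q, Q / 8 < sqDist y x₁ :=
      hs.continuousAt.eventually_const_lt (by simp only [hqx1]; linarith)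
    have e2 : ∀ᶠ y in 𝓝 q, sqDist y x₁ < 3 * Q :=
      hs.continuousAt.eventually_lt_const (by simp only [hqx1]; linarith)
    have e3 : ∀ᶠ y in 𝓝 q, v y < 3 / 4 * c :=
      (hv2 q (by rwa [hqx1])).1.continuousAt.eventually_lt_const (by rw [hvq]; linarith)
    have e4 : ∀ᶠ y in 𝓝 q, 1 / 4 * c < ψe y :=
      hψe.cont.continuousAt.eventually_const_lt (by rw [hψe.zero_off q hqP]; linarith)
    exact (e1.and e2).and (e3.and e4)
  · obtain ⟨φ, φ1, φ2, φ3⟩ := (hψe.isSubPotential hPΩ hδ.1).exists_glue (v := v) (x₁ := x₁)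
      (σ₁ := Q / 8) (σ₂ := Q / 4) (σ₃ := 2 * Q) (σ₄ := 3 * Q) (ε := δ) (by linarith)
      (by linarith) hδ.1 (fun x _ hx => hball x hx)
      (fun x hx1 hx2 => by
        obtain ⟨v1, v2⟩ := hv2 x (by linarith)
        exact ⟨v1, v2 ▸ hB x (hball x hx2)⟩)
      (fun x hx1 hx2 => by
        have h1 := hinner x hx2
        have h2 : Real.log (Q / 8) ≤ Real.log (sqDist x x₁) :=
          Real.log_le_log (by positivity) hx1.le
        rw [hlogQ8] at h2
        have h3 := mul_le_mul_of_nonneg_left (show -4 ≤ Real.log (sqDist x x₁) - Real.log (2 * Q) by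
          rw [hlog2Q]; linarith) (show 0 ≤ η * Q by positivity)
        have h4 : 0 ≤ η / 4 * (2 * Q - sqDist x x₁) := mul_nonneg (by positivity) (by linarith)
        have h5 : 4 * (η * Q) ≤ κ₀ * t / 2 := by
          have := mul_le_mul_of_nonneg_left ht2 ht0.le
          rw [hQd]
          linarith
        simp only [hv, logKer_zero]
        linarith)
      (fun x hx1 hx2 => by
        refine (hψe.nonpos x).trans ?_
        simp only [hv, logKer_zero]
        exact barrier_nonneg hQ hη hx1 hx2)
      (fun x hx1 hx2 hx => by
        by_cases hxP : x ∈ P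
        · exact Or.inl ⟨hψe.c2 x hxP, (hψe.lap_eq x hxP).le⟩
        · right
          have h1 := (min_le_smoothMin hδ.1 (ψe x) (v x)).trans_lt hx
          rw [hψe.zero_off x hxP] at h1 ⊢
          rcases min_lt_iff.1 h1 with h2 | h2
          · linarith [hδ.1]
          · linarith)
    refine ⟨φ, φ1, φ2, fun y hy => ?_⟩
    obtain ⟨⟨y1, y2⟩, y3, y4⟩ := hy
    have := φ3 y y1 y2
    linarith [hδ.2]

/-- A component of a proper open subset of a connected open set has a boundary point, away from
the subset, at which it satisfies an interior disc condition. -/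
lemma exists_interior_disc {Ω P : Set (ℝ × ℝ)} (hΩ : IsOpen Ω) (hΩc : IsPreconnected Ω)
    (hP : IsOpen P) (hPΩ : P ⊆ Ω) {p z₀ : ℝ × ℝ} (hp : p ∈ P) (hz : z₀ ∈ Ω) (hzP : z₀ ∉ P) :
    ∃ q ∈ Ω, ∃ x₀, q ∉ P ∧ q ∈ closure (connectedComponentIn P p) ∧ 0 < sqDist q x₀ ∧
      {y | sqDist y x₀ < sqDist q x₀} ⊆ P := by
  set V := connectedComponentIn P p with hV
  have hVo : IsOpen V := hP.connectedComponentIn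
  have hVP : V ⊆ P := connectedComponentIn_subset P p
  have hpV : p ∈ V := mem_connectedComponentIn hp
  obtain ⟨q₀, hq₀V, hq₀Ω, hq₀⟩ : ∃ q₀ ∈ closure V, q₀ ∈ Ω ∧ q₀ ∉ V := by
    by_contra! h
    exact hzP (hVP (hΩc.subset_of_closure_inter_subset hVo ⟨p, hPΩ hp, hpV⟩
      (fun x hx => h x hx.1 hx.2) hz))
  obtain ⟨ρ, hρ, hρΩ⟩ := exists_sqDist_lt_subset (hΩ.mem_nhds hq₀Ω)
  obtain ⟨x₀, hx₀, hx₀V⟩ := mem_closure_iff_nhds.1 hq₀V _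
    (sqDist_lt_mem_nhds (x := q₀) (a := q₀) (σ := ρ / 4) (by rw [sqDist_self]; positivity))
  have hx₀' : sqDist x₀ q₀ < ρ / 4 := hx₀
  have hs := continuous_sqDist_left x₀
  obtain ⟨q, ⟨hq1, hq2⟩, hmin⟩ := ((isCompact_sqDist_le x₀ (sqDist q₀ x₀)).inter_right
    hVo.isClosed_compl).exists_isMinOn ⟨q₀, le_refl (sqDist q₀ x₀), hq₀⟩ hs.continuousOn
  have hq1' : sqDist q x₀ ≤ sqDist q₀ x₀ := hq1
  have hqΩ : q ∈ Ω := hρΩ (by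
    have := sqDist_le_two_mul_add q x₀ q₀
    rw [sqDist_comm q₀ x₀] at hq1'
    show sqDist q q₀ < ρ
    linarith)
  have hpos : 0 < sqDist q x₀ := sqDist_pos fun h => hq2 (h ▸ hx₀V)
  have hball : {y | sqDist y x₀ < sqDist q x₀} ⊆ V := fun y hy => by
    have hy' : sqDist y x₀ < sqDist q x₀ := hy
    by_contra hyV
    exact hy'.not_ge (hmin ⟨(hy'.trans_le hq1').le, hyV⟩)
  have hqcl : q ∈ closure V := by
    set f : ℝ → ℝ × ℝ := fun t => q + t • (x₀ - q) with hf
    have hfc : Continuous f := by fun_prop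
    have h0 : f 0 = q := by simp [hf]
    have h1 : f '' Ioo 0 1 ⊆ V := by
      rintro _ ⟨t, ht, rfl⟩
      refine hball ?_
      have h2 : sqDist (f t) x₀ = (1 - t) ^ 2 * sqDist q x₀ := by
        simp only [hf, sqDist, Prod.fst_add, Prod.snd_add, Prod.smul_fst, Prod.smul_snd,
          Prod.fst_sub, Prod.snd_sub, smul_eq_mul]
        ring
      show sqDist (f t) x₀ < sqDist q x₀
      rw [h2]
      exact mul_lt_of_lt_one_left hpos (pow_lt_one₀ (by linarith [ht.2]) (by linarith [ht.1])
        two_ne_zero)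
    rw [← h0]
    refine closure_mono h1 (image_closure_subset_closure_image hfc ⟨0, ?_, rfl⟩)
    rw [closure_Ioo zero_ne_one]
    exact ⟨le_rfl, zero_le_one⟩
  refine ⟨q, hqΩ, x₀, fun hqP => ?_, hqcl, hpos, hball.trans hVP⟩
  obtain ⟨y, hy1, hy2⟩ := mem_closure_iff_nhds.1 hqcl _
    (hP.connectedComponentIn.mem_nhds (mem_connectedComponentIn hqP))
  refine hq2 ?_
  show q ∈ connectedComponentIn P p
  rw [connectedComponentIn_eq hy2, ← connectedComponentIn_eq hy1]
  exact mem_connectedComponentIn hqP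

lemma exists_gain {Ω P : Set (ℝ × ℝ)} {B ψe : ℝ × ℝ → ℝ} (hΩ : IsOpen Ω) (hΩc : IsPreconnected Ω)
    (hψe : IsPosPotential P B ψe) (hPΩ : P ⊆ Ω) {η : ℝ} (hη : 0 < η) (hB : ∀ x ∈ Ω, -η ≤ B x)
    {p z₀ : ℝ × ℝ} (hp : p ∈ P) (hz : z₀ ∈ Ω) (hzP : z₀ ∉ P) :
    ∃ N ∈ 𝓝 p, HasGainOn Ω B ψe N := by
  obtain ⟨q, hqΩ, x₀, hqP, hqcl, hpos, hball⟩ :=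
    exists_interior_disc hΩ hΩc hψe.isOpen hPΩ hp hz hzP
  obtain ⟨N, hN, hg⟩ := hasGainOn_of_interior_disc hψe hPΩ hΩ hη hB hqΩ hqP hpos hball
  obtain ⟨x, hx, hxV⟩ := mem_closure_iff_nhds.1 hqcl _ (interior_mem_nhds.2 hN)
  exact hasGainOn_of_mem_component hψe hPΩ isPreconnected_connectedComponentIn
    (connectedComponentIn_subset P p) ⟨x, hxV, N, mem_interior_iff_mem_nhds.1 hx, hg⟩ p
    (mem_connectedComponentIn hp)

/-- Theorem 2.4 / `th1.6`: if `B⁻¹(0)` is either a compact `C^{2,α}`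
simple closed curve in `Ω`, or a `C^{2,α}` simple arc crossing `∂Ω` transversally away
from the corners, then the upper bound `2·inf_{Ω_B⁺} ψ̂₀` is not optimal:
`limsup_{h→0⁺} h·log λ₋^D(h,B,Ω) < 2·inf_{Ω_B⁺} ψ̂₀`. -/
theorem pauli_limsup_lt_inf_on_positivity_set (Ω : Set (ℝ × ℝ)) (B ψ₀ ψhat : ℝ × ℝ → ℝ)
    (α : ℝ) (hα : 0 < α)
    (hR : AssumptionR Ω B) (hsc : SimplyConnectedSpace Ω)
    (hψ₀ : IsScalarPotential Ω B ψ₀)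
    (hplus : ({x ∈ Ω | 0 < B x}).Nonempty)
    (hψ : IsScalarPotential {x ∈ Ω | 0 < B x} B ψhat)
    (hzero :
      -- either `B⁻¹(0)` is a compact `C^{2,α}` simple closed curve contained in `Ω` ...
      (IsC2ClosedCurve α (B ⁻¹' {0} ∩ closure Ω) ∧ IsCompact (B ⁻¹' {0} ∩ closure Ω) ∧
        B ⁻¹' {0} ∩ closure Ω ⊆ Ω) ∨
      -- ... or a `C^{2,α}` simple arc crossing `∂Ω` transversally away from the corners
      (∃ γ : ℝ → ℝ × ℝ, C2HolderOn α γ (Icc 0 1) ∧ InjOn γ (Icc 0 1) ∧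
        B ⁻¹' {0} ∩ closure Ω = γ '' Icc 0 1 ∧
        γ 0 ∈ frontier Ω ∧ γ 1 ∈ frontier Ω ∧ γ '' Ioo 0 1 ⊆ Ω ∧
        ∀ t ∈ ({0, 1} : Set ℝ),
          IsLocallyC2CurveAt α (frontier Ω) (γ t) ∧
          ∃ δ : ℝ → ℝ × ℝ, δ 0 = γ t ∧ DifferentiableAt ℝ δ 0 ∧
            (∃ ε > 0, frontier Ω ∩ Metric.ball (γ t) ε ⊆ range δ) ∧
            ∀ s u : ℝ, s • derivWithin γ (Icc 0 1) t + u • deriv δ 0 = 0 → s = 0 ∧ u = 0)) :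
    limsup (fun h : ℝ => h * Real.log (lambdaMinusD h (perpGrad ψ₀) B Ω)) (𝓝[>] 0)
      < 2 * sInf (ψhat '' {x ∈ Ω | 0 < B x}) := by
  have hΩ := hR.isOpen
  have hΩc : IsPreconnected Ω := isPreconnected_iff_preconnectedSpace.2 inferInstance
  set P := {x ∈ Ω | 0 < B x} with hP
  have hPΩ : P ⊆ Ω := fun x hx => hx.1
  have hPo : IsOpen P :=
    (hR.fieldCont.mono subset_closure).isOpen_inter_preimage hΩ isOpen_Ioi
  have hPb := hR.bounded.subset hPΩ
  obtain ⟨z₀, hz, hz0⟩ : ∃ z ∈ Ω, B z = 0 := by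
    rcases hzero with ⟨⟨γ, -, -, -, h1⟩, -, h2⟩ | ⟨γ, -, -, h1, -, -, h2, -⟩
    · have h3 : γ 0 ∈ B ⁻¹' {0} ∩ closure Ω := h1 ▸ mem_image_of_mem γ (by simp)
      exact ⟨γ 0, h2 h3, h3.1⟩
    · have h3 : γ (1 / 2) ∈ B ⁻¹' {0} ∩ closure Ω :=
        h1 ▸ mem_image_of_mem γ (by constructor <;> norm_num)
      exact ⟨γ (1 / 2), h2 (mem_image_of_mem γ (by constructor <;> norm_num)), h3.1⟩
  have hzP : z₀ ∉ P := fun h => by have := h.2; rw [hz0] at this; exact lt_irrefl _ this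
  obtain ⟨η, hη⟩ := hR.bounded.isCompact_closure.exists_bound_of_continuousOn hR.fieldCont
  have hη0 : 0 < |η| + 1 := by positivity
  have hB : ∀ x ∈ Ω, -(|η| + 1) ≤ B x := fun x hx => by
    have h1 := (abs_le.1 (hη x (subset_closure hx))).1
    have := le_abs_self η
    linarith
  have hψe := hψ.isPosPotential hPo hPb fun x hx => hx.2
  set ψe := P.indicator ψhat with hψe'
  have hne : (closure P).Nonempty := hplus.mono subset_closure
  obtain ⟨p, hp, hmin⟩ :=
    hPb.isCompact_closure.exists_isMinOn hne hψe.cont.continuousOn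
  have hpP : p ∈ P := by
    obtain ⟨y, hy⟩ := hplus
    exact hψe.mem_of_neg ((hmin (subset_closure hy)).trans_lt (hψe.neg y hy))
  have hinf : ψe p ≤ sInf (ψhat '' P) := by
    refine le_csInf (hplus.image ψhat) ?_
    rintro _ ⟨y, hy, rfl⟩
    have : ψe p ≤ ψe y := hmin (subset_closure hy)
    rwa [show ψe y = ψhat y from indicator_of_mem hy ψhat] at this
  obtain ⟨N, hN, κ, hκ, δ₀, hδ₀, hgain⟩ := exists_gain hΩ hΩc hψe hPΩ hη0 hB hpP hz hzP
  have hpn := hψe.neg p hpP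
  obtain ⟨δ, h1, h2, h3⟩ : ∃ δ ∈ Ioo 0 δ₀, 4 * δ < κ ∧ 19 * δ < 2 * κ := by
    refine ⟨min (δ₀ / 2) (κ / 10), ⟨by positivity, ?_⟩, ?_, ?_⟩
    · exact (min_le_left _ _).trans_lt (half_lt_self hδ₀)
    all_goals
      have := min_le_right (δ₀ / 2) (κ / 10)
      linarith
  obtain ⟨ψ, hψ1, -, hψ3⟩ := hgain δ h1
  have h4 := hψ3 p (mem_of_mem_nhds hN)
  refine (hψ1.limsup_le hΩ hR.bounded hψ₀ h1.1 (p := p) (by linarith)).trans_lt ?_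
  linarith
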